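/- For any 1 < p < ∞ and t₀ > 0 there exists a constant C > 0 such that the following holds. Let f : (−t₀,0) × ℝ³ → ℝ³ and g : (−t₀,0) × ℝ³ → ℝ be in L^p((−t₀,0) × ℝ³), both vanishing for x outside B₁. Define u(t,x) = ∫_{−t₀}^t ∫_{ℝ³} K(t−s, x−y) g(s,y) dy ds − ∫_{−t₀}^t ∫_{ℝ³} (∇_z K)(t−s, x−y) · f(s,y) dy ds. Then u(t,·) is weakly differentiable in x for almost every t ∈ (−t₀,0) and ∫_{−t₀}^0 ∫_{B₁} (|u(t,x)|^p + |∇u(t,x)|^p) dx dt ≤ C^p ( ‖f‖_{L^p((−t₀,0)×ℝ³)}^p + ‖g‖_{L^p((−t₀,0)×ℝ³)}^p ). -/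

import Mathlib

open MeasureTheory Set Metric
open scoped ENNReal NNReal

noncomputable section

/-- `ℝ³` with the Euclidean norm. -/
abbrev E3 := EuclideanSpace ℝ (Fin 3)

/-- Spatial partial derivative `∂ⱼ f` of a scalar function. -/
def pd (f : E3 → ℝ) (j : Fin 3) (x : E3) : ℝ :=
  fderiv ℝ f x (EuclideanSpace.single j 1)

/-- `|∇f|² = Σ_{i,j} |∂ⱼ fᵢ|²`. -/
def gradSq (f : E3 → E3) (x : E3) : ℝ :=
  ∑ i, ∑ j, (pd (fun y => f y i) j x) ^ 2

/-- `(u,P)` is a smooth solution of the incompressible Navier–Stokes equations on the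
open set `U ⊆ ℝ × ℝ³`: `u` and `P` are infinitely differentiable on `U`, and on `U` one has
`∂ₜuᵢ + Σⱼ uⱼ ∂ⱼuᵢ + ∂ᵢP − Δuᵢ = 0` and `div u = 0`. -/
def IsNSSolution (u : ℝ → E3 → E3) (P : ℝ → E3 → ℝ) (U : Set (ℝ × E3)) : Prop :=
  ContDiffOn ℝ (⊤ : ℕ∞) (fun q : ℝ × E3 => u q.1 q.2) U ∧
  ContDiffOn ℝ (⊤ : ℕ∞) (fun q : ℝ × E3 => P q.1 q.2) U ∧
  (∀ q ∈ U, ∀ i : Fin 3,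
    deriv (fun s => u s q.2 i) q.1
      + (∑ j, u q.1 q.2 j * pd (fun y => u q.1 y i) j q.2)
      + pd (fun y => P q.1 y) i q.2
      - ∑ j, pd (pd (fun y => u q.1 y i) j) j q.2 = 0) ∧
  (∀ q ∈ U, ∑ i, pd (fun y => u q.1 y i) i q.2 = 0)

/-- The heat kernel on `ℝ³`: `K(τ,z) = (4πτ)^{−3/2} exp(−|z|²/(4τ))`. -/
def heatK (τ : ℝ) (z : E3) : ℝ :=
  (4 * Real.pi * τ) ^ (-(3:ℝ)/2) * Real.exp (-‖z‖ ^ 2 / (4 * τ))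

/-- Young's inequality `‖K ⋆ F‖_p ≤ ‖K‖₁ ‖F‖_p` for nonnegative functions. -/
theorem lintegral_conv_rpow_le {G : Type*} [AddCommGroup G] [MeasurableSpace G]
    [MeasurableAdd₂ G] [MeasurableNeg G] {μ : Measure G} [SFinite μ] [μ.IsAddLeftInvariant]
    {p : ℝ} (hp : 1 < p) {K F : G → ℝ≥0∞} (hK : Measurable K) (hF : Measurable F) :
    ∫⁻ q, (∫⁻ r, K r * F (q - r) ∂μ) ^ p ∂μ ≤ (∫⁻ r, K r ∂μ) ^ p * ∫⁻ r, F r ^ p ∂μ := by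
  have hp0 : 0 < p := by linarith
  obtain ⟨q', hq'⟩ : ∃ q', q' = p / (p - 1) := ⟨_, rfl⟩
  have hpq : p.HolderConjugate q' := by
    rw [hq']; exact Real.HolderConjugate.conjExponent hp
  have hsum : 1 / p + 1 / q' = 1 := by
    have := hpq.inv_add_inv_eq_one
    simpa using this
  have hq0 : 0 < q' := hpq.symm.pos
  have step : ∀ q, (∫⁻ r, K r * F (q - r) ∂μ) ^ p
      ≤ (∫⁻ r, K r ∂μ) ^ (p - 1) * ∫⁻ r, K r * F (q - r) ^ p ∂μ := by
    intro q
    have hFm : Measurable fun r => F (q - r) := hF.comp (by fun_prop)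
    have h1 : ∀ r, K r * F (q - r) = (fun r => K r ^ (1 / q')) r
        * (fun r => K r ^ (1 / p) * F (q - r)) r := by
      intro r
      simp only
      rw [← mul_assoc, ← ENNReal.rpow_add_of_nonneg _ _ (by positivity) (by positivity), add_comm,
        hsum, ENNReal.rpow_one]
    have h2 := ENNReal.lintegral_mul_le_Lp_mul_Lq μ hpq.symm
      (f := fun r => K r ^ (1 / q')) (g := fun r => K r ^ (1 / p) * F (q - r))
      (hK.pow_const _).aemeasurable ((hK.pow_const _).mul hFm).aemeasurable
    have e1 : ∀ r, (K r ^ (1 / q')) ^ q' = K r := by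
      intro r; rw [← ENNReal.rpow_mul, one_div_mul_cancel hq0.ne', ENNReal.rpow_one]
    have e2 : ∀ r, (K r ^ (1 / p) * F (q - r)) ^ p = K r * F (q - r) ^ p := by
      intro r
      rw [ENNReal.mul_rpow_of_nonneg _ _ hp0.le, ← ENNReal.rpow_mul, one_div_mul_cancel hp0.ne',
        ENNReal.rpow_one]
    simp only [e1, e2] at h2
    have h3 : ∫⁻ r, K r * F (q - r) ∂μ ≤ (∫⁻ r, K r ∂μ) ^ (1 / q')
        * (∫⁻ r, K r * F (q - r) ^ p ∂μ) ^ (1 / p) := by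
      refine le_trans (le_of_eq ?_) h2
      exact lintegral_congr fun r => h1 r
    calc (∫⁻ r, K r * F (q - r) ∂μ) ^ p
        ≤ ((∫⁻ r, K r ∂μ) ^ (1 / q') * (∫⁻ r, K r * F (q - r) ^ p ∂μ) ^ (1 / p)) ^ p :=
          ENNReal.rpow_le_rpow h3 hp0.le
      _ = _ := by
        rw [ENNReal.mul_rpow_of_nonneg _ _ hp0.le, ← ENNReal.rpow_mul, ← ENNReal.rpow_mul,
          one_div_mul_cancel hp0.ne', ENNReal.rpow_one]
        congr 2
        rw [hq']; field_simp
  calc ∫⁻ q, (∫⁻ r, K r * F (q - r) ∂μ) ^ p ∂μ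
      ≤ ∫⁻ q, (∫⁻ r, K r ∂μ) ^ (p - 1) * ∫⁻ r, K r * F (q - r) ^ p ∂μ ∂μ :=
        lintegral_mono step
    _ = (∫⁻ r, K r ∂μ) ^ (p - 1) * ∫⁻ q, ∫⁻ r, K r * F (q - r) ^ p ∂μ ∂μ := by
        rw [lintegral_const_mul]
        apply Measurable.lintegral_prod_right' (f := fun z : G × G => K z.2 * F (z.1 - z.2) ^ p)
        fun_prop
    _ = (∫⁻ r, K r ∂μ) ^ (p - 1) * ∫⁻ r, ∫⁻ q, K r * F (q - r) ^ p ∂μ ∂μ := by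
        rw [lintegral_lintegral_swap]
        exact Measurable.aemeasurable (by fun_prop)
    _ = (∫⁻ r, K r ∂μ) ^ (p - 1) * ((∫⁻ r, K r ∂μ) * ∫⁻ r, F r ^ p ∂μ) := by
        congr 1
        rw [← lintegral_mul_const _ hK]
        refine lintegral_congr fun r => ?_
        rw [lintegral_const_mul _ (by fun_prop)]
        congr 1
        exact lintegral_sub_right_eq_self (fun q => F q ^ p) r
    _ = _ := by
        rw [← mul_assoc]
        congr 1
        have := ENNReal.rpow_add_of_nonneg (x := ∫⁻ r, K r ∂μ) (p - 1) 1 (by linarith) (by norm_num)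
        rw [ENNReal.rpow_one] at this
        rw [← this]; congr 1; ring

/-- Index of the parabolic dyadic cube of generation `n` that contains `q`. -/
def cell (n : ℤ) (q : ℝ × E3) : ℤ × (Fin 3 → ℤ) :=
  (⌊q.1 * (4:ℝ) ^ n⌋, fun i => ⌊q.2 i * (2:ℝ) ^ n⌋)

/-- The parabolic dyadic cube with a given generation and index. -/
def cube (s : ℤ × (ℤ × (Fin 3 → ℤ))) : Set (ℝ × E3) := cell s.1 ⁻¹' {s.2}

theorem measurable_cell (n : ℤ) : Measurable (cell n) := by
  unfold cell
  fun_prop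

theorem measurableSet_cube (s) : MeasurableSet (cube s) :=
  measurable_cell _ (measurableSet_singleton _)

theorem floor_mul_zpow_eq {b : ℕ} (hb : 0 < b) {m n : ℤ} (hmn : m ≤ n) (x : ℝ) :
    ⌊x * (b:ℝ) ^ m⌋ = ⌊x * (b:ℝ) ^ n⌋ / ((b ^ (n - m).toNat : ℕ) : ℤ) := by
  have h := Int.mul_cast_floor_div_cancel_of_pos (n := ((b ^ (n - m).toNat : ℕ) : ℤ))
    (by positivity) (x * (b:ℝ) ^ m)
  rw [← h]
  congr 2
  push_cast
  rw [mul_assoc, ← zpow_natCast, ← zpow_add₀ (by positivity), Int.toNat_of_nonneg (by omega)]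
  congr 2
  omega

theorem cell_eq_of_le {m n : ℤ} (hmn : m ≤ n) {q q' : ℝ × E3} (h : cell n q = cell n q') :
    cell m q = cell m q' := by
  simp only [cell, Prod.mk.injEq, funext_iff] at h ⊢
  have h4 : (4:ℝ) = ((4:ℕ):ℝ) := by norm_num
  have h2 : (2:ℝ) = ((2:ℕ):ℝ) := by norm_num
  rw [h4, h2] at h ⊢
  refine ⟨?_, fun i => ?_⟩
  · rw [floor_mul_zpow_eq (by norm_num) hmn, floor_mul_zpow_eq (by norm_num) hmn, h.1]
  · rw [floor_mul_zpow_eq (by norm_num) hmn, floor_mul_zpow_eq (by norm_num) hmn, h.2 i]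

theorem abs_sub_le_of_floor_eq {b : ℝ} (hb : 0 < b) {n : ℤ} {x y : ℝ}
    (h : ⌊x * b ^ n⌋ = ⌊y * b ^ n⌋) : |x - y| ≤ (b ^ n)⁻¹ := by
  have hb' : 0 < b ^ n := zpow_pos hb n
  have h1 := Int.abs_sub_lt_one_of_floor_eq_floor h
  rw [← sub_mul, abs_mul, abs_of_pos hb'] at h1
  rw [← one_div, le_div_iff₀ hb']
  exact h1.le

theorem E3_norm_le {x : E3} {r : ℝ} (hr : 0 ≤ r) (h : ∀ i, |x i| ≤ r) : ‖x‖ ≤ 2 * r := by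
  rw [EuclideanSpace.norm_eq]
  apply Real.sqrt_le_iff.2
  refine ⟨by positivity, ?_⟩
  have : ∀ i, ‖x i‖ ^ 2 ≤ r ^ 2 := fun i => by
    rw [Real.norm_eq_abs]; exact pow_le_pow_left₀ (abs_nonneg _) (h i) 2
  rw [Fin.sum_univ_three]
  nlinarith [this 0, this 1, this 2, sq_nonneg r]

theorem dist_of_cell_eq {n : ℤ} {q q' : ℝ × E3} (h : cell n q = cell n q') :
    |q.1 - q'.1| ≤ (((2:ℝ) ^ n)⁻¹) ^ 2 ∧ ‖q.2 - q'.2‖ ≤ 2 * ((2:ℝ) ^ n)⁻¹ := by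
  simp only [cell, Prod.mk.injEq, funext_iff] at h
  refine ⟨?_, E3_norm_le (by positivity) fun i => ?_⟩
  · have h1 := abs_sub_le_of_floor_eq (by norm_num) h.1
    refine h1.trans (le_of_eq ?_)
    rw [inv_pow, ← zpow_natCast, ← zpow_mul, show (4:ℝ) = 2 ^ (2:ℤ) by norm_num, ← zpow_mul]
    congr 2; push_cast; ring
  · simpa using abs_sub_le_of_floor_eq (by norm_num) (h.2 i)

theorem volume_E3_pi (s : Fin 3 → Set ℝ) (hs : ∀ i, MeasurableSet (s i)) :
    volume {x : E3 | ∀ i, x i ∈ s i} = ∏ i, volume (s i) := by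
  have h := (PiLp.volume_preserving_ofLp (Fin 3)).measure_preimage
    (s := Set.univ.pi s) (MeasurableSet.univ_pi hs).nullMeasurableSet
  rw [volume_pi_pi] at h
  rw [← h]
  congr 1
  ext x; simp

theorem volume_cube (s) : volume (cube s) = ENNReal.ofReal (((32:ℝ) ^ s.1)⁻¹) := by
  obtain ⟨n, a, c⟩ := s
  have hIco : ∀ (b : ℝ), 0 < b → ∀ (k : ℤ), {x : ℝ | ⌊x * b ^ n⌋ = k}
      = Ico (k * (b ^ n)⁻¹) ((k + 1) * (b ^ n)⁻¹) := by
    intro b hb k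
    ext x
    have hb' : 0 < b ^ n := zpow_pos hb n
    simp only [mem_ofPred_eq, Int.floor_eq_iff, mem_Ico]
    rw [← div_eq_mul_inv, ← div_eq_mul_inv, div_le_iff₀ hb', lt_div_iff₀ hb']
  have hvol : ∀ (b : ℝ), 0 < b → ∀ (k : ℤ), volume {x : ℝ | ⌊x * b ^ n⌋ = k}
      = ENNReal.ofReal ((b ^ n)⁻¹) := by
    intro b hb k
    rw [hIco b hb, Real.volume_Ico]; congr 1; ring
  have hset : cube (n, a, c) = {x : ℝ | ⌊x * (4:ℝ) ^ n⌋ = a}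
      ×ˢ {x : E3 | ∀ i, x i ∈ {x : ℝ | ⌊x * (2:ℝ) ^ n⌋ = c i}} := by
    ext q
    simp [cube, cell, funext_iff]
  rw [hset, Measure.volume_eq_prod, Measure.prod_prod, volume_E3_pi, hvol _ (by norm_num),
    Fin.prod_univ_three, hvol _ (by norm_num), hvol _ (by norm_num), hvol _ (by norm_num),
    ← ENNReal.ofReal_mul (by positivity), ← ENNReal.ofReal_mul (by positivity),
    ← ENNReal.ofReal_mul (by positivity)]
  · congr 1
    rw [← mul_inv, ← mul_inv, ← mul_inv, ← mul_zpow, ← mul_zpow, ← mul_zpow]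
    norm_num
  · intro i
    rw [hIco _ (by norm_num)]
    exact measurableSet_Ico

theorem exists_cz_cubes {f : ℝ × E3 → ℝ} (hf : Continuous f) (hfi : Integrable f)
    {l : ℝ} (hl : 0 < l) :
    ∃ S : Set (ℤ × (ℤ × (Fin 3 → ℤ))),
      S.PairwiseDisjoint cube ∧
      (∀ s ∈ S, (cube s).Nonempty ∧
        ENNReal.ofReal l * volume (cube s) ≤ ∫⁻ q in cube s, ‖f q‖ₑ ∧
        ∫⁻ q in cube s, ‖f q‖ₑ ≤ ENNReal.ofReal (32 * l) * volume (cube s)) ∧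
      ∀ q, q ∉ ⋃ s ∈ S, cube s → |f q| ≤ l := by
  set big : ℤ × (ℤ × (Fin 3 → ℤ)) → Prop := fun s =>
    ENNReal.ofReal l * volume (cube s) < ∫⁻ q in cube s, ‖f q‖ₑ with hbig
  set S : Set (ℤ × (ℤ × (Fin 3 → ℤ))) := {s | (cube s).Nonempty ∧ big s ∧
    ∀ q ∈ cube s, ∀ m < s.1, ¬ big (m, cell m q)} with hS
  have hkey : ∀ s ∈ S, ∀ t ∈ S, s.1 < t.1 → ∀ q, q ∈ cube s → q ∈ cube t → False := by
    intro s hs t ht hst q hqs hqt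
    refine ht.2.2 q hqt s.1 hst ?_
    have : (s.1, cell s.1 q) = s := Prod.ext rfl hqs
    rw [this]; exact hs.2.1
  refine ⟨S, ?_, ?_, ?_⟩
  · intro s hs t ht hst
    rw [Function.onFun, Set.disjoint_left]
    intro q hqs hqt
    rcases lt_trichotomy s.1 t.1 with h | h | h
    · exact hkey s hs t ht h q hqs hqt
    · apply hst
      refine Prod.ext h ?_
      have h1 : cell s.1 q = s.2 := hqs
      have h2 : cell t.1 q = t.2 := hqt
      rw [← h1, ← h2, h]
    · exact hkey t ht s hs h q hqt hqs
  · rintro s ⟨⟨q, hq⟩, hsb, hsm⟩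
    refine ⟨⟨q, hq⟩, hsb.le, ?_⟩
    have h1 := hsm q hq (s.1 - 1) (by omega)
    simp only [hbig, not_lt] at h1
    have hsub : cube s ⊆ cube (s.1 - 1, cell (s.1 - 1) q) := by
      intro q' hq'
      have hq1 : cell s.1 q = s.2 := hq
      have hq2 : cell s.1 q' = s.2 := hq'
      exact cell_eq_of_le (by omega) (hq2.trans hq1.symm)
    refine (lintegral_mono_set hsub).trans (h1.trans (le_of_eq ?_))
    rw [volume_cube, volume_cube, ← ENNReal.ofReal_mul hl.le, ← ENNReal.ofReal_mul (by positivity)]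
    congr 1
    simp only
    rw [zpow_sub_one₀ (by norm_num)]
    field_simp
  · intro q hq
    by_contra hlt
    push Not at hlt
    apply hq
    have hI : ∫⁻ q, ‖f q‖ₑ < ⊤ := hfi.2
    have hex : ∃ n, big (n, cell n q) := by
      obtain ⟨d, hd, hd'⟩ : ∃ d > 0, ∀ q', dist q' q < d → l < |f q'| := by
        have := (hf.abs.continuousAt (x := q)).eventually_const_lt hlt
        obtain ⟨d, hd, h⟩ := Metric.eventually_nhds_iff.1 this
        exact ⟨d, hd, fun q' hq' => h hq'⟩
      obtain ⟨n, hn⟩ : ∃ n : ℕ, (2⁻¹ : ℝ) ^ n < min (d / 2) 1 :=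
        exists_pow_lt_of_lt_one (by positivity) (by norm_num)
      refine ⟨n, ?_⟩
      have hpos : (0:ℝ) < (2⁻¹ : ℝ) ^ n := by positivity
      have hmem : ∀ q' ∈ cube ((n:ℤ), cell n q), l < |f q'| := by
        intro q' hq'
        obtain ⟨h1, h2⟩ := dist_of_cell_eq (show cell n q' = cell n q from hq')
        have e : ((2:ℝ) ^ (n:ℤ))⁻¹ = (2⁻¹ : ℝ) ^ n := by simp
        rw [e] at h1 h2
        have hn1 := hn.trans_le (min_le_left _ _)
        have hn2 := hn.trans_le (min_le_right _ _)
        apply hd'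
        rw [Prod.dist_eq, max_lt_iff, Real.dist_eq, dist_eq_norm]
        refine ⟨by nlinarith, by linarith⟩
      have hvol : volume (cube ((n:ℤ), cell n q)) ≠ 0 := by
        rw [volume_cube]; simp only [ne_eq, ENNReal.ofReal_eq_zero, not_le]; positivity
      simp only [hbig]
      have hc : ENNReal.ofReal l * volume (cube ((n:ℤ), cell n q))
          = ∫⁻ _ in cube ((n:ℤ), cell n q), ENNReal.ofReal l := by
        rw [lintegral_const, Measure.restrict_apply_univ]
      rw [hc]
      apply lintegral_strict_mono (by simpa using hvol) (by fun_prop)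
      · rw [← hc, volume_cube]; exact ENNReal.mul_ne_top ENNReal.ofReal_ne_top ENNReal.ofReal_ne_top
      · refine (ae_restrict_iff' (measurableSet_cube _)).2 (Filter.Eventually.of_forall fun q' hq' => ?_)
        rw [Real.enorm_eq_ofReal_abs]
        exact (ENNReal.ofReal_lt_ofReal_iff (hl.trans (hmem q' hq'))).2 (hmem q' hq')
    have hbdd : ∃ b, ∀ n, big (n, cell n q) → b ≤ n := by
      set I := (∫⁻ q, ‖f q‖ₑ).toReal with hIdef
      obtain ⟨b, hb⟩ : ∃ b : ℕ, I / l < (32:ℝ) ^ b := pow_unbounded_of_one_lt _ (by norm_num)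
      refine ⟨-b, fun n hn => ?_⟩
      by_contra hlt'
      push Not at hlt'
      simp only [hbig] at hn
      have h1 := hn.trans_le (setLIntegral_le_lintegral _ _)
      rw [volume_cube, ← ENNReal.ofReal_toReal hI.ne, ← ENNReal.ofReal_mul hl.le,
        ENNReal.ofReal_lt_ofReal_iff_of_nonneg (by positivity)] at h1
      have h2 : (32:ℝ) ^ b ≤ ((32:ℝ) ^ n)⁻¹ := by
        rw [← zpow_neg, ← zpow_natCast]
        exact zpow_le_zpow_right₀ (by norm_num) (by omega)
      rw [div_lt_iff₀ hl] at hb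
      simp only at h1
      nlinarith
    obtain ⟨n, hn, hmin⟩ := Int.exists_least_of_bdd hbdd hex
    refine mem_iUnion₂.2 ⟨(n, cell n q), ⟨⟨q, rfl⟩, hn, ?_⟩, rfl⟩
    intro q' hq' m hm hb
    have : cell m q' = cell m q := cell_eq_of_le hm.le hq'
    rw [this] at hb
    exact absurd (hmin m hb) (not_le.2 hm)

instance : (volume : Measure (ℝ × E3)).IsAddHaarMeasure := by
  exact Measure.prod.instIsAddHaarMeasure _ _

/-- Convolution on space-time, `(k ⋆ f)(q) = ∫ k(q - r) f(r) dr`. -/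
def cv (k f : ℝ × E3 → ℝ) (q : ℝ × E3) : ℝ := ∫ r, k (q - r) * f r

/-- Parabolic box of radius `4 r` centred at the origin. -/
def box (r : ℝ) : Set (ℝ × E3) := {x | |x.1| < 4 * r ^ 2 ∧ ‖x.2‖ < 4 * r}

/-- A bounded parabolic Calderón–Zygmund kernel, with constant `A` in the `L²` bound
and in the Hörmander condition. -/
structure IsCZKernel (k : ℝ × E3 → ℝ) (A : ℝ≥0∞) : Prop where
  measurable : Measurable k
  bounded : ∃ B, ∀ q, |k q| ≤ B
  l2 : ∀ g : ℝ × E3 → ℝ, Measurable g → Integrable g → (∃ M, ∀ q, |g q| ≤ M) →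
    ∫⁻ q, ‖cv k g q‖ₑ ^ 2 ≤ A * ∫⁻ q, ‖g q‖ₑ ^ 2
  hormander : ∀ r > 0, ∀ y : ℝ × E3, |y.1| ≤ r ^ 2 → ‖y.2‖ ≤ 2 * r →
    ∫⁻ x in (box r)ᶜ, ‖k (x - y) - k x‖ₑ ≤ A

theorem measurableSet_box (r : ℝ) : MeasurableSet (box r) := by
  unfold box
  have h1 : Measurable fun x : ℝ × E3 => |x.1| := by fun_prop
  have h2 : Measurable fun x : ℝ × E3 => ‖x.2‖ := by fun_prop
  exact (measurableSet_lt h1 measurable_const).inter (measurableSet_lt h2 measurable_const)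

theorem volume_box_le (n : ℤ) :
    volume (box ((2:ℝ) ^ n)⁻¹) ≤ 4096 * ENNReal.ofReal (((32:ℝ) ^ n)⁻¹) := by
  set r : ℝ := ((2:ℝ) ^ n)⁻¹ with hr
  have hr0 : 0 < r := by positivity
  have hsub : box r ⊆ Ioo (-(4 * r ^ 2)) (4 * r ^ 2) ×ˢ
      {x : E3 | ∀ i, x i ∈ Ioo (-(4 * r)) (4 * r)} := by
    rintro q ⟨h1, h2⟩
    refine ⟨abs_lt.1 h1, fun i => abs_lt.1 (lt_of_le_of_lt ?_ h2)⟩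
    rw [← Real.norm_eq_abs]; exact PiLp.norm_apply_le q.2 i
  refine (measure_mono hsub).trans (le_of_eq ?_)
  rw [Measure.volume_eq_prod, Measure.prod_prod, volume_E3_pi _ (fun _ => measurableSet_Ioo),
    Fin.prod_univ_three, Real.volume_Ioo, Real.volume_Ioo,
    ← ENNReal.ofReal_mul (by linarith), ← ENNReal.ofReal_mul (by nlinarith),
    ← ENNReal.ofReal_mul (by nlinarith), show (4096:ℝ≥0∞) = ENNReal.ofReal 4096 by norm_num,
    ← ENNReal.ofReal_mul (by norm_num)]
  congr 1
  have : ((32:ℝ) ^ n)⁻¹ = r ^ 5 := by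
    rw [hr, inv_pow, ← zpow_natCast, ← zpow_mul, show (32:ℝ) = 2 ^ (5:ℤ) by norm_num, ← zpow_mul]
    congr 2; push_cast; ring
  rw [this]; ring

section

variable {k : ℝ × E3 → ℝ} {A : ℝ≥0∞}

theorem IsCZKernel.integrable_mul (hk : IsCZKernel k A) {f : ℝ × E3 → ℝ} (hf : Integrable f)
    (q : ℝ × E3) : Integrable fun r => k (q - r) * f r := by
  obtain ⟨B, hB⟩ := hk.bounded
  refine hf.bdd_mul (c := B) ?_ (Filter.Eventually.of_forall fun r => hB _)
  exact (hk.measurable.comp (by fun_prop)).aestronglyMeasurable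

theorem measurable_cv (hk : Measurable k) {f : ℝ × E3 → ℝ} (hf : Measurable f) :
    Measurable (cv k f) := by
  refine (StronglyMeasurable.integral_prod_right (f := fun q r => k (q - r) * f r) ?_).measurable
  apply Measurable.stronglyMeasurable
  fun_prop

theorem cv_sub (hk : IsCZKernel k A) {f g : ℝ × E3 → ℝ} (hf : Integrable f) (hg : Integrable g)
    (q : ℝ × E3) : cv k (fun r => f r - g r) q = cv k f q - cv k g q := by
  unfold cv
  rw [← integral_sub (hk.integrable_mul hf q) (hk.integrable_mul hg q)]
  congr 1; ext r; ring

/-- Outside an enlarged cube, the kernel acts on a mean-zero function on the cube as an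
`L¹`-bounded operator. -/
theorem lintegral_cv_atom_le (hk : IsCZKernel k A) {b : ℝ × E3 → ℝ} (hbm : Measurable b)
    (hb : Integrable b) {s : ℤ × (ℤ × (Fin 3 → ℤ))} {c : ℝ × E3} (hc : c ∈ cube s)
    (h0 : ∫ y in cube s, b y = 0) :
    ∫⁻ x in {x | x - c ∉ box ((2:ℝ) ^ s.1)⁻¹}, ‖∫ y in cube s, k (x - y) * b y‖ₑ
      ≤ A * ∫⁻ y in cube s, ‖b y‖ₑ := by
  set r : ℝ := ((2:ℝ) ^ s.1)⁻¹ with hr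
  have hr0 : 0 < r := by positivity
  have hkm := hk.measurable
  have hms : MeasurableSet {x | x - c ∉ box r} :=
    ((measurable_id.sub_const c) (measurableSet_box r)).compl
  have h1 : ∀ x, ‖∫ y in cube s, k (x - y) * b y‖ₑ
      ≤ ∫⁻ y in cube s, ‖k (x - y) - k (x - c)‖ₑ * ‖b y‖ₑ := by
    intro x
    have : ∫ y in cube s, k (x - y) * b y = ∫ y in cube s, (k (x - y) - k (x - c)) * b y := by
      simp_rw [sub_mul]
      rw [integral_sub (hk.integrable_mul hb x).integrableOn (hb.integrableOn.const_mul _),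
        integral_const_mul, h0, mul_zero, sub_zero]
    rw [this]
    refine (enorm_integral_le_lintegral_enorm _).trans (le_of_eq ?_)
    simp_rw [enorm_mul]
  have h2 : ∀ y ∈ cube s, ∫⁻ x in {x | x - c ∉ box r}, ‖k (x - y) - k (x - c)‖ₑ ≤ A := by
    intro y hy
    obtain ⟨d1, d2⟩ := dist_of_cell_eq (show cell s.1 y = cell s.1 c from Eq.trans hy (Eq.symm hc))
    have := hk.hormander r hr0 (y - c) d1 d2
    rw [← lintegral_indicator (measurableSet_box r).compl] at this
    rw [← lintegral_indicator hms]
    rw [← lintegral_sub_right_eq_self _ c] at this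
    refine le_trans (le_of_eq (lintegral_congr fun x => ?_)) this
    by_cases hx : x - c ∈ box r
    · simp [hx]
    · simp [hx]
  calc _ ≤ ∫⁻ x in {x | x - c ∉ box r}, ∫⁻ y in cube s, ‖k (x - y) - k (x - c)‖ₑ * ‖b y‖ₑ :=
        lintegral_mono h1
    _ = ∫⁻ y in cube s, ∫⁻ x in {x | x - c ∉ box r}, ‖k (x - y) - k (x - c)‖ₑ * ‖b y‖ₑ := by
        rw [lintegral_lintegral_swap]
        apply Measurable.aemeasurable
        fun_prop
    _ ≤ ∫⁻ y in cube s, A * ‖b y‖ₑ := by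
        refine setLIntegral_mono' (measurableSet_cube s) fun y hy => ?_
        rw [lintegral_mul_const _ (by fun_prop)]
        gcongr
        exact h2 y hy
    _ = _ := lintegral_const_mul _ (by fun_prop)

/-- Weak type `(1,1)` estimate for Calderón–Zygmund kernels. -/
theorem IsCZKernel.weak_type (hk : IsCZKernel k A) {f : ℝ × E3 → ℝ} (hf : Continuous f)
    (hfi : Integrable f) {l : ℝ} (hl : 0 < l) :
    ENNReal.ofReal l * volume {q | l < |cv k f q|} ≤ (4096 + 132 * A) * ∫⁻ q, ‖f q‖ₑ := by
  classical
  obtain ⟨S, hSd, hS, hSc⟩ := exists_cz_cubes hf hfi hl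
  have hScount : S.Countable := S.to_countable
  set Ω : Set (ℝ × E3) := ⋃ s ∈ S, cube s with hΩ
  have hΩm : MeasurableSet Ω := MeasurableSet.biUnion hScount fun s _ => measurableSet_cube s
  set avg : ℤ × (ℤ × (Fin 3 → ℤ)) → ℝ := fun s => (32:ℝ) ^ s.1 * ∫ q in cube s, f q with havg
  set g : ℝ × E3 → ℝ := fun q => if h : ∃ s ∈ S, q ∈ cube s then avg h.choose else f q with hg
  have hgS : ∀ s ∈ S, ∀ q ∈ cube s, g q = avg s := by
    intro s hs q hq
    have h : ∃ s ∈ S, q ∈ cube s := ⟨s, hs, hq⟩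
    have h2 : h.choose = s := hSd.elim h.choose_spec.1 hs
      (Set.not_disjoint_iff.2 ⟨q, h.choose_spec.2, hq⟩)
    simp only [hg, dif_pos h, h2]
  have hgΩ : ∀ q, q ∉ Ω → g q = f q := by
    intro q hq
    have h : ¬ ∃ s ∈ S, q ∈ cube s := by simpa [hΩ] using hq
    simp only [hg, dif_neg h]
  have hgm : Measurable g := by
    intro U hU
    have : g ⁻¹' U = (Ωᶜ ∩ f ⁻¹' U) ∪ ⋃ s ∈ {s ∈ S | avg s ∈ U}, cube s := by
      ext q
      by_cases hq : q ∈ Ω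
      · obtain ⟨s, hs, hqs⟩ := mem_iUnion₂.1 hq
        simp only [mem_preimage, hgS s hs q hqs, mem_union, mem_inter_iff, mem_compl_iff, hq,
          not_true_eq_false, false_and, false_or, mem_iUnion, exists_prop]
        constructor
        · intro h; exact ⟨s, ⟨hs, h⟩, hqs⟩
        · rintro ⟨t, ⟨ht, htU⟩, hqt⟩
          rwa [← hgS s hs q hqs, hgS t ht q hqt]
      · simp only [mem_preimage, hgΩ q hq, mem_union, mem_inter_iff, mem_compl_iff, hq,
          not_false_eq_true, true_and, mem_iUnion, exists_prop]
        refine ⟨Or.inl, ?_⟩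
        rintro (h | ⟨t, ⟨ht, htU⟩, hqt⟩)
        · exact h
        · exact absurd (mem_iUnion₂.2 ⟨t, ht, hqt⟩) hq
    rw [this]
    exact (hΩm.compl.inter (hf.measurable hU)).union
      (MeasurableSet.biUnion (hScount.mono fun s hs => hs.1) fun s _ => measurableSet_cube s)
  have hvol0 : ∀ s, volume (cube s) ≠ 0 := fun s => by
    rw [volume_cube]; simp only [ne_eq, ENNReal.ofReal_eq_zero, not_le]; positivity
  have hvolT : ∀ s, volume (cube s) ≠ ⊤ := fun s => by
    rw [volume_cube]; exact ENNReal.ofReal_ne_top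
  have havgle : ∀ s, ‖avg s‖ₑ * volume (cube s) ≤ ∫⁻ q in cube s, ‖f q‖ₑ := by
    intro s
    rw [volume_cube]
    simp only [havg]
    rw [enorm_mul, Real.enorm_of_nonneg (by positivity : (0:ℝ) ≤ (32:ℝ) ^ s.1), mul_right_comm,
      ← ENNReal.ofReal_mul (by positivity), mul_inv_cancel₀ (by positivity), ENNReal.ofReal_one,
      one_mul]
    exact enorm_integral_le_lintegral_enorm _
  have havgb : ∀ s ∈ S, |avg s| ≤ 32 * l := by
    intro s hs
    have h1 := (havgle s).trans (hS s hs).2.2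
    rw [ENNReal.mul_le_mul_iff_left (hvol0 s) (hvolT s), Real.enorm_eq_ofReal_abs,
      ENNReal.ofReal_le_ofReal_iff (by positivity)] at h1
    exact h1
  have hgb : ∀ q, |g q| ≤ 32 * l := by
    intro q
    by_cases hq : q ∈ Ω
    · obtain ⟨s, hs, hqs⟩ := mem_iUnion₂.1 hq
      rw [hgS s hs q hqs]; exact havgb s hs
    · rw [hgΩ q hq]; have := hSc q hq; linarith
  have hgint : ∫⁻ q, ‖g q‖ₑ ≤ ∫⁻ q, ‖f q‖ₑ := by
    rw [← lintegral_add_compl _ hΩm, ← lintegral_add_compl (fun q => ‖f q‖ₑ) hΩm]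
    refine add_le_add ?_ (le_of_eq (setLIntegral_congr_fun hΩm.compl fun q hq => by rw [hgΩ q hq]))
    rw [hΩ, lintegral_biUnion hScount (fun s _ => measurableSet_cube s) hSd,
      lintegral_biUnion hScount (fun s _ => measurableSet_cube s) hSd]
    refine ENNReal.tsum_le_tsum fun s => ?_
    refine le_trans (le_of_eq ?_) (havgle s)
    rw [setLIntegral_congr_fun (measurableSet_cube _)
      (g := fun _ => ‖avg s‖ₑ) fun q hq => by rw [hgS s s.2 q hq]]
    rw [lintegral_const, Measure.restrict_apply_univ]
  have hI : ∫⁻ q, ‖f q‖ₑ < ⊤ := hfi.2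
  have hgi : Integrable g := ⟨hgm.aestronglyMeasurable, hgint.trans_lt hI⟩
  set b : ℝ × E3 → ℝ := fun q => f q - g q with hb
  have hbm : Measurable b := hf.measurable.sub hgm
  have hbi : Integrable b := hfi.sub hgi
  have hbint : ∫⁻ q, ‖b q‖ₑ ≤ 2 * ∫⁻ q, ‖f q‖ₑ := by
    calc ∫⁻ q, ‖b q‖ₑ ≤ ∫⁻ q, (‖f q‖ₑ + ‖g q‖ₑ) := lintegral_mono fun q => enorm_sub_le
      _ = (∫⁻ q, ‖f q‖ₑ) + ∫⁻ q, ‖g q‖ₑ := lintegral_add_left (by fun_prop) _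
      _ ≤ _ := by rw [two_mul]; gcongr
  have hb0 : ∀ s ∈ S, ∫ y in cube s, b y = 0 := by
    intro s hs
    have : ∫ y in cube s, b y = ∫ y in cube s, (f y - avg s) :=
      setIntegral_congr_fun (measurableSet_cube s) fun y hy => by simp only [hb, hgS s hs y hy]
    have hci : IntegrableOn (fun _ => avg s) (cube s) :=
      integrableOn_const (hvolT s)
    rw [this, integral_sub hfi.integrableOn hci, setIntegral_const, Measure.real, volume_cube,
      ENNReal.toReal_ofReal (by positivity), smul_eq_mul]
    simp only [havg]
    rw [← mul_assoc, inv_mul_cancel₀ (by positivity), one_mul, sub_self]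
  have hbΩ : ∀ q, q ∉ Ω → b q = 0 := fun q hq => by simp [hb, hgΩ q hq]
  choose! c hc using fun s hs => (hS s hs).1
  set Ω' : Set (ℝ × E3) := ⋃ s ∈ S, {x | x - c s ∈ box ((2:ℝ) ^ s.1)⁻¹} with hΩ'
  have hboxm : ∀ s : ℤ × (ℤ × (Fin 3 → ℤ)), MeasurableSet {x | x - c s ∈ box ((2:ℝ) ^ s.1)⁻¹} :=
    fun s => (measurable_id.sub_const (c s)) (measurableSet_box _)
  have hΩ'm : MeasurableSet Ω' := MeasurableSet.biUnion hScount fun s _ => hboxm s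
  have hsumf : ∑' s : S, ∫⁻ q in cube s.1, ‖f q‖ₑ ≤ ∫⁻ q, ‖f q‖ₑ := by
    rw [← lintegral_biUnion hScount (fun s _ => measurableSet_cube s) hSd]
    exact setLIntegral_le_lintegral _ _
  -- the enlarged cubes
  have E1 : ENNReal.ofReal l * volume Ω' ≤ 4096 * ∫⁻ q, ‖f q‖ₑ := by
    calc ENNReal.ofReal l * volume Ω'
        ≤ ENNReal.ofReal l * ∑' s : S, volume {x | x - c s.1 ∈ box ((2:ℝ) ^ s.1.1)⁻¹} := by
          gcongr; exact measure_biUnion_le volume hScount _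
      _ = ∑' s : S, ENNReal.ofReal l * volume {x | x - c s.1 ∈ box ((2:ℝ) ^ s.1.1)⁻¹} :=
          ENNReal.tsum_mul_left.symm
      _ ≤ ∑' s : S, 4096 * ∫⁻ q in cube s.1, ‖f q‖ₑ := by
          refine ENNReal.tsum_le_tsum fun s => ?_
          have h1 : volume {x | x - c s.1 ∈ box ((2:ℝ) ^ s.1.1)⁻¹} = volume (box ((2:ℝ) ^ s.1.1)⁻¹) :=
            by
              simp_rw [sub_eq_add_neg]
              exact measure_preimage_add_right volume (-c s.1) (box ((2:ℝ) ^ s.1.1)⁻¹)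
          rw [h1]
          calc _ ≤ ENNReal.ofReal l * (4096 * ENNReal.ofReal (((32:ℝ) ^ s.1.1)⁻¹)) := by
                gcongr; exact volume_box_le _
            _ = 4096 * (ENNReal.ofReal l * volume (cube s.1)) := by rw [volume_cube]; ring
            _ ≤ _ := by gcongr; exact (hS s s.2).2.1
      _ = 4096 * ∑' s : S, ∫⁻ q in cube s.1, ‖f q‖ₑ := ENNReal.tsum_mul_left
      _ ≤ _ := by gcongr
  -- the good part
  have E2 : ENNReal.ofReal l * volume {q | l / 2 < |cv k g q|} ≤ 128 * A * ∫⁻ q, ‖f q‖ₑ := by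
    have h1 : ∫⁻ q, ‖g q‖ₑ ^ 2 ≤ ENNReal.ofReal (32 * l) * ∫⁻ q, ‖f q‖ₑ := by
      calc ∫⁻ q, ‖g q‖ₑ ^ 2 ≤ ∫⁻ q, ENNReal.ofReal (32 * l) * ‖g q‖ₑ := by
            refine lintegral_mono fun q => ?_
            simp only
            rw [sq]; gcongr
            rw [Real.enorm_eq_ofReal_abs]
            exact ENNReal.ofReal_le_ofReal (hgb q)
        _ = ENNReal.ofReal (32 * l) * ∫⁻ q, ‖g q‖ₑ := lintegral_const_mul _ (by fun_prop)
        _ ≤ _ := by gcongr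
    have h2 := (hk.l2 g hgm hgi ⟨_, hgb⟩).trans (mul_le_mul_right h1 A)
    have h3 := mul_meas_ge_le_lintegral₀ (μ := volume)
      ((measurable_cv hk.measurable hgm).enorm.pow_const 2).aemeasurable (ENNReal.ofReal ((l / 2) ^ 2))
    have h4 : volume {q | l / 2 < |cv k g q|}
        ≤ volume {q | ENNReal.ofReal ((l / 2) ^ 2) ≤ ‖cv k g q‖ₑ ^ 2} := by
      refine measure_mono fun q hq => ?_
      have hq' : l / 2 < |cv k g q| := hq
      rw [Set.mem_ofPred_eq]
      rw [Real.enorm_eq_ofReal_abs, ← ENNReal.ofReal_pow (abs_nonneg _)]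
      exact ENNReal.ofReal_le_ofReal (pow_le_pow_left₀ (by positivity) hq'.le 2)
    have h5 : ENNReal.ofReal l = ENNReal.ofReal (4 / l) * ENNReal.ofReal ((l / 2) ^ 2) := by
      rw [← ENNReal.ofReal_mul (by positivity)]; congr 1; field_simp; norm_num
    calc ENNReal.ofReal l * volume {q | l / 2 < |cv k g q|}
        ≤ ENNReal.ofReal (4 / l) * (ENNReal.ofReal ((l / 2) ^ 2)
          * volume {q | ENNReal.ofReal ((l / 2) ^ 2) ≤ ‖cv k g q‖ₑ ^ 2}) := by
          rw [h5, mul_assoc]; gcongr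
      _ ≤ ENNReal.ofReal (4 / l) * (A * (ENNReal.ofReal (32 * l) * ∫⁻ q, ‖f q‖ₑ)) :=
          mul_le_mul_right (h3.trans h2) _
      _ = (ENNReal.ofReal (4 / l) * ENNReal.ofReal (32 * l)) * (A * ∫⁻ q, ‖f q‖ₑ) := by ring
      _ = _ := by
          rw [← ENNReal.ofReal_mul (by positivity), show 4 / l * (32 * l) = 128 by field_simp; norm_num]
          rw [show ENNReal.ofReal 128 = 128 by norm_num]; ring
  -- the bad part
  have E3' : ENNReal.ofReal l * volume (Ω'ᶜ ∩ {q | l / 2 < |cv k b q|})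
      ≤ 4 * A * ∫⁻ q, ‖f q‖ₑ := by
    have h1 : ∀ x, ‖cv k b x‖ₑ ≤ ∑' s : S, ‖∫ y in cube s.1, k (x - y) * b y‖ₑ := by
      intro x
      have e1 : cv k b x = ∫ y in ⋃ s : S, cube s.1, k (x - y) * b y := by
        unfold cv
        rw [setIntegral_eq_integral_of_forall_compl_eq_zero]
        intro y hy
        rw [hbΩ y (by rwa [hΩ, biUnion_eq_iUnion]), mul_zero]
      have e2 := hasSum_integral_iUnion (μ := volume) (s := fun s : S => cube s.1)
        (f := fun y => k (x - y) * b y) (fun s => measurableSet_cube s.1)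
        (fun s t hst => hSd s.2 t.2 (fun h => hst (Subtype.ext h)))
        (hk.integrable_mul hbi x).integrableOn
      rw [e1, ← e2.tsum_eq]
      exact enorm_tsum_le_tsum_enorm
    have h2 : ∫⁻ x in Ω'ᶜ, ‖cv k b x‖ₑ ≤ 2 * A * ∫⁻ q, ‖f q‖ₑ := by
      calc ∫⁻ x in Ω'ᶜ, ‖cv k b x‖ₑ
          ≤ ∫⁻ x in Ω'ᶜ, ∑' s : S, ‖∫ y in cube s.1, k (x - y) * b y‖ₑ := lintegral_mono h1
        _ = ∑' s : S, ∫⁻ x in Ω'ᶜ, ‖∫ y in cube s.1, k (x - y) * b y‖ₑ := by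
            rw [lintegral_tsum]
            intro s
            apply AEMeasurable.enorm
            apply Measurable.aemeasurable
            refine (StronglyMeasurable.integral_prod_right
              (f := fun x y => k (x - y) * b y) ?_).measurable
            have := hk.measurable
            apply Measurable.stronglyMeasurable
            fun_prop
        _ ≤ ∑' s : S, A * ∫⁻ y in cube s.1, ‖b y‖ₑ := by
            refine ENNReal.tsum_le_tsum fun s => ?_
            refine le_trans (lintegral_mono_set ?_)
              (lintegral_cv_atom_le hk hbm hbi (hc s.1 s.2) (hb0 s.1 s.2))
            intro x hx hx'
            exact hx (mem_iUnion₂.2 ⟨s.1, s.2, hx'⟩)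
        _ = A * ∑' s : S, ∫⁻ y in cube s.1, ‖b y‖ₑ := ENNReal.tsum_mul_left
        _ ≤ A * ∫⁻ y, ‖b y‖ₑ := by
            gcongr
            rw [← lintegral_biUnion hScount (fun s _ => measurableSet_cube s) hSd]
            exact setLIntegral_le_lintegral _ _
        _ ≤ A * (2 * ∫⁻ q, ‖f q‖ₑ) := by gcongr
        _ = _ := by ring
    have h3 := mul_meas_ge_le_lintegral₀ (μ := volume.restrict Ω'ᶜ)
      (measurable_cv hk.measurable hbm).enorm.aemeasurable (ENNReal.ofReal (l / 2))
    have h4 : volume (Ω'ᶜ ∩ {q | l / 2 < |cv k b q|})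
        ≤ volume.restrict Ω'ᶜ {q | ENNReal.ofReal (l / 2) ≤ ‖cv k b q‖ₑ} := by
      rw [Measure.restrict_apply (measurableSet_le measurable_const
        (measurable_cv hk.measurable hbm).enorm), inter_comm]
      refine measure_mono (inter_subset_inter_left _ fun q hq => ?_)
      have hq' : l / 2 < |cv k b q| := hq
      rw [Set.mem_ofPred_eq]
      rw [Real.enorm_eq_ofReal_abs]
      exact ENNReal.ofReal_le_ofReal hq'.le
    have h5 : ENNReal.ofReal l = 2 * ENNReal.ofReal (l / 2) := by
      rw [show (2:ℝ≥0∞) = ENNReal.ofReal 2 by norm_num, ← ENNReal.ofReal_mul (by positivity)]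
      congr 1; ring
    calc ENNReal.ofReal l * volume (Ω'ᶜ ∩ {q | l / 2 < |cv k b q|})
        ≤ 2 * (ENNReal.ofReal (l / 2)
          * volume.restrict Ω'ᶜ {q | ENNReal.ofReal (l / 2) ≤ ‖cv k b q‖ₑ}) := by
          rw [h5, mul_assoc]; gcongr
      _ ≤ 2 * (2 * A * ∫⁻ q, ‖f q‖ₑ) := mul_le_mul_right (h3.trans h2) _
      _ = _ := by ring
  have hsub : {q | l < |cv k f q|} ⊆ {q | l / 2 < |cv k g q|} ∪ Ω' ∪
      (Ω'ᶜ ∩ {q | l / 2 < |cv k b q|}) := by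
    intro q hq
    by_contra hcon
    simp only [mem_union, mem_inter_iff, mem_compl_iff, mem_ofPred_eq, not_or, not_and, not_lt] at hcon
    obtain ⟨⟨h1, h2⟩, h3⟩ := hcon
    have h4 := cv_sub hk hfi hgi q
    have h5 := h3 h2
    have h6 : cv k f q = cv k b q + cv k g q := by rw [← sub_eq_iff_eq_add, ← h4]
    have h7 := abs_add_le (cv k b q) (cv k g q)
    rw [← h6] at h7
    have hq' : l < |cv k f q| := hq
    linarith
  calc ENNReal.ofReal l * volume {q | l < |cv k f q|}
      ≤ ENNReal.ofReal l * (volume {q | l / 2 < |cv k g q|} + volume Ω' +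
        volume (Ω'ᶜ ∩ {q | l / 2 < |cv k b q|})) := by
        gcongr
        exact (measure_mono hsub).trans ((measure_union_le _ _).trans
          (add_le_add_left (measure_union_le _ _) _))
    _ ≤ 128 * A * (∫⁻ q, ‖f q‖ₑ) + 4096 * (∫⁻ q, ‖f q‖ₑ) + 4 * A * ∫⁻ q, ‖f q‖ₑ := by
        rw [mul_add, mul_add]; gcongr
    _ = _ := by ring

end

theorem lintegral_Ioc_rpow {a s : ℝ} (ha : 0 ≤ a) (hs : -1 < s) :
    ∫⁻ l in Ioc 0 a, ENNReal.ofReal (l ^ s) = ENNReal.ofReal (a ^ (s + 1) / (s + 1)) := by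
  have hi : IntegrableOn (fun l : ℝ => l ^ s) (Ioc 0 a) :=
    (intervalIntegrable_iff_integrableOn_Ioc_of_le ha).1 (intervalIntegral.intervalIntegrable_rpow' hs)
  rw [← ofReal_integral_eq_lintegral_ofReal hi, ← intervalIntegral.integral_of_le ha,
    integral_rpow (Or.inl hs), Real.zero_rpow (by linarith), sub_zero]
  exact (ae_restrict_iff' measurableSet_Ioc).2 (Filter.Eventually.of_forall fun l hl =>
    Real.rpow_nonneg hl.1.le _)

theorem lintegral_Ioi_rpow {a s : ℝ} (ha : 0 < a) (hs : s < -1) :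
    ∫⁻ l in Ioi a, ENNReal.ofReal (l ^ s) = ENNReal.ofReal (-a ^ (s + 1) / (s + 1)) := by
  rw [← ofReal_integral_eq_lintegral_ofReal (integrableOn_Ioi_rpow_of_lt hs ha),
    integral_Ioi_rpow_of_lt hs ha]
  exact (ae_restrict_iff' measurableSet_Ioi).2 (Filter.Eventually.of_forall fun l hl =>
    Real.rpow_nonneg (ha.trans hl).le _)

theorem lintegral_rpow_mul_min_sq_le {p a : ℝ} (hp : 1 < p) (hp2 : p < 2) (ha : 0 ≤ a) :
    ∫⁻ l in Ioi 0, ENNReal.ofReal (l ^ (p - 3) * (min a l) ^ 2)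
      ≤ ENNReal.ofReal ((1 / p + 1 / (2 - p)) * a ^ p) := by
  rcases ha.eq_or_lt with rfl | ha0
  · refine le_of_eq_of_le ?_ zero_le
    rw [setLIntegral_congr_fun measurableSet_Ioi (g := fun _ => 0), lintegral_zero]
    intro l hl
    simp [min_eq_left (le_of_lt (show (0:ℝ) < l from hl))]
  rw [← Ioc_union_Ioi_eq_Ioi ha, lintegral_union measurableSet_Ioi (Ioc_disjoint_Ioi le_rfl)]
  have h1 : ∫⁻ l in Ioc 0 a, ENNReal.ofReal (l ^ (p - 3) * (min a l) ^ 2)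
      = ENNReal.ofReal (a ^ p / p) := by
    have := lintegral_Ioc_rpow ha (s := p - 1) (by linarith)
    rw [sub_add_cancel] at this
    rw [← this]
    refine setLIntegral_congr_fun measurableSet_Ioc fun l hl => ?_
    rw [min_eq_right hl.2, ← Real.rpow_natCast, ← Real.rpow_add hl.1]
    congr 2; push_cast; ring
  have h2 : ∫⁻ l in Ioi a, ENNReal.ofReal (l ^ (p - 3) * (min a l) ^ 2)
      = ENNReal.ofReal (a ^ p / (2 - p)) := by
    have := lintegral_Ioi_rpow ha0 (s := p - 3) (by linarith)
    have h3 : a ^ p / (2 - p) = (-a ^ (p - 3 + 1) / (p - 3 + 1)) * a ^ 2 := by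
      rw [show (p - 3 + 1) = -(2 - p) by ring, neg_div_neg_eq, div_mul_eq_mul_div,
        ← Real.rpow_natCast, ← Real.rpow_add ha0]
      congr 2; push_cast; ring
    rw [h3, mul_comm, ENNReal.ofReal_mul (by positivity), ← this, ← lintegral_const_mul _ (by fun_prop)]
    refine setLIntegral_congr_fun measurableSet_Ioi fun l hl => ?_
    rw [min_eq_left (le_of_lt (show a < l from hl)), ← ENNReal.ofReal_mul (by positivity), mul_comm]
  have h3 : 0 < 2 - p := by linarith
  rw [h1, h2, ← ENNReal.ofReal_add (by positivity) (by positivity)]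
  exact le_of_eq (by congr 1; ring)

theorem lintegral_rpow_mul_sub_le {p a : ℝ} (hp : 1 < p) (ha : 0 ≤ a) :
    ∫⁻ l in Ioi 0, ENNReal.ofReal (l ^ (p - 2) * max (a - l) 0)
      ≤ ENNReal.ofReal (1 / (p - 1) * a ^ p) := by
  rcases ha.eq_or_lt with rfl | ha0
  · refine le_of_eq_of_le ?_ zero_le
    rw [setLIntegral_congr_fun measurableSet_Ioi (g := fun _ => 0), lintegral_zero]
    intro l hl
    have : (0:ℝ) - l ≤ 0 := by linarith [show (0:ℝ) < l from hl]
    simp only [max_eq_right this, mul_zero, ENNReal.ofReal_zero]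
  rw [← Ioc_union_Ioi_eq_Ioi ha, lintegral_union measurableSet_Ioi (Ioc_disjoint_Ioi le_rfl)]
  have h2 : ∫⁻ l in Ioi a, ENNReal.ofReal (l ^ (p - 2) * max (a - l) 0) = 0 := by
    rw [setLIntegral_congr_fun measurableSet_Ioi (g := fun _ => 0), lintegral_zero]
    intro l hl
    have : a - l ≤ 0 := by linarith [show a < l from hl]
    simp only [max_eq_right this, mul_zero, ENNReal.ofReal_zero]
  rw [h2, add_zero]
  have := lintegral_Ioc_rpow ha (s := p - 2) (by linarith)
  have h3 : 1 / (p - 1) * a ^ p = a * (a ^ (p - 2 + 1) / (p - 2 + 1)) := by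
    rw [show p - 2 + 1 = p - 1 by ring, Real.rpow_sub_one ha0.ne']
    field_simp
  rw [h3, ENNReal.ofReal_mul ha, ← this, ← lintegral_const_mul _ (by fun_prop)]
  refine setLIntegral_mono' measurableSet_Ioc fun l hl => ?_
  rw [← ENNReal.ofReal_mul ha]
  refine ENNReal.ofReal_le_ofReal ?_
  rw [mul_comm]
  refine mul_le_mul_of_nonneg_right (max_le (by linarith [hl.1]) ha) (Real.rpow_nonneg hl.1.le _)

/-- The constant in the interpolated `Lᵖ` bound, `1 < p < 2`. -/
def czConst (p : ℝ) (A : ℝ≥0∞) : ℝ≥0∞ :=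
  ENNReal.ofReal p * (4 * A * ENNReal.ofReal (1 / p + 1 / (2 - p))
    + 2 * (4096 + 132 * A) * ENNReal.ofReal (1 / (p - 1)))

theorem czConst_ne_top {p : ℝ} {A : ℝ≥0∞} (hA : A ≠ ⊤) : czConst p A ≠ ⊤ := by
  unfold czConst
  finiteness

theorem IsCZKernel.distribution_le {k : ℝ × E3 → ℝ} {A : ℝ≥0∞} (hk : IsCZKernel k A)
    {f : ℝ × E3 → ℝ} (hf : Continuous f) (hfi : Integrable f) {l : ℝ} (hl : 0 < l) :
    volume {q | l < |cv k f q|} ≤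
      4 * A * (∫⁻ q, ENNReal.ofReal (l ^ (-2:ℝ) * (min |f q| l) ^ 2))
      + 2 * (4096 + 132 * A) * ∫⁻ q, ENNReal.ofReal (l ^ (-1:ℝ) * max (|f q| - l) 0) := by
  set g : ℝ × E3 → ℝ := fun q => max (min (f q) l) (-l) with hg
  set b : ℝ × E3 → ℝ := fun q => f q - g q with hb
  have hgc : Continuous g := by fun_prop
  have hbc : Continuous b := by fun_prop
  have hgabs : ∀ q, |g q| = min |f q| l := by
    intro q
    simp only [hg, max_def, min_def, abs_eq_max_neg]
    split_ifs <;> linarith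
  have hbabs : ∀ q, |b q| = max (|f q| - l) 0 := by
    intro q
    simp only [hb, hg, max_def, min_def, abs_eq_max_neg]
    split_ifs <;> linarith
  have hgi : Integrable g := hfi.mono hgc.aestronglyMeasurable
    (Filter.Eventually.of_forall fun q => by
      rw [Real.norm_eq_abs, hgabs]; exact min_le_left _ _)
  have hbi : Integrable b := hfi.sub hgi
  have hsub : {q | l < |cv k f q|} ⊆ {q | l / 2 < |cv k g q|} ∪ {q | l / 2 < |cv k b q|} := by
    intro q hq
    by_contra hcon
    simp only [mem_union, mem_ofPred_eq, not_or, not_lt] at hcon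
    have h4 := cv_sub hk hfi hgi q
    have h6 : cv k f q = cv k b q + cv k g q := by rw [← sub_eq_iff_eq_add, ← h4]
    have h7 := abs_add_le (cv k b q) (cv k g q)
    rw [← h6] at h7
    have hq' : l < |cv k f q| := hq
    linarith [hcon.1, hcon.2]
  have E1 : volume {q | l / 2 < |cv k g q|}
      ≤ 4 * A * ∫⁻ q, ENNReal.ofReal (l ^ (-2:ℝ) * (min |f q| l) ^ 2) := by
    have h2 := hk.l2 g hgc.measurable hgi ⟨l, fun q => by rw [hgabs]; exact min_le_right _ _⟩
    have h3 := mul_meas_ge_le_lintegral₀ (μ := volume)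
      ((measurable_cv hk.measurable hgc.measurable).enorm.pow_const 2).aemeasurable
      (ENNReal.ofReal ((l / 2) ^ 2))
    have h4 : volume {q | l / 2 < |cv k g q|}
        ≤ volume {q | ENNReal.ofReal ((l / 2) ^ 2) ≤ ‖cv k g q‖ₑ ^ 2} := by
      refine measure_mono fun q hq => ?_
      have hq' : l / 2 < |cv k g q| := hq
      rw [Set.mem_ofPred_eq]
      rw [Real.enorm_eq_ofReal_abs, ← ENNReal.ofReal_pow (abs_nonneg _)]
      exact ENNReal.ofReal_le_ofReal (pow_le_pow_left₀ (by positivity) hq'.le 2)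
    have h5 : (1:ℝ≥0∞) = ENNReal.ofReal (4 * l ^ (-2:ℝ)) * ENNReal.ofReal ((l / 2) ^ 2) := by
      rw [← ENNReal.ofReal_mul (by positivity), ← ENNReal.ofReal_one]
      congr 1
      rw [Real.rpow_neg hl.le, Real.rpow_two]; field_simp; norm_num
    calc volume {q | l / 2 < |cv k g q|}
        ≤ ENNReal.ofReal (4 * l ^ (-2:ℝ)) * (ENNReal.ofReal ((l / 2) ^ 2)
          * volume {q | ENNReal.ofReal ((l / 2) ^ 2) ≤ ‖cv k g q‖ₑ ^ 2}) := by
          rw [← mul_assoc, ← h5, one_mul]; exact h4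
      _ ≤ ENNReal.ofReal (4 * l ^ (-2:ℝ)) * (A * ∫⁻ q, ‖g q‖ₑ ^ 2) :=
          mul_le_mul_right (h3.trans h2) _
      _ = 4 * A * (ENNReal.ofReal (l ^ (-2:ℝ)) * ∫⁻ q, ‖g q‖ₑ ^ 2) := by
          rw [ENNReal.ofReal_mul (by norm_num), show ENNReal.ofReal 4 = 4 by norm_num]; ring
      _ = _ := by
          rw [← lintegral_const_mul _ (by fun_prop)]
          congr 1
          refine lintegral_congr fun q => ?_
          rw [ENNReal.ofReal_mul (by positivity), ← hgabs, Real.enorm_eq_ofReal_abs,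
            ENNReal.ofReal_pow (abs_nonneg _)]
  have E2 : volume {q | l / 2 < |cv k b q|}
      ≤ 2 * (4096 + 132 * A) * ∫⁻ q, ENNReal.ofReal (l ^ (-1:ℝ) * max (|f q| - l) 0) := by
    have h2 := hk.weak_type hbc hbi (half_pos hl)
    have h5 : (1:ℝ≥0∞) = ENNReal.ofReal (2 * l ^ (-1:ℝ)) * ENNReal.ofReal (l / 2) := by
      rw [← ENNReal.ofReal_mul (by positivity), ← ENNReal.ofReal_one]
      congr 1
      rw [Real.rpow_neg hl.le, Real.rpow_one]; field_simp
    calc volume {q | l / 2 < |cv k b q|}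
        = ENNReal.ofReal (2 * l ^ (-1:ℝ)) * (ENNReal.ofReal (l / 2)
          * volume {q | l / 2 < |cv k b q|}) := by
          rw [← mul_assoc, ← h5, one_mul]
      _ ≤ ENNReal.ofReal (2 * l ^ (-1:ℝ)) * ((4096 + 132 * A) * ∫⁻ q, ‖b q‖ₑ) :=
          mul_le_mul_right h2 _
      _ = 2 * (4096 + 132 * A) * (ENNReal.ofReal (l ^ (-1:ℝ)) * ∫⁻ q, ‖b q‖ₑ) := by
          rw [ENNReal.ofReal_mul (by norm_num), show ENNReal.ofReal 2 = 2 by norm_num]; ring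
      _ = _ := by
          rw [← lintegral_const_mul _ (by fun_prop)]
          congr 1
          refine lintegral_congr fun q => ?_
          rw [ENNReal.ofReal_mul (by positivity), ← hbabs, Real.enorm_eq_ofReal_abs]
  exact (measure_mono hsub).trans ((measure_union_le _ _).trans (add_le_add E1 E2))

/-- Calderón–Zygmund theorem in `Lᵖ`, `1 < p < 2`. -/
theorem IsCZKernel.lintegral_rpow_le_of_lt_two {k : ℝ × E3 → ℝ} {A : ℝ≥0∞} (hk : IsCZKernel k A)
    {p : ℝ} (hp : 1 < p) (hp2 : p < 2)
    {f : ℝ × E3 → ℝ} (hf : Continuous f) (hfi : Integrable f) :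
    ∫⁻ q, ‖cv k f q‖ₑ ^ p ≤ czConst p A * ∫⁻ q, ‖f q‖ₑ ^ p := by
  have hp0 : 0 < p := by linarith
  have hm := measurable_cv hk.measurable hf.measurable
  have hfm := hf.measurable
  have e1 : ∀ q, ‖cv k f q‖ₑ ^ p = ENNReal.ofReal (|cv k f q| ^ p) := fun q => by
    rw [Real.enorm_eq_ofReal_abs, ENNReal.ofReal_rpow_of_nonneg (abs_nonneg _) hp0.le]
  have e2 : ∀ q, ‖f q‖ₑ ^ p = ENNReal.ofReal (|f q| ^ p) := fun q => by
    rw [Real.enorm_eq_ofReal_abs, ENNReal.ofReal_rpow_of_nonneg (abs_nonneg _) hp0.le]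
  simp_rw [e1]
  rw [lintegral_rpow_eq_lintegral_meas_lt_mul volume
    (Filter.Eventually.of_forall fun q => abs_nonneg _) (by fun_prop) hp0]
  have h1 : ∫⁻ q, ∫⁻ l in Ioi (0:ℝ), ENNReal.ofReal (l ^ (p - 3) * (min |f q| l) ^ 2)
      ≤ ENNReal.ofReal (1 / p + 1 / (2 - p)) * ∫⁻ q, ‖f q‖ₑ ^ p := by
    rw [← lintegral_const_mul _ (by fun_prop)]
    refine lintegral_mono fun q => ?_
    have : 0 < 2 - p := by linarith
    simp only
    rw [e2, ← ENNReal.ofReal_mul (by positivity)]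
    exact lintegral_rpow_mul_min_sq_le hp hp2 (abs_nonneg _)
  have h2 : ∫⁻ q, ∫⁻ l in Ioi (0:ℝ), ENNReal.ofReal (l ^ (p - 2) * max (|f q| - l) 0)
      ≤ ENNReal.ofReal (1 / (p - 1)) * ∫⁻ q, ‖f q‖ₑ ^ p := by
    rw [← lintegral_const_mul _ (by fun_prop)]
    refine lintegral_mono fun q => ?_
    have : 0 < p - 1 := by linarith
    simp only
    rw [e2, ← ENNReal.ofReal_mul (by positivity)]
    exact lintegral_rpow_mul_sub_le hp (abs_nonneg _)
  have m1 : Measurable fun x : (ℝ × E3) × ℝ =>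
      ENNReal.ofReal (x.2 ^ (p - 3) * (min |f x.1| x.2) ^ 2) := by fun_prop
  have m2 : Measurable fun x : (ℝ × E3) × ℝ =>
      ENNReal.ofReal (x.2 ^ (p - 2) * max (|f x.1| - x.2) 0) := by fun_prop
  rw [lintegral_lintegral_swap m1.aemeasurable] at h1
  rw [lintegral_lintegral_swap m2.aemeasurable] at h2
  unfold czConst
  rw [mul_assoc]
  gcongr
  calc ∫⁻ l in Ioi (0:ℝ), volume {q | l < |cv k f q|} * ENNReal.ofReal (l ^ (p - 1))
      ≤ ∫⁻ l in Ioi (0:ℝ),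
        (4 * A * (∫⁻ q, ENNReal.ofReal (l ^ (p - 3) * (min |f q| l) ^ 2))
          + 2 * (4096 + 132 * A) * ∫⁻ q, ENNReal.ofReal (l ^ (p - 2) * max (|f q| - l) 0)) := by
        refine setLIntegral_mono' measurableSet_Ioi fun l hl => ?_
        have hl0 : (0:ℝ) < l := hl
        refine (mul_le_mul_left (hk.distribution_le hf hfi hl0) _).trans (le_of_eq ?_)
        rw [add_mul, mul_assoc, mul_assoc (2 * _), ← lintegral_mul_const _ (by fun_prop),
          ← lintegral_mul_const _ (by fun_prop)]
        congr 2
        · refine lintegral_congr fun q => ?_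
          rw [← ENNReal.ofReal_mul (by positivity), mul_right_comm, ← Real.rpow_add hl0]
          congr 3; ring
        · refine lintegral_congr fun q => ?_
          rw [← ENNReal.ofReal_mul (by positivity), mul_right_comm, ← Real.rpow_add hl0]
          congr 3; ring
    _ = 4 * A * (∫⁻ l in Ioi (0:ℝ), ∫⁻ q, ENNReal.ofReal (l ^ (p - 3) * (min |f q| l) ^ 2))
        + 2 * (4096 + 132 * A) *
          ∫⁻ l in Ioi (0:ℝ), ∫⁻ q, ENNReal.ofReal (l ^ (p - 2) * max (|f q| - l) 0) := by
        have m1' : Measurable fun l : ℝ =>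
            ∫⁻ q, ENNReal.ofReal (l ^ (p - 3) * (min |f q| l) ^ 2) := m1.lintegral_prod_left'
        have m2' : Measurable fun l : ℝ =>
            ∫⁻ q, ENNReal.ofReal (l ^ (p - 2) * max (|f q| - l) 0) := m2.lintegral_prod_left'
        rw [lintegral_add_left (m1'.const_mul _), lintegral_const_mul _ m1',
          lintegral_const_mul _ m2']
    _ ≤ _ := by
        rw [add_mul, mul_assoc (4 * A), mul_assoc (2 * (4096 + 132 * A))]
        gcongr

theorem continuous_cv {k f : ℝ × E3 → ℝ} (hk : Integrable k) (hf : Continuous f)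
    (hfc : HasCompactSupport f) : Continuous (cv k f) := by
  have e : cv k f = fun q => ∫ r, k r * f (q - r) := by
    ext q
    unfold cv
    rw [← integral_sub_left_eq_self (fun r => k r * f (q - r)) volume q]
    simp only [sub_sub_cancel]
  rw [e]
  obtain ⟨M, hM⟩ := hfc.exists_bound_of_continuous hf
  refine continuous_of_dominated (bound := fun r => ‖k r‖ * M) (fun q => ?_) (fun q => ?_)
    (hk.norm.mul_const M) ?_
  · exact hk.aestronglyMeasurable.mul (by fun_prop : Continuous fun r => f (q - r)).aestronglyMeasurable
  · refine Filter.Eventually.of_forall fun r => ?_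
    rw [norm_mul]; gcongr; exact hM _
  · exact Filter.Eventually.of_forall fun r => by fun_prop

theorem integral_cv_mul {k : ℝ × E3 → ℝ} (hkm : Measurable k) (hkb : ∃ B, ∀ q, |k q| ≤ B)
    {f h : ℝ × E3 → ℝ} (hf : Integrable f) (hh : Integrable h) :
    ∫ q, cv k f q * h q = ∫ r, f r * cv (fun q => k (-q)) h r := by
  unfold cv
  simp_rw [← integral_mul_const, ← integral_const_mul]
  rw [integral_integral_swap]
  · congr 1; ext r; congr 1; ext q
    rw [neg_sub]; ring
  · obtain ⟨B, hB⟩ := hkb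
    have h1 : Integrable (fun z : (ℝ × E3) × (ℝ × E3) => h z.1 * f z.2) (volume.prod volume) :=
      hh.mul_prod hf
    have h2 := h1.bdd_mul (c := B) (f := fun z : (ℝ × E3) × (ℝ × E3) => k (z.1 - z.2))
      (hkm.comp (by fun_prop)).aestronglyMeasurable (Filter.Eventually.of_forall fun z => hB _)
    refine h2.congr (Filter.Eventually.of_forall fun z => ?_)
    simp only [Function.uncurry]; ring

theorem ENNReal_le_of_le_mul_rpow {p q : ℝ} (hpq : p.HolderConjugate q) {I N C : ℝ≥0∞}
    (hI : I ≠ ⊤) (h : I ≤ N ^ (1 / p) * (C * I) ^ (1 / q)) : I ≤ C ^ (p - 1) * N := by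
  rcases eq_or_ne I 0 with rfl | hI0
  · exact zero_le
  have hp := hpq.pos
  have hq := hpq.symm.pos
  have hsum : 1 / p + 1 / q = 1 := by simpa using hpq.inv_add_inv_eq_one
  have h1 : I ^ (1 / p) * I ^ (1 / q) ≤ (N ^ (1 / p) * C ^ (1 / q)) * I ^ (1 / q) := by
    rw [← ENNReal.rpow_add _ _ hI0 hI, hsum, ENNReal.rpow_one, mul_assoc,
      ← ENNReal.mul_rpow_of_nonneg _ _ (by positivity)]
    exact h
  have hq0 : I ^ (1 / q) ≠ 0 := by simp [hI0, hI]
  have hqT : I ^ (1 / q) ≠ ⊤ := ENNReal.rpow_ne_top_of_nonneg (by positivity) hI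
  rw [ENNReal.mul_le_mul_iff_left hq0 hqT] at h1
  have h2 := ENNReal.rpow_le_rpow h1 hp.le
  rw [← ENNReal.rpow_mul, ENNReal.mul_rpow_of_nonneg _ _ hp.le, ← ENNReal.rpow_mul,
    ← ENNReal.rpow_mul, one_div_mul_cancel hp.ne', ENNReal.rpow_one, ENNReal.rpow_one] at h2
  rw [mul_comm]
  refine h2.trans (le_of_eq ?_)
  congr 2
  rw [one_div_mul_eq_div]
  exact hpq.div_conj_eq_sub_one

theorem IsCZKernel.lintegral_rpow_le_of_two_lt {k : ℝ × E3 → ℝ} {A : ℝ≥0∞} (hk : IsCZKernel k A)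
    (hk' : IsCZKernel (fun q => k (-q)) A) (hki : Integrable k) {p : ℝ} (hp2 : 2 < p)
    {f : ℝ × E3 → ℝ} (hf : Continuous f) (hfc : HasCompactSupport f) :
    ∫⁻ q, ‖cv k f q‖ₑ ^ p ≤ czConst (p / (p - 1)) A ^ (p - 1) * ∫⁻ q, ‖f q‖ₑ ^ p := by
  have hpq : p.HolderConjugate (p / (p - 1)) := Real.HolderConjugate.conjExponent (by linarith)
  set q := p / (p - 1) with hq
  have hq1 : 1 < q := hpq.symm.lt
  have hq2 : q < 2 := by rw [hq, div_lt_iff₀ (by linarith)]; linarith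
  have hq0 : 0 < q := by linarith
  have hp0 : 0 < p := by linarith
  set F := cv k f with hF
  have hFc : Continuous F := continuous_cv hki hf hfc
  have hfi : Integrable f := hf.integrable_of_hasCompactSupport hfc
  set χ : ℕ → ℝ × E3 → ℝ := fun n x => max 0 (min 1 ((n:ℝ) - ‖x‖)) with hχ
  have hχc : ∀ n, Continuous (χ n) := fun n => by fun_prop
  have hχ0 : ∀ n x, 0 ≤ χ n x := fun n x => le_max_left _ _
  have hχ1 : ∀ n x, χ n x ≤ 1 := fun n x => max_le zero_le_one (min_le_left _ _)
  have hχs : ∀ n, HasCompactSupport (χ n) := fun n => by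
    refine HasCompactSupport.intro (isCompact_closedBall (0 : ℝ × E3) n) fun x hx => ?_
    simp only [mem_closedBall, dist_zero_right, not_le] at hx
    exact max_eq_left ((min_le_right _ _).trans (by linarith))
  have key : ∀ n, ∫⁻ x, ENNReal.ofReal (|F x| ^ p * χ n x)
      ≤ czConst q A ^ (p - 1) * ∫⁻ q, ‖f q‖ₑ ^ p := by
    intro n
    set h : ℝ × E3 → ℝ := fun x => |F x| ^ (p - 2) * F x * χ n x with hh
    have hhc : Continuous h :=
      ((hFc.abs.rpow_const fun x => Or.inr (by linarith)).mul hFc).mul (hχc n)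
    have hhs : HasCompactSupport h := (hχs n).mul_left
    have hhi : Integrable h := hhc.integrable_of_hasCompactSupport hhs
    have hFh : ∀ x, F x * h x = |F x| ^ p * χ n x := by
      intro x
      have : |F x| ^ p = |F x| ^ (p - 2) * (F x) ^ 2 := by
        rcases eq_or_ne (F x) 0 with h0 | h0
        · rw [h0]; simp [Real.zero_rpow hp0.ne']
        · rw [← sq_abs, ← Real.rpow_natCast, ← Real.rpow_add (abs_pos.2 h0)]; congr 1; push_cast; ring
      rw [this]; simp only [hh]; ring
    have hhq : ∀ x, ‖h x‖ₑ ^ q ≤ ENNReal.ofReal (|F x| ^ p * χ n x) := by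
      intro x
      rw [Real.enorm_eq_ofReal_abs, ENNReal.ofReal_rpow_of_nonneg (abs_nonneg _) hq0.le]
      refine ENNReal.ofReal_le_ofReal ?_
      have e1 : |h x| = |F x| ^ (p - 1) * χ n x := by
        simp only [hh]
        rw [abs_mul, abs_mul, abs_of_nonneg (hχ0 n x),
          abs_of_nonneg (Real.rpow_nonneg (abs_nonneg _) _)]
        congr 1
        rcases eq_or_ne (F x) 0 with h0 | h0
        · rw [h0]; simp [Real.zero_rpow (by linarith : p - 1 ≠ 0)]
        · rw [← Real.rpow_add_one (abs_ne_zero.2 h0)]; congr 1; ring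
      rw [e1, Real.mul_rpow (Real.rpow_nonneg (abs_nonneg _) _) (hχ0 n x),
        ← Real.rpow_mul (abs_nonneg _)]
      have e2 : (p - 1) * q = p := by rw [hq]; field_simp [(by linarith : p - 1 ≠ 0)]
      rw [e2]
      gcongr
      exact Real.rpow_le_self_of_le_one (hχ0 n x) (hχ1 n x) hq1.le
    have hFhc : Continuous fun x => F x * h x := hFc.mul hhc
    have hFhi : Integrable fun x => F x * h x :=
      hFhc.integrable_of_hasCompactSupport hhs.mul_left
    have hI : ∫⁻ x, ENNReal.ofReal (|F x| ^ p * χ n x) = ENNReal.ofReal (∫ x, F x * h x) := by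
      rw [ofReal_integral_eq_lintegral_ofReal hFhi]
      · simp_rw [hFh]
      · exact Filter.Eventually.of_forall fun x => by
          simp only [hFh]; exact mul_nonneg (Real.rpow_nonneg (abs_nonneg _) _) (hχ0 n x)
    refine ENNReal_le_of_le_mul_rpow hpq (by rw [hI]; exact ENNReal.ofReal_ne_top) ?_
    calc ∫⁻ x, ENNReal.ofReal (|F x| ^ p * χ n x)
        = ENNReal.ofReal (∫ r, f r * cv (fun q => k (-q)) h r) := by
          rw [hI, hF, integral_cv_mul hk.measurable hk.bounded hfi hhi]
      _ ≤ ‖∫ r, f r * cv (fun q => k (-q)) h r‖ₑ := by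
          rw [Real.enorm_eq_ofReal_abs]; exact ENNReal.ofReal_le_ofReal (le_abs_self _)
      _ ≤ ∫⁻ r, ‖f r‖ₑ * ‖cv (fun q => k (-q)) h r‖ₑ := by
          refine (enorm_integral_le_lintegral_enorm _).trans (le_of_eq ?_)
          simp_rw [enorm_mul]
      _ ≤ (∫⁻ r, ‖f r‖ₑ ^ p) ^ (1 / p) * (∫⁻ r, ‖cv (fun q => k (-q)) h r‖ₑ ^ q) ^ (1 / q) :=
          ENNReal.lintegral_mul_le_Lp_mul_Lq volume hpq hf.measurable.enorm.aemeasurable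
            (measurable_cv hk'.measurable hhc.measurable).enorm.aemeasurable
      _ ≤ _ := by
          gcongr
          refine (hk'.lintegral_rpow_le_of_lt_two hq1 hq2 hhc hhi).trans ?_
          gcongr
          exact hhq _
  have hlim : ∀ x, Filter.Tendsto (fun n => ENNReal.ofReal (|F x| ^ p * χ n x)) Filter.atTop
      (nhds (‖F x‖ₑ ^ p)) := by
    intro x
    refine tendsto_atTop_of_eventually_const (i₀ := ⌈‖x‖ + 1⌉₊) fun n hn => ?_
    have : ‖x‖ + 1 ≤ n := Nat.ceil_le.1 hn
    simp only [hχ]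
    rw [min_eq_left (by linarith), max_eq_right zero_le_one, mul_one, Real.enorm_eq_ofReal_abs,
      ENNReal.ofReal_rpow_of_nonneg (abs_nonneg _) hp0.le]
  calc ∫⁻ x, ‖F x‖ₑ ^ p
      = ∫⁻ x, Filter.liminf (fun n => ENNReal.ofReal (|F x| ^ p * χ n x)) Filter.atTop :=
        lintegral_congr fun x => (hlim x).liminf_eq.symm
    _ ≤ Filter.liminf (fun n => ∫⁻ x, ENNReal.ofReal (|F x| ^ p * χ n x)) Filter.atTop := by
        refine lintegral_liminf_le fun n => ?_
        have := (hχc n).measurable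
        have := hFc.measurable
        fun_prop
    _ ≤ Filter.limsup (fun n => ∫⁻ x, ENNReal.ofReal (|F x| ^ p * χ n x)) Filter.atTop :=
        Filter.liminf_le_limsup
    _ ≤ _ := Filter.limsup_le_of_le (by isBoundedDefault) (Filter.Eventually.of_forall key)

/-- Calderón–Zygmund theorem. -/
theorem exists_czKernel_bound {p : ℝ} (hp : 1 < p) {A : ℝ≥0∞} (hA : A ≠ ⊤) :
    ∃ C : ℝ≥0∞, C ≠ ⊤ ∧ ∀ k : ℝ × E3 → ℝ, IsCZKernel k A → IsCZKernel (fun q => k (-q)) A →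
      Integrable k → ∀ f : ℝ × E3 → ℝ, Continuous f → HasCompactSupport f →
        ∫⁻ q, ‖cv k f q‖ₑ ^ p ≤ C * ∫⁻ q, ‖f q‖ₑ ^ p := by
  rcases lt_trichotomy p 2 with h | rfl | h
  · exact ⟨_, czConst_ne_top hA, fun k hk _ _ f hf hfc =>
      hk.lintegral_rpow_le_of_lt_two hp h hf (hf.integrable_of_hasCompactSupport hfc)⟩
  · refine ⟨A, hA, fun k hk _ _ f hf hfc => ?_⟩
    simp_rw [ENNReal.rpow_two]
    exact hk.l2 f hf.measurable (hf.integrable_of_hasCompactSupport hfc)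
      (hfc.exists_bound_of_continuous hf)
  · exact ⟨_, ENNReal.rpow_ne_top_of_nonneg (by linarith) (czConst_ne_top hA),
      fun k hk hk' hki f hf hfc => hk.lintegral_rpow_le_of_two_lt hk' hki h hf hfc⟩

open FourierTransform in
/-- Plancherel's theorem for integrable and square integrable functions. -/
theorem lintegral_fourier_sq {φ : E3 → ℂ} (h1 : Integrable φ) (h2 : MemLp φ 2) :
    ∫⁻ ξ, ‖𝓕 φ ξ‖ₑ ^ 2 = ∫⁻ x, ‖φ x‖ₑ ^ 2 := by
  set F : Lp ℂ 2 (volume : Measure E3) := h2.toLp φ with hF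
  have hae : ∀ᵐ ξ, (𝓕 F : Lp ℂ 2 (volume : Measure E3)) ξ = 𝓕 φ ξ := by
    refine ae_eq_of_integral_contDiff_smul_eq
      ((Lp.memLp (𝓕 F : Lp ℂ 2 (volume : Measure E3))).locallyIntegrable (by norm_num)) ?_ ?_
    · refine Continuous.locallyIntegrable ?_
      exact VectorFourier.fourierIntegral_continuous Real.continuous_fourierChar
        (by exact continuous_inner) h1
    intro g hg hgc
    have hgC : ContDiff ℝ (⊤ : ℕ∞) (fun x => (g x : ℂ)) := Complex.ofRealCLM.contDiff.comp hg
    have hgCc : HasCompactSupport (fun x => (g x : ℂ)) := hgc.comp_left Complex.ofReal_zero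
    set G : SchwartzMap E3 ℂ := hgCc.toSchwartzMap hgC with hG
    have e := congrArg (fun T => T G) (Lp.fourier_toTemperedDistribution_eq F)
    simp only [TemperedDistribution.fourier_apply, Lp.toTemperedDistribution_apply] at e
    have hGx : ∀ x, G x = (g x : ℂ) := fun x => rfl
    have e1 : ∫ x, g x • (𝓕 F : Lp ℂ 2 (volume : Measure E3)) x
        = ∫ x, G x • (𝓕 F : Lp ℂ 2 (volume : Measure E3)) x := by
      congr 1
    rw [e1, ← e]
    have e2 : ∫ x, (𝓕 G) x • F x = ∫ x, (𝓕 G) x • φ x := by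
      refine integral_congr_ae ?_
      filter_upwards [h2.coeFn_toLp] with x hx
      rw [hF, hx]
    rw [e2]
    have e3 := VectorFourier.integral_fourierIntegral_smul_eq_flip (μ := (volume : Measure E3))
      (ν := (volume : Measure E3)) (L := innerₗ E3) (f := fun x => G x) (g := φ)
      Real.continuous_fourierChar (by exact continuous_inner) G.integrable h1
    rw [flip_innerₗ] at e3
    have e4 : ∀ x, (𝓕 G) x = VectorFourier.fourierIntegral Real.fourierChar volume (innerₗ E3)
      (fun x => G x) x := fun x => by rw [SchwartzMap.fourier_coe]; rfl
    simp_rw [e4]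
    rw [e3]
    rfl
  have hn := Lp.norm_fourier_eq F
  have hn' : ‖(𝓕 F : Lp ℂ 2 (volume : Measure E3))‖ₑ = ‖F‖ₑ := by
    rw [← ofReal_norm, ← ofReal_norm, hn]
  rw [Lp.enorm_def, Lp.enorm_def, eLpNorm_congr_ae h2.coeFn_toLp, eLpNorm_congr_ae hae] at hn'
  have h3 : ∀ ψ : E3 → ℂ, ∫⁻ x, ‖ψ x‖ₑ ^ 2 = eLpNorm ψ 2 volume ^ 2 := by
    intro ψ
    have := eLpNorm_nnreal_pow_eq_lintegral (f := ψ) (μ := volume) (p := 2) (by norm_num)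
    simpa using this.symm
  rw [h3, h3, hn']

/-- First spatial derivatives of the heat kernel. -/
def dK (i : Fin 3) (τ : ℝ) (z : E3) : ℝ := -(z i / (2 * τ)) * heatK τ z

/-- Second spatial derivatives of the heat kernel. -/
def ddK (i j : Fin 3) (τ : ℝ) (z : E3) : ℝ :=
  (z i * z j / (4 * τ ^ 2) - (if i = j then 1 else 0) / (2 * τ)) * heatK τ z

/-- Gaussian majorant of the heat kernel and of its derivatives. -/
def gauss (τ : ℝ) (z : E3) : ℝ := τ ^ (-(3:ℝ)/2) * Real.exp (-‖z‖ ^ 2 / (20 * τ))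

theorem hasFDerivAt_heatK (τ : ℝ) (z : E3) :
    HasFDerivAt (heatK τ) ((-(heatK τ z) / (2 * τ)) • (innerSL ℝ z)) z := by
  have h1 : HasFDerivAt (fun z : E3 => ‖z‖ ^ 2) (2 • (innerSL ℝ z)) z :=
    (hasStrictFDerivAt_norm_sq z).hasFDerivAt
  have h2 := (((h1.neg).mul_const (1 / (4 * τ))).exp).const_mul ((4 * Real.pi * τ) ^ (-(3:ℝ)/2))
  have e : heatK τ = fun z => (4 * Real.pi * τ) ^ (-(3:ℝ)/2) * Real.exp (-‖z‖ ^ 2 * (1 / (4 * τ))) := by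
    ext z; unfold heatK; rw [mul_one_div]
  rw [e]
  refine h2.congr_fderiv ?_
  ext v
  simp
  ring

theorem fderiv_heatK (τ : ℝ) (z v : E3) :
    fderiv ℝ (heatK τ) z v = ∑ i, dK i τ z * v i := by
  rw [(hasFDerivAt_heatK τ z).fderiv]
  simp only [_root_.smul_apply, innerSL_apply_apply, smul_eq_mul, dK,
    PiLp.inner_apply, Finset.mul_sum]
  refine Finset.sum_congr rfl fun i _ => ?_
  simp; ring

theorem hasFDerivAt_dK (j : Fin 3) (τ : ℝ) (z : E3) :
    HasFDerivAt (dK j τ) ((-(z j / (2 * τ))) • ((-(heatK τ z) / (2 * τ)) • (innerSL ℝ z))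
      + heatK τ z • (-(1 / (2 * τ)) • (EuclideanSpace.proj j : E3 →L[ℝ] ℝ))) z := by
  have h1 : HasFDerivAt (fun z : E3 => -(z j / (2 * τ)))
      (-(1 / (2 * τ)) • (EuclideanSpace.proj j : E3 →L[ℝ] ℝ)) z := by
    have := ((EuclideanSpace.proj j : E3 →L[ℝ] ℝ).hasFDerivAt (x := z)).const_mul (-(1 / (2 * τ)))
    refine this.congr_of_eventuallyEq (Filter.Eventually.of_forall fun y => ?_)
    simp; ring
  exact h1.mul (hasFDerivAt_heatK τ z)

theorem fderiv_dK_single (i j : Fin 3) (τ : ℝ) (z : E3) :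
    fderiv ℝ (dK j τ) z (EuclideanSpace.single i 1) = ddK i j τ z := by
  rw [(hasFDerivAt_dK j τ z).fderiv]
  have h : inner ℝ z (EuclideanSpace.single i (1:ℝ)) = z i := by
    rw [EuclideanSpace.inner_single_right]; simp
  by_cases hij : i = j
  · subst hij; simp [ddK, h]; ring
  · simp [ddK, h, hij, Ne.symm hij]; ring

theorem fderiv_heatK_single (i : Fin 3) (τ : ℝ) (z : E3) :
    fderiv ℝ (heatK τ) z (EuclideanSpace.single i 1) = dK i τ z := by
  rw [(hasFDerivAt_heatK τ z).fderiv]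
  have h : inner ℝ z (EuclideanSpace.single i (1:ℝ)) = z i := by
    rw [EuclideanSpace.inner_single_right]; simp
  simp [dK, h]
  ring

theorem heatK_nonneg {τ : ℝ} (hτ : 0 < τ) (z : E3) : 0 ≤ heatK τ z := by
  unfold heatK; positivity

theorem gauss_nonneg {τ : ℝ} (hτ : 0 < τ) (z : E3) : 0 ≤ gauss τ z := by
  unfold gauss; positivity

theorem heatK_le {τ : ℝ} (hτ : 0 < τ) (z : E3) :
    heatK τ z ≤ τ ^ (-(3:ℝ)/2) * Real.exp (-‖z‖ ^ 2 / (4 * τ)) := by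
  unfold heatK
  refine mul_le_mul_of_nonneg_right ?_ (Real.exp_pos _).le
  exact Real.rpow_le_rpow_of_nonpos hτ (by nlinarith [Real.pi_gt_three]) (by norm_num)

theorem abs_apply_le (z : E3) (i : Fin 3) : |z i| ≤ ‖z‖ := PiLp.norm_apply_le z i

theorem exp_bound {a b c y : ℝ} (hb : y ≤ b) (h : c ≤ a * (1 + (b - y) + (b - y) ^ 2 / 2)) (ha : 0 ≤ a) :
    c * Real.exp (-b) ≤ a * Real.exp (-y) := by
  have h1 := Real.quadratic_le_exp_of_nonneg (sub_nonneg.2 hb)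
  have h2 : Real.exp (-y) = Real.exp (b - y) * Real.exp (-b) := by rw [← Real.exp_add]; congr 1; ring
  rw [h2, ← mul_assoc]
  gcongr
  exact h.trans (by gcongr)

theorem heatK_le_gauss {τ : ℝ} (hτ : 0 < τ) (z : E3) : heatK τ z ≤ gauss τ z := by
  refine (heatK_le hτ z).trans ?_
  unfold gauss
  refine mul_le_mul_of_nonneg_left (Real.exp_le_exp.2 ?_) (by positivity)
  rw [neg_div, neg_div, neg_le_neg_iff]
  exact div_le_div_of_nonneg_left (by positivity) (by positivity) (by linarith)

/-- Normal form: `τ = σ²`, `‖z‖ = ρ σ`. -/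
theorem exists_scale {τ : ℝ} (hτ : 0 < τ) (z : E3) :
    ∃ σ ρ : ℝ, 0 < σ ∧ 0 ≤ ρ ∧ τ = σ ^ 2 ∧ ‖z‖ = ρ * σ := by
  refine ⟨√τ, ‖z‖ / √τ, by positivity, by positivity, (Real.sq_sqrt hτ.le).symm, ?_⟩
  field_simp

theorem abs_dK_le (i : Fin 3) {τ : ℝ} (hτ : 0 < τ) (z : E3) :
    |dK i τ z| ≤ τ ^ (-(1:ℝ)/2) * gauss τ z := by
  obtain ⟨σ, ρ, hσ, hρ, rfl, hz⟩ := exists_scale hτ z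
  have h1 : |dK i (σ ^ 2) z| ≤ (ρ / (2 * σ)) * ((σ ^ 2) ^ (-(3:ℝ)/2) * Real.exp (-(ρ ^ 2 / 4))) := by
    unfold dK
    rw [abs_mul, abs_of_nonneg (heatK_nonneg hτ z), abs_neg, abs_div, abs_of_pos (by positivity : 0 < 2 * σ ^ 2)]
    refine mul_le_mul ?_ ?_ (heatK_nonneg hτ z) (by positivity)
    · rw [div_le_div_iff₀ (by positivity) (by positivity)]
      have := abs_apply_le z i
      rw [hz] at this
      nlinarith [mul_le_mul_of_nonneg_right this hσ.le]
    · refine (heatK_le hτ z).trans (le_of_eq ?_)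
      rw [hz]; congr 2; field_simp
  refine h1.trans ?_
  have h2 : (σ ^ 2) ^ (-(1:ℝ)/2) = σ⁻¹ := by
    rw [← Real.rpow_natCast, ← Real.rpow_mul hσ.le, ← Real.rpow_neg_one]; norm_num
  have h3 : gauss (σ ^ 2) z = (σ ^ 2) ^ (-(3:ℝ)/2) * Real.exp (-(ρ ^ 2 / 20)) := by
    unfold gauss; rw [hz]; congr 2; field_simp
  rw [h2, h3]
  have h4 := exp_bound (a := 1) (b := ρ ^ 2 / 4) (y := ρ ^ 2 / 20) (c := ρ / 2)
    (by nlinarith [sq_nonneg ρ]) (by nlinarith [sq_nonneg (ρ - 1), sq_nonneg ρ]) zero_le_one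
  calc _ = (σ⁻¹ * (σ ^ 2) ^ (-(3:ℝ)/2)) * (ρ / 2 * Real.exp (-(ρ ^ 2 / 4))) := by field_simp
    _ ≤ (σ⁻¹ * (σ ^ 2) ^ (-(3:ℝ)/2)) * (1 * Real.exp (-(ρ ^ 2 / 20))) := by gcongr
    _ = _ := by ring

theorem abs_coef_le (i j : Fin 3) {σ ρ : ℝ} (hσ : 0 < σ) {z : E3} (hz : ‖z‖ = ρ * σ) :
    |z i * z j / (4 * (σ ^ 2) ^ 2) - (if i = j then 1 else 0) / (2 * σ ^ 2)|
      ≤ (ρ ^ 2 / 4 + 1 / 2) / σ ^ 2 := by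
  have h1 : |z i * z j / (4 * (σ ^ 2) ^ 2)| ≤ ρ ^ 2 / 4 / σ ^ 2 := by
    rw [abs_div, abs_mul, abs_of_pos (by positivity : 0 < 4 * (σ ^ 2) ^ 2)]
    calc |z i| * |z j| / (4 * (σ ^ 2) ^ 2) ≤ ‖z‖ * ‖z‖ / (4 * (σ ^ 2) ^ 2) := by
          gcongr <;> exact abs_apply_le _ _
      _ = _ := by rw [hz]; field_simp
  have h2 : |(if i = j then (1:ℝ) else 0) / (2 * σ ^ 2)| ≤ 1 / 2 / σ ^ 2 := by
    rw [abs_div, abs_of_pos (by positivity : 0 < 2 * σ ^ 2), div_div]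
    gcongr
    split_ifs <;> simp
  rw [add_div]
  rw [abs_le] at h1 h2 ⊢
  constructor <;> linarith [h1.1, h1.2, h2.1, h2.2]

theorem abs_ddK_scale_le (i j : Fin 3) {σ ρ : ℝ} (hσ : 0 < σ) {z : E3} (hz : ‖z‖ = ρ * σ) :
    |ddK i j (σ ^ 2) z| ≤ (ρ ^ 2 / 4 + 1 / 2) / σ ^ 2 *
      ((σ ^ 2) ^ (-(3:ℝ)/2) * Real.exp (-(ρ ^ 2 / 4))) := by
  have hτ : 0 < σ ^ 2 := by positivity
  unfold ddK
  rw [abs_mul, abs_of_nonneg (heatK_nonneg hτ z)]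
  gcongr
  · exact heatK_nonneg hτ z
  · exact abs_coef_le i j hσ hz
  · refine (heatK_le hτ z).trans (le_of_eq ?_)
    rw [hz]; congr 2; field_simp

theorem gauss_scale {σ ρ : ℝ} (hσ : 0 < σ) {z : E3} (hz : ‖z‖ = ρ * σ) :
    gauss (σ ^ 2) z = (σ ^ 2) ^ (-(3:ℝ)/2) * Real.exp (-(ρ ^ 2 / 20)) := by
  unfold gauss; rw [hz]; congr 2; field_simp

theorem abs_ddK_le (i j : Fin 3) {τ : ℝ} (hτ : 0 < τ) (z : E3) :
    |ddK i j τ z| ≤ 2 / τ * gauss τ z := by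
  obtain ⟨σ, ρ, hσ, hρ, rfl, hz⟩ := exists_scale hτ z
  refine (abs_ddK_scale_le i j hσ hz).trans ?_
  rw [gauss_scale hσ hz]
  have h4 := exp_bound (a := 2) (b := ρ ^ 2 / 4) (y := ρ ^ 2 / 20) (c := ρ ^ 2 / 4 + 1 / 2)
    (by nlinarith [sq_nonneg ρ]) (by nlinarith [sq_nonneg (ρ ^ 2), sq_nonneg ρ]) (by norm_num)
  calc _ = (1 / σ ^ 2 * (σ ^ 2) ^ (-(3:ℝ)/2)) * ((ρ ^ 2 / 4 + 1 / 2) * Real.exp (-(ρ ^ 2 / 4))) := by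
        ring
    _ ≤ (1 / σ ^ 2 * (σ ^ 2) ^ (-(3:ℝ)/2)) * (2 * Real.exp (-(ρ ^ 2 / 20))) := by gcongr
    _ = _ := by ring

theorem abs_ddK_le_of_le_norm (i j : Fin 3) {τ r : ℝ} (hτ : 0 < τ) (hr : 0 < r) {z : E3}
    (hz' : 2 * r ≤ ‖z‖) : |ddK i j τ z| ≤ 4 / r ^ 2 * gauss τ z := by
  obtain ⟨σ, ρ, hσ, hρ, rfl, hz⟩ := exists_scale hτ z
  refine (abs_ddK_scale_le i j hσ hz).trans ?_
  rw [gauss_scale hσ hz]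
  have h4 := exp_bound (a := 4) (b := ρ ^ 2 / 4) (y := ρ ^ 2 / 20)
    (c := ρ ^ 2 / 4 * (ρ ^ 2 / 4 + 1 / 2))
    (by nlinarith [sq_nonneg ρ]) (by nlinarith [sq_nonneg (ρ ^ 2), sq_nonneg ρ]) (by norm_num)
  have h5 : 1 / σ ^ 2 ≤ ρ ^ 2 / (4 * r ^ 2) := by
    rw [div_le_div_iff₀ (by positivity) (by positivity)]
    rw [hz] at hz'
    nlinarith [mul_self_le_mul_self (by positivity) hz']
  calc _ = 1 / σ ^ 2 * ((ρ ^ 2 / 4 + 1 / 2) * ((σ ^ 2) ^ (-(3:ℝ)/2) * Real.exp (-(ρ ^ 2 / 4)))) := by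
        ring
    _ ≤ ρ ^ 2 / (4 * r ^ 2) * ((ρ ^ 2 / 4 + 1 / 2) * ((σ ^ 2) ^ (-(3:ℝ)/2) * Real.exp (-(ρ ^ 2 / 4)))) := by
        gcongr
    _ = (1 / r ^ 2 * (σ ^ 2) ^ (-(3:ℝ)/2)) * ((ρ ^ 2 / 4 * (ρ ^ 2 / 4 + 1 / 2)) * Real.exp (-(ρ ^ 2 / 4))) := by
        field_simp
    _ ≤ (1 / r ^ 2 * (σ ^ 2) ^ (-(3:ℝ)/2)) * (4 * Real.exp (-(ρ ^ 2 / 20))) := by gcongr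
    _ = _ := by ring

theorem lintegral_gauss {τ : ℝ} (hτ : 0 < τ) :
    ∫⁻ z : E3, ENNReal.ofReal (gauss τ z) = ENNReal.ofReal ((20 * Real.pi) ^ ((3:ℝ)/2)) := by
  have hb : 0 < 1 / (20 * τ) := by positivity
  have h1 := GaussianFourier.integral_rexp_neg_mul_sq_norm (V := E3) hb
  have h0 : Integrable fun z : E3 => Real.exp (-(1 / (20 * τ)) * ‖z‖ ^ 2) := by
    refine Integrable.of_integral_ne_zero ?_
    rw [h1]; positivity
  have e : ∀ z : E3, gauss τ z = τ ^ (-(3:ℝ)/2) * Real.exp (-(1 / (20 * τ)) * ‖z‖ ^ 2) := by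
    intro z; unfold gauss; congr 2; ring
  rw [← ofReal_integral_eq_lintegral_ofReal]
  · simp_rw [e]
    rw [integral_const_mul, h1]
    congr 1
    rw [show Module.finrank ℝ E3 = 3 from finrank_euclideanSpace_fin]
    push_cast
    rw [div_div_eq_mul_div, div_one, show Real.pi * (20 * τ) = τ * (20 * Real.pi) by ring,
      Real.mul_rpow hτ.le (by positivity), ← mul_assoc, ← Real.rpow_add hτ]
    norm_num
  · exact (h0.const_mul _).congr (ae_of_all _ fun z => (e z).symm)
  · exact Filter.Eventually.of_forall fun z => gauss_nonneg hτ z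

theorem measurable_heatK : Measurable fun q : ℝ × E3 => heatK q.1 q.2 := by
  unfold heatK; fun_prop

theorem measurable_apply (i : Fin 3) : Measurable fun q : ℝ × E3 => q.2 i := by fun_prop

theorem measurable_dK (i : Fin 3) : Measurable fun q : ℝ × E3 => dK i q.1 q.2 := by
  unfold dK
  have := measurable_heatK
  have := measurable_apply i
  fun_prop

theorem measurable_ddK (i j : Fin 3) : Measurable fun q : ℝ × E3 => ddK i j q.1 q.2 := by
  unfold ddK
  have := measurable_heatK
  have := measurable_apply i
  have := measurable_apply j
  fun_prop

theorem measurable_gauss : Measurable fun q : ℝ × E3 => gauss q.1 q.2 := by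
  unfold gauss; fun_prop

theorem hasDerivAt_heatK_path {τ s : ℝ} {z h : E3} {θ : ℝ} (hT : 0 < τ - θ * s) :
    HasDerivAt (fun θ : ℝ => heatK (τ - θ * s) (z - θ • h))
      (heatK (τ - θ * s) (z - θ • h) * (3 * s / (2 * (τ - θ * s))
        + inner ℝ (z - θ • h) h / (2 * (τ - θ * s))
        - ‖z - θ • h‖ ^ 2 * s / (4 * (τ - θ * s) ^ 2))) θ := by
  have hTd : HasDerivAt (fun θ : ℝ => τ - θ * s) (-s) θ := by
    simpa using ((hasDerivAt_id θ).mul_const s).const_sub τ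
  have hw : HasDerivAt (fun θ : ℝ => z - θ • h) (-h) θ := by
    simpa using ((hasDerivAt_id θ).smul_const h).const_sub z
  have h1 := (hTd.const_mul (4 * Real.pi)).rpow_const (p := -(3:ℝ)/2) (Or.inl (by positivity))
  have h2 := ((hw.norm_sq.neg).div (hTd.const_mul 4) (by positivity)).exp
  refine (h1.mul h2).congr_deriv ?_
  unfold heatK
  simp only [Pi.neg_apply, Pi.div_apply]
  rw [Real.rpow_sub_one (by positivity)]
  generalize Real.exp _ = e
  generalize (4 * Real.pi * (τ - θ * s)) ^ (-(3:ℝ)/2) = a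
  generalize ‖z - θ • h‖ = n
  rw [inner_neg_right]
  generalize inner ℝ (z - θ • h) h = m
  generalize τ - θ * s = T at hT
  have := Real.pi_pos
  field_simp
  ring

theorem hasDerivAt_ddK_path (i j : Fin 3) {τ s : ℝ} {z h : E3} {θ : ℝ} (hT : 0 < τ - θ * s) :
    HasDerivAt (fun θ : ℝ => ddK i j (τ - θ * s) (z - θ • h))
      ((-(h i * (z - θ • h) j + (z - θ • h) i * h j) / (4 * (τ - θ * s) ^ 2)
          + (z - θ • h) i * (z - θ • h) j * s / (2 * (τ - θ * s) ^ 3)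
          - (if i = j then 1 else 0) * s / (2 * (τ - θ * s) ^ 2)) * heatK (τ - θ * s) (z - θ • h)
        + ((z - θ • h) i * (z - θ • h) j / (4 * (τ - θ * s) ^ 2)
            - (if i = j then 1 else 0) / (2 * (τ - θ * s)))
          * (heatK (τ - θ * s) (z - θ • h) * (3 * s / (2 * (τ - θ * s))
            + inner ℝ (z - θ • h) h / (2 * (τ - θ * s))
            - ‖z - θ • h‖ ^ 2 * s / (4 * (τ - θ * s) ^ 2)))) θ := by
  have hTd : HasDerivAt (fun θ : ℝ => τ - θ * s) (-s) θ := by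
    simpa using ((hasDerivAt_id θ).mul_const s).const_sub τ
  have hw : ∀ l : Fin 3, HasDerivAt (fun θ : ℝ => (z - θ • h) l) (-(h l)) θ := by
    intro l
    simpa using ((hasDerivAt_id θ).mul_const (h l)).const_sub (z l)
  have h1 := ((hw i).mul (hw j)).div ((hTd.pow 2).const_mul 4) (by simp; exact hT.ne')
  have h2 := (hasDerivAt_const θ (if i = j then (1:ℝ) else 0)).div (hTd.const_mul 2) (by simpa using hT.ne')
  refine ((h1.sub h2).mul (hasDerivAt_heatK_path hT)).congr_deriv ?_
  congr 1
  congr 1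
  simp only [Pi.mul_apply, Pi.pow_apply]
  generalize (z - θ • h) i = a
  generalize (z - θ • h) j = b
  generalize (if i = j then (1:ℝ) else 0) = c
  generalize τ - θ * s = T at hT
  field_simp
  simp
  ring

theorem abs_add_sub_le {a b c A B C : ℝ} (ha : |a| ≤ A) (hb : |b| ≤ B) (hc : |c| ≤ C) :
    |a + b - c| ≤ A + B + C :=
  (norm_sub_le (a + b) c).trans (add_le_add ((abs_add_le a b).trans (add_le_add ha hb)) hc)

set_option maxHeartbeats 1000000 in
theorem abs_pathDeriv_le (i j : Fin 3) {T s r : ℝ} {w h : E3} (hr : 0 < r) (hT : 3 * r ^ 2 ≤ T)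
    (hs : |s| ≤ r ^ 2) (hh : ‖h‖ ≤ 2 * r) :
    |(-(h i * w j + w i * h j) / (4 * T ^ 2)
          + w i * w j * s / (2 * T ^ 3)
          - (if i = j then 1 else 0) * s / (2 * T ^ 2)) * heatK T w
        + (w i * w j / (4 * T ^ 2) - (if i = j then 1 else 0) / (2 * T))
          * (heatK T w * (3 * s / (2 * T) + inner ℝ w h / (2 * T) - ‖w‖ ^ 2 * s / (4 * T ^ 2)))|
      ≤ 40 * r * T ^ (-(3:ℝ)/2) * (T ^ (-(3:ℝ)/2) * Real.exp (-(‖w‖ ^ 2 / (8 * T)))) := by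
  have hT0 : 0 < T := by nlinarith [sq_pos_of_pos hr]
  obtain ⟨σ, ρ, hσ, hρ, rfl, hz⟩ := exists_scale hT0 w
  have hrσ : r ≤ σ := by
    refine le_of_sq_le_sq ?_ hσ.le
    nlinarith [sq_pos_of_pos hr]
  have hs' : |s| ≤ r * σ := hs.trans (by nlinarith)
  have hwi : ∀ l, |w l| ≤ ρ * σ := fun l => hz ▸ abs_apply_le w l
  have hhi : ∀ l, |h l| ≤ 2 * r := fun l => (abs_apply_le h l).trans hh
  have hδ : |if i = j then (1:ℝ) else 0| ≤ 1 := by split_ifs <;> simp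
  have e1 : |-(h i * w j + w i * h j) / (4 * (σ ^ 2) ^ 2)| ≤ r / σ ^ 3 * ρ := by
    rw [abs_div, abs_neg, abs_of_pos (by positivity : 0 < 4 * (σ ^ 2) ^ 2),
      div_le_iff₀ (by positivity)]
    have a1 : |h i * w j| ≤ 2 * r * (ρ * σ) := by
      rw [abs_mul]; exact mul_le_mul (hhi i) (hwi j) (abs_nonneg _) (by positivity)
    have a2 : |w i * h j| ≤ ρ * σ * (2 * r) := by
      rw [abs_mul]; exact mul_le_mul (hwi i) (hhi j) (abs_nonneg _) (by positivity)
    calc _ ≤ _ := abs_add_le _ _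
      _ ≤ _ := add_le_add a1 a2
      _ = _ := by field_simp; ring
  have hww : |w i * w j| ≤ (ρ * σ) * (ρ * σ) := by
    rw [abs_mul]; exact mul_le_mul (hwi i) (hwi j) (abs_nonneg _) (by positivity)
  have e2 : |w i * w j * s / (2 * (σ ^ 2) ^ 3)| ≤ r / σ ^ 3 * (ρ ^ 2 / 2) := by
    rw [abs_div, abs_mul, abs_of_pos (by positivity : 0 < 2 * (σ ^ 2) ^ 3),
      div_le_iff₀ (by positivity)]
    calc _ ≤ _ := mul_le_mul hww hs' (abs_nonneg _) (by positivity)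
      _ = _ := by field_simp
  have e3 : |(if i = j then (1:ℝ) else 0) * s / (2 * (σ ^ 2) ^ 2)| ≤ r / σ ^ 3 * (1 / 2) := by
    rw [abs_div, abs_mul, abs_of_pos (by positivity : 0 < 2 * (σ ^ 2) ^ 2),
      div_le_iff₀ (by positivity)]
    calc _ ≤ _ := mul_le_mul hδ hs' (abs_nonneg _) (by positivity)
      _ = _ := by field_simp
  have e4 := abs_coef_le i j hσ hz
  have e5 : |3 * s / (2 * σ ^ 2)| ≤ r / σ * (3 / 2) := by
    rw [abs_div, abs_mul, abs_of_pos (by positivity : 0 < 2 * σ ^ 2),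
      div_le_iff₀ (by positivity), abs_of_pos (by norm_num : (0:ℝ) < 3)]
    calc _ ≤ _ := mul_le_mul_of_nonneg_left hs' (by norm_num)
      _ = _ := by field_simp
  have e6 : |inner ℝ w h / (2 * σ ^ 2)| ≤ r / σ * ρ := by
    rw [abs_div, abs_of_pos (by positivity : 0 < 2 * σ ^ 2), div_le_iff₀ (by positivity)]
    calc _ ≤ ‖w‖ * ‖h‖ := abs_real_inner_le_norm w h
      _ ≤ (ρ * σ) * (2 * r) := mul_le_mul hz.le hh (norm_nonneg _) (by positivity)
      _ = _ := by field_simp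
  have e7 : |‖w‖ ^ 2 * s / (4 * (σ ^ 2) ^ 2)| ≤ r / σ * (ρ ^ 2 / 4) := by
    rw [abs_div, abs_mul, abs_of_pos (by positivity : 0 < 4 * (σ ^ 2) ^ 2),
      div_le_iff₀ (by positivity), hz, abs_of_nonneg (by positivity : 0 ≤ (ρ * σ) ^ 2)]
    calc _ ≤ _ := mul_le_mul_of_nonneg_left hs' (by positivity)
      _ = _ := by field_simp
  generalize -(h i * w j + w i * h j) / (4 * (σ ^ 2) ^ 2) = x1 at *
  generalize w i * w j * s / (2 * (σ ^ 2) ^ 3) = x2 at *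
  generalize (if i = j then (1:ℝ) else 0) * s / (2 * (σ ^ 2) ^ 2) = x3 at *
  generalize w i * w j / (4 * (σ ^ 2) ^ 2) - (if i = j then (1:ℝ) else 0) / (2 * σ ^ 2) = x4 at *
  generalize 3 * s / (2 * σ ^ 2) = x5 at *
  generalize inner ℝ w h / (2 * σ ^ 2) = x6 at *
  generalize ‖w‖ ^ 2 * s / (4 * (σ ^ 2) ^ 2) = x7 at *
  have hK := heatK_le hT0 w
  have hK0 := heatK_nonneg hT0 w
  have h3 : (σ ^ 2) ^ (-(3:ℝ)/2) = 1 / σ ^ 3 := by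
    rw [← Real.rpow_natCast, ← Real.rpow_mul hσ.le, one_div, ← Real.rpow_natCast,
      ← Real.rpow_neg hσ.le]
    norm_num
  have hx : |x1 + x2 - x3| ≤ r / σ ^ 3 * (ρ + ρ ^ 2 / 2 + 1 / 2) := by
    rw [mul_add, mul_add]; exact abs_add_sub_le e1 e2 e3
  have hy : |x5 + x6 - x7| ≤ r / σ * (3 / 2 + ρ + ρ ^ 2 / 4) := by
    rw [mul_add, mul_add]; exact abs_add_sub_le e5 e6 e7
  have hxy : |x4 * (x5 + x6 - x7)| ≤ r / σ ^ 3 * ((ρ ^ 2 / 4 + 1 / 2) * (3 / 2 + ρ + ρ ^ 2 / 4)) := by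
    rw [abs_mul]
    calc _ ≤ _ := mul_le_mul e4 hy (abs_nonneg _) (by positivity)
      _ = _ := by field_simp
  have hE := exp_bound (a := 40) (b := ρ ^ 2 / 4) (y := ρ ^ 2 / 8)
    (c := (ρ + ρ ^ 2 / 2 + 1 / 2) + (ρ ^ 2 / 4 + 1 / 2) * (3 / 2 + ρ + ρ ^ 2 / 4))
    (by nlinarith [sq_nonneg ρ])
    (by nlinarith [sq_nonneg (ρ ^ 2), sq_nonneg ρ, sq_nonneg (ρ - 1), sq_nonneg (ρ * (ρ - 1))])
    (by norm_num)
  have hexp1 : -‖w‖ ^ 2 / (4 * σ ^ 2) = -(ρ ^ 2 / 4) := by rw [hz]; field_simp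
  have hexp2 : -(‖w‖ ^ 2 / (8 * σ ^ 2)) = -(ρ ^ 2 / 8) := by rw [hz]; field_simp
  rw [hexp1] at hK
  rw [hexp2]
  calc |(x1 + x2 - x3) * heatK (σ ^ 2) w + x4 * (heatK (σ ^ 2) w * (x5 + x6 - x7))|
      = |(x1 + x2 - x3) + x4 * (x5 + x6 - x7)| * heatK (σ ^ 2) w := by
        rw [← abs_of_nonneg hK0, ← abs_mul, abs_of_nonneg hK0]; congr 1; ring
    _ ≤ (r / σ ^ 3 * ((ρ + ρ ^ 2 / 2 + 1 / 2) + (ρ ^ 2 / 4 + 1 / 2) * (3 / 2 + ρ + ρ ^ 2 / 4))) *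
        ((σ ^ 2) ^ (-(3:ℝ)/2) * Real.exp (-(ρ ^ 2 / 4))) := by
        refine mul_le_mul ?_ hK hK0 (by positivity)
        rw [mul_add]
        exact (abs_add_le _ _).trans (add_le_add hx hxy)
    _ = r / σ ^ 3 * (σ ^ 2) ^ (-(3:ℝ)/2) *
        (((ρ + ρ ^ 2 / 2 + 1 / 2) + (ρ ^ 2 / 4 + 1 / 2) * (3 / 2 + ρ + ρ ^ 2 / 4)) *
          Real.exp (-(ρ ^ 2 / 4))) := by ring
    _ ≤ r / σ ^ 3 * (σ ^ 2) ^ (-(3:ℝ)/2) * (40 * Real.exp (-(ρ ^ 2 / 8))) :=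
        mul_le_mul_of_nonneg_left hE (by positivity)
    _ = _ := by rw [h3]; ring

/-- Smoothness of the second derivatives of the heat kernel at parabolic scale `r`. -/
theorem abs_ddK_sub_le (i j : Fin 3) {τ s r : ℝ} {z h : E3} (hr : 0 < r) (hτ : 4 * r ^ 2 ≤ τ)
    (hs : |s| ≤ r ^ 2) (hh : ‖h‖ ≤ 2 * r) :
    |ddK i j (τ - s) (z - h) - ddK i j τ z| ≤ 320 * r * τ ^ (-(3:ℝ)/2) * gauss τ z := by
  have hr2 := sq_pos_of_pos hr
  have hτ0 : 0 < τ := by linarith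
  have hb := abs_le.1 hs
  have hTb : ∀ θ ∈ Icc (0:ℝ) 1, 3 * τ / 4 ≤ τ - θ * s ∧ τ - θ * s ≤ 5 * τ / 4 := by
    intro θ hθ
    constructor <;> nlinarith [hθ.1, hθ.2]
  have hT0 : ∀ θ ∈ Icc (0:ℝ) 1, 0 < τ - θ * s := fun θ hθ => by linarith [(hTb θ hθ).1]
  have key := norm_image_sub_le_of_norm_deriv_le_segment_01'
    (f := fun θ : ℝ => ddK i j (τ - θ * s) (z - θ • h))
    (C := 320 * r * τ ^ (-(3:ℝ)/2) * gauss τ z)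
    (fun θ hθ => (hasDerivAt_ddK_path i j (hT0 θ hθ)).hasDerivWithinAt) ?_
  · simpa using key
  intro θ hθ
  have hθ' : θ ∈ Icc (0:ℝ) 1 := ⟨hθ.1, hθ.2.le⟩
  have hθh : ‖θ • h‖ ≤ 2 * r := by
    rw [norm_smul, Real.norm_eq_abs, abs_of_nonneg hθ.1]
    nlinarith [hθ.1, hθ.2, norm_nonneg h]
  obtain ⟨b1, b2⟩ := hTb θ hθ'
  refine (abs_pathDeriv_le i j hr (T := τ - θ * s) (by linarith) hs hh).trans ?_
  set T := τ - θ * s with hTdef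
  set w := z - θ • h with hwdef
  have hTpos : 0 < T := hT0 θ hθ'
  have hz2 : ‖z‖ ^ 2 / 2 - 4 * r ^ 2 ≤ ‖w‖ ^ 2 := by
    have : ‖z‖ ≤ ‖w‖ + 2 * r := by
      calc ‖z‖ = ‖w + θ • h‖ := by rw [hwdef]; simp
        _ ≤ _ := (norm_add_le _ _).trans (by gcongr)
    nlinarith [sq_nonneg (‖w‖ - 2 * r), norm_nonneg z, norm_nonneg w]
  have hpow : T ^ (-(3:ℝ)/2) ≤ 2 * τ ^ (-(3:ℝ)/2) := by
    have h1 : T ^ (-(3:ℝ)/2) ≤ ((1/2) * τ * (3/2)) ^ (-(3:ℝ)/2) :=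
      Real.rpow_le_rpow_of_nonpos (by positivity) (by linarith) (by norm_num)
    refine h1.trans ?_
    rw [show (1/2) * τ * (3/2) = (3/4) * τ by ring, Real.mul_rpow (by norm_num) hτ0.le]
    refine mul_le_mul_of_nonneg_right ?_ (by positivity)
    rw [show (-(3:ℝ)/2) = -(3/2) by ring, Real.rpow_neg (by norm_num),
      inv_le_comm₀ (by positivity) (by norm_num)]
    calc (2:ℝ)⁻¹ ≤ (3/4) ^ (2:ℝ) := by norm_num
      _ ≤ _ := Real.rpow_le_rpow_of_exponent_ge (by norm_num) (by norm_num) (by norm_num)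
  have hexp : Real.exp (-(‖w‖ ^ 2 / (8 * T))) ≤ 2 * Real.exp (-‖z‖ ^ 2 / (20 * τ)) := by
    have h1 : -(‖w‖ ^ 2 / (8 * T)) ≤ -‖z‖ ^ 2 / (20 * τ) + 1 / 10 := by
      have h2 : ‖w‖ ^ 2 / (10 * τ) ≤ ‖w‖ ^ 2 / (8 * T) :=
        div_le_div_of_nonneg_left (by positivity) (by positivity) (by linarith)
      have h3 : (‖z‖ ^ 2 / 2 - 4 * r ^ 2) / (10 * τ) ≤ ‖w‖ ^ 2 / (10 * τ) :=
        div_le_div_of_nonneg_right hz2 (by positivity)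
      have h4 : (‖z‖ ^ 2 / 2 - 4 * r ^ 2) / (10 * τ) = ‖z‖ ^ 2 / (20 * τ) - 4 * r ^ 2 / (10 * τ) := by
        field_simp
        ring
      have h5 : 4 * r ^ 2 / (10 * τ) ≤ 1 / 10 := by
        rw [div_le_div_iff₀ (by positivity) (by norm_num)]; nlinarith
      rw [neg_div]; linarith
    refine (Real.exp_le_exp.2 h1).trans ?_
    rw [Real.exp_add, mul_comm]
    refine mul_le_mul_of_nonneg_right ?_ (Real.exp_pos _).le
    have := Real.exp_one_lt_d9
    have h10 : Real.exp (1/10) ^ 10 = Real.exp 1 := by rw [← Real.exp_nat_mul]; norm_num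
    by_contra hc
    push Not at hc
    have := pow_le_pow_left₀ (by norm_num) hc.le 10
    norm_num at this
    linarith
  calc _ ≤ 40 * r * (2 * τ ^ (-(3:ℝ)/2)) * ((2 * τ ^ (-(3:ℝ)/2)) * (2 * Real.exp (-‖z‖ ^ 2 / (20 * τ)))) := by
        gcongr
    _ = _ := by unfold gauss; ring

/-- Second derivatives of the heat kernel, truncated to `ε < τ < N`. -/
def ddKTrunc (i j : Fin 3) (ε N : ℝ) (q : ℝ × E3) : ℝ :=
  if ε < q.1 ∧ q.1 < N then ddK i j q.1 q.2 else 0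

/-- The Gaussian majorant, extended by zero to nonpositive times. -/
def gaussE (q : ℝ × E3) : ℝ≥0∞ := if 0 < q.1 then ENNReal.ofReal (gauss q.1 q.2) else 0

theorem measurable_ddKTrunc (i j : Fin 3) (ε N : ℝ) : Measurable (ddKTrunc i j ε N) := by
  refine Measurable.ite ?_ (measurable_ddK i j) measurable_const
  exact (measurableSet_lt measurable_const measurable_fst).inter
    (measurableSet_lt measurable_fst measurable_const)

theorem measurable_gaussE : Measurable gaussE :=
  Measurable.ite (measurableSet_lt measurable_const measurable_fst)
    measurable_gauss.ennreal_ofReal measurable_const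

theorem lintegral_gaussE_le (t : ℝ) :
    ∫⁻ z : E3, gaussE (t, z) ≤ ENNReal.ofReal ((20 * Real.pi) ^ ((3:ℝ)/2)) := by
  by_cases ht : 0 < t
  · simp only [gaussE, ht, if_true]; exact (lintegral_gauss ht).le
  · simp [gaussE, ht]

theorem enorm_le_ofReal_mul_gaussE {q : ℝ × E3} (hq : 0 < q.1) {x c : ℝ} (hc : 0 ≤ c)
    (h : |x| ≤ c * gauss q.1 q.2) : ‖x‖ₑ ≤ ENNReal.ofReal c * gaussE q := by
  rw [gaussE, if_pos hq, ← ENNReal.ofReal_mul hc, Real.enorm_eq_ofReal_abs]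
  exact ENNReal.ofReal_le_ofReal h

/-- Time weight in the Hörmander estimate at scale `r`. -/
def hormWeight (ε N r t : ℝ) : ℝ≥0∞ :=
  (Icc (-(4 * r ^ 2)) (4 * r ^ 2)).indicator (fun _ => ENNReal.ofReal (4 / r ^ 2)) t
  + (Ici (4 * r ^ 2)).indicator
      (fun t => ENNReal.ofReal (320 * r) * ENNReal.ofReal (t ^ (-(3:ℝ)/2))) t
  + ((Icc (ε - r ^ 2) (ε + r ^ 2)).indicator (fun _ => ENNReal.ofReal (1 / r ^ 2)) t
  + (Icc (N - r ^ 2) (N + r ^ 2)).indicator (fun _ => ENNReal.ofReal (1 / r ^ 2)) t)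

theorem measurable_hormWeight (ε N r : ℝ) : Measurable (hormWeight ε N r) := by
  unfold hormWeight
  refine ((measurable_const.indicator measurableSet_Icc).add
    (Measurable.indicator ?_ measurableSet_Ici)).add
    ((measurable_const.indicator measurableSet_Icc).add
      (measurable_const.indicator measurableSet_Icc))
  fun_prop

theorem lintegral_hormWeight (ε N : ℝ) {r : ℝ} (hr : 0 < r) :
    ∫⁻ t, hormWeight ε N r t = ENNReal.ofReal 356 := by
  unfold hormWeight
  have hr2 := sq_pos_of_pos hr
  rw [lintegral_add_left, lintegral_add_left, lintegral_add_left]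
  · rw [lintegral_indicator_const measurableSet_Icc, lintegral_indicator_const measurableSet_Icc,
      lintegral_indicator_const measurableSet_Icc, lintegral_indicator measurableSet_Ici,
      ← setLIntegral_congr Ioi_ae_eq_Ici,
      lintegral_const_mul _ (by fun_prop), lintegral_Ioi_rpow (by positivity) (by norm_num),
      Real.volume_Icc, Real.volume_Icc, Real.volume_Icc]
    have h4 : (4 * r ^ 2) ^ (-(3:ℝ)/2 + 1) = 1 / (2 * r) := by
      rw [show 4 * r ^ 2 = (2 * r) ^ (2:ℕ) by ring, ← Real.rpow_natCast, ← Real.rpow_mul (by positivity),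
        one_div, ← Real.rpow_neg_one]
      norm_num
    rw [h4, ← ENNReal.ofReal_mul (by positivity), ← ENNReal.ofReal_mul (by positivity),
      ← ENNReal.ofReal_mul (by positivity), ← ENNReal.ofReal_mul (by positivity),
      ← ENNReal.ofReal_add, ← ENNReal.ofReal_add, ← ENNReal.ofReal_add]
    · congr 1
      field_simp
      ring
    all_goals ring_nf; positivity
  all_goals try exact measurable_const.indicator measurableSet_Icc
  exact (measurable_const.indicator measurableSet_Icc).add
    (Measurable.indicator (by fun_prop) measurableSet_Ici)

theorem ddKTrunc_sub_le (i j : Fin 3) {ε N : ℝ} (hε : 0 < ε) {r : ℝ} (hr : 0 < r) {y : ℝ × E3}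
    (hy1 : |y.1| ≤ r ^ 2) (hy2 : ‖y.2‖ ≤ 2 * r) {x : ℝ × E3} (hx : x ∉ box r) :
    ‖ddKTrunc i j ε N (x - y) - ddKTrunc i j ε N x‖ₑ
      ≤ hormWeight ε N r x.1 * (gaussE x + gaussE (x - y)) := by
  have hr2 := sq_pos_of_pos hr
  obtain ⟨s, h⟩ := y
  obtain ⟨τ, z⟩ := x
  simp only at hy1 hy2
  have hs := abs_le.1 hy1
  have hsub : ((τ, z) - (s, h) : ℝ × E3) = (τ - s, z - h) := rfl
  rw [hsub]
  rcases lt_or_ge |τ| (4 * r ^ 2) with hτ | hτ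
  · have hz : 4 * r ≤ ‖z‖ := by
      by_contra hc
      exact hx ⟨hτ, not_le.1 hc⟩
    have hzh : 2 * r ≤ ‖z - h‖ := by linarith [norm_sub_norm_le z h]
    have hw : ENNReal.ofReal (4 / r ^ 2) ≤ hormWeight ε N r τ := by
      unfold hormWeight
      rw [indicator_of_mem (show τ ∈ Icc _ _ from abs_le.1 hτ.le), add_assoc]
      exact le_self_add
    have hk : ∀ (t : ℝ) (w : E3), 2 * r ≤ ‖w‖ →
        ‖ddKTrunc i j ε N (t, w)‖ₑ ≤ ENNReal.ofReal (4 / r ^ 2) * gaussE (t, w) := by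
      intro t w hw
      unfold ddKTrunc
      split_ifs with hc
      · exact enorm_le_ofReal_mul_gaussE (hε.trans hc.1) (by positivity)
          (abs_ddK_le_of_le_norm i j (hε.trans hc.1) hr hw)
      · simp
    refine (enorm_sub_le).trans ?_
    rw [mul_add, add_comm]
    exact add_le_add ((hk τ z (by linarith)).trans (mul_le_mul_left hw _))
      ((hk _ _ hzh).trans (mul_le_mul_left hw _))
  rcases le_or_gt 0 τ with h0 | h0
  swap
  · rw [abs_of_neg h0] at hτ
    have e1 : ddKTrunc i j ε N (τ, z) = 0 := if_neg fun hc => by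
      simp only at hc; linarith [hc.1]
    have e2 : ddKTrunc i j ε N (τ - s, z - h) = 0 := if_neg fun hc => by
      simp only at hc; linarith [hc.1]
    simp [e1, e2]
  rw [abs_of_nonneg h0] at hτ
  have hτs : 3 * r ^ 2 ≤ τ - s := by linarith [hs.2]
  have hedge : (¬ (ε < τ ∧ τ < N) ∧ (ε < τ - s ∧ τ - s < N)) ∨
      ((ε < τ ∧ τ < N) ∧ ¬ (ε < τ - s ∧ τ - s < N)) →
      ENNReal.ofReal (1 / r ^ 2) ≤ hormWeight ε N r τ := by
    intro hc
    have : τ ∈ Icc (ε - r ^ 2) (ε + r ^ 2) ∨ τ ∈ Icc (N - r ^ 2) (N + r ^ 2) := by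
      simp only [not_and_or, not_lt] at hc
      rcases hc with ⟨h1 | h1, h2, h3⟩ | ⟨⟨h2, h3⟩, h1 | h1⟩
      · left; constructor <;> linarith
      · right; constructor <;> linarith
      · left; constructor <;> linarith
      · right; constructor <;> linarith
    unfold hormWeight
    refine le_trans ?_ le_add_self
    rcases this with h1 | h1
    · rw [indicator_of_mem h1]; exact le_self_add
    · rw [indicator_of_mem h1 (fun _ => ENNReal.ofReal (1 / r ^ 2))]; exact le_add_self
  have hbd : ∀ (t : ℝ) (w : E3), 3 * r ^ 2 ≤ t →
      ‖ddK i j t w‖ₑ ≤ ENNReal.ofReal (1 / r ^ 2) * gaussE (t, w) := by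
    intro t w ht
    have ht0 : 0 < t := by linarith
    refine enorm_le_ofReal_mul_gaussE ht0 (by positivity) ((abs_ddK_le i j ht0 w).trans ?_)
    refine mul_le_mul_of_nonneg_right ?_ (gauss_nonneg ht0 w)
    rw [div_le_div_iff₀ ht0 hr2]; linarith
  by_cases h1 : ε < τ ∧ τ < N <;> by_cases h2 : ε < τ - s ∧ τ - s < N
  · rw [ddKTrunc, ddKTrunc, if_pos h1, if_pos h2]
    have h3 := abs_ddK_sub_le i j hr hτ hy1 hy2 (z := z)
    have hw : ENNReal.ofReal (320 * r * τ ^ (-(3:ℝ)/2)) ≤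
        hormWeight ε N r τ := by
      unfold hormWeight
      rw [indicator_of_mem (show τ ∈ Ici (4 * r ^ 2) from hτ), ENNReal.ofReal_mul (by positivity),
        add_right_comm]
      exact le_add_self
    calc _ ≤ _ := enorm_le_ofReal_mul_gaussE (q := (τ, z)) (by simp only; linarith) (by positivity) h3
      _ ≤ _ := mul_le_mul' hw le_self_add
  · rw [ddKTrunc, ddKTrunc, if_pos h1, if_neg h2, zero_sub, enorm_neg]
    exact (hbd τ z (by linarith)).trans (mul_le_mul' (hedge (Or.inr ⟨h1, h2⟩)) le_self_add)
  · rw [ddKTrunc, ddKTrunc, if_neg h1, if_pos h2, sub_zero]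
    exact (hbd _ _ hτs).trans (mul_le_mul' (hedge (Or.inl ⟨h1, h2⟩)) le_add_self)
  · rw [ddKTrunc, ddKTrunc, if_neg h1, if_neg h2]; simp

/-- The Hörmander constant of the truncated kernels. -/
def hormConst : ℝ≥0∞ := ENNReal.ofReal 356 *
  (ENNReal.ofReal ((20 * Real.pi) ^ ((3:ℝ)/2)) + ENNReal.ofReal ((20 * Real.pi) ^ ((3:ℝ)/2)))

theorem hormander_ddKTrunc (i j : Fin 3) {ε N : ℝ} (hε : 0 < ε) {r : ℝ} (hr : 0 < r) (y : ℝ × E3)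
    (hy1 : |y.1| ≤ r ^ 2) (hy2 : ‖y.2‖ ≤ 2 * r) :
    ∫⁻ x in (box r)ᶜ, ‖ddKTrunc i j ε N (x - y) - ddKTrunc i j ε N x‖ₑ ≤ hormConst := by
  calc _ ≤ ∫⁻ x in (box r)ᶜ, hormWeight ε N r x.1 * (gaussE x + gaussE (x - y)) :=
        setLIntegral_mono' (measurableSet_box r).compl
          fun x hx => ddKTrunc_sub_le i j hε hr hy1 hy2 hx
    _ ≤ ∫⁻ x : ℝ × E3, hormWeight ε N r x.1 * (gaussE x + gaussE (x - y)) := setLIntegral_le_lintegral _ _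
    _ = ∫⁻ t : ℝ, ∫⁻ z : E3, hormWeight ε N r t * (gaussE (t, z) + gaussE ((t, z) - y)) := by
        refine lintegral_prod _ ?_
        have := measurable_hormWeight ε N r
        have := measurable_gaussE
        fun_prop
    _ ≤ ∫⁻ t : ℝ, hormWeight ε N r t * (ENNReal.ofReal ((20 * Real.pi) ^ ((3:ℝ)/2))
          + ENNReal.ofReal ((20 * Real.pi) ^ ((3:ℝ)/2))) := by
        refine lintegral_mono fun t => ?_
        have hm : Measurable fun z : E3 => gaussE (t, z) := measurable_gaussE.comp (by fun_prop)
        have hm' : Measurable fun z : E3 => gaussE ((t, z) - y) := measurable_gaussE.comp (by fun_prop)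
        rw [lintegral_const_mul _ (by fun_prop), lintegral_add_left hm]
        refine mul_le_mul_right (add_le_add (lintegral_gaussE_le t) ?_) _
        refine le_trans (le_of_eq ?_) (lintegral_gaussE_le (t - y.1))
        exact lintegral_sub_right_eq_self (fun z => gaussE (t - y.1, z)) y.2
    _ = _ := by
        rw [lintegral_mul_const _ (measurable_hormWeight ε N r), lintegral_hormWeight ε N hr]
        rfl

theorem integrable_gauss {τ : ℝ} (hτ : 0 < τ) : Integrable (gauss τ) := by
  refine ⟨(measurable_gauss.comp (by fun_prop : Measurable fun z : E3 => (τ, z))).aestronglyMeasurable, ?_⟩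
  refine lt_of_le_of_lt ?_ (ENNReal.ofReal_lt_top (r := (20 * Real.pi) ^ ((3:ℝ)/2)))
  rw [← lintegral_gauss hτ]
  refine lintegral_mono fun z => ?_
  rw [Real.enorm_eq_ofReal_abs, abs_of_nonneg (gauss_nonneg hτ z)]

theorem integrable_of_le_gauss {τ c : ℝ} (hτ : 0 < τ) {f : E3 → ℝ} (hf : Measurable f)
    (h : ∀ z, |f z| ≤ c * gauss τ z) : Integrable f :=
  ((integrable_gauss hτ).const_mul c).mono' hf.aestronglyMeasurable (ae_of_all _ h)

theorem integrable_heatK {τ : ℝ} (hτ : 0 < τ) : Integrable (heatK τ) :=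
  integrable_of_le_gauss (c := 1) hτ (measurable_heatK.comp (by fun_prop : Measurable fun z : E3 => (τ, z)))
    fun z => by rw [abs_of_nonneg (heatK_nonneg hτ z), one_mul]; exact heatK_le_gauss hτ z

theorem integrable_dK (i : Fin 3) {τ : ℝ} (hτ : 0 < τ) : Integrable (dK i τ) :=
  integrable_of_le_gauss hτ ((measurable_dK i).comp (by fun_prop : Measurable fun z : E3 => (τ, z)))
    (abs_dK_le i hτ)

theorem integrable_ddK (i j : Fin 3) {τ : ℝ} (hτ : 0 < τ) : Integrable (ddK i j τ) :=
  integrable_of_le_gauss hτ ((measurable_ddK i j).comp (by fun_prop : Measurable fun z : E3 => (τ, z)))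
    (abs_ddK_le i j hτ)

open FourierTransform in
theorem fourier_pderiv {f : E3 → ℂ} (hf : Integrable f) (hd : Differentiable ℝ f)
    (hf' : ∀ i, Integrable fun z => fderiv ℝ f z (EuclideanSpace.single i 1)) (i : Fin 3) (ξ : E3) :
    𝓕 (fun z => fderiv ℝ f z (EuclideanSpace.single i 1)) ξ = (2 * Real.pi * Complex.I * ξ i) * 𝓕 f ξ := by
  have hi : Integrable (fderiv ℝ f) := by
    have hm : AEStronglyMeasurable (fderiv ℝ f) volume :=
      (measurable_fderiv ℝ f).stronglyMeasurable.aestronglyMeasurable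
    refine (integrable_finsetSum Finset.univ fun l _ => (hf' l).norm).mono' hm
      (ae_of_all _ fun z => ContinuousLinearMap.opNorm_le_bound _ (by positivity) fun v => ?_)
    have hv : v = ∑ l, v l • EuclideanSpace.single l (1:ℝ) := by
      conv_lhs => rw [← (EuclideanSpace.basisFun (Fin 3) ℝ).sum_repr v]
      simp
    conv_lhs => rw [hv]
    rw [map_sum, Finset.sum_mul]
    refine (norm_sum_le _ _).trans (Finset.sum_le_sum fun l _ => ?_)
    rw [map_smul, norm_smul, mul_comm]
    exact mul_le_mul_of_nonneg_left (PiLp.norm_apply_le v l) (norm_nonneg _)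
  rw [← Real.fourier_continuousLinearMap_apply hi, Real.fourier_fderiv hf hd hi]
  rw [VectorFourier.fourierSMulRight_apply]
  have h : innerSL ℝ ξ (EuclideanSpace.single i (1:ℝ)) = ξ i := by
    rw [innerSL_apply_apply, EuclideanSpace.inner_single_right]; simp
  rw [neg_apply, neg_apply, h]
  simp
  ring

theorem hasFDerivAt_ofReal_comp {f : E3 → ℝ} {f' : E3 →L[ℝ] ℝ} {z : E3} (h : HasFDerivAt f f' z) :
    HasFDerivAt (fun y => (f y : ℂ)) (Complex.ofRealCLM.comp f') z :=
  Complex.ofRealCLM.hasFDerivAt.comp z h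

theorem fderiv_ofReal_comp {f : E3 → ℝ} {z v : E3} (h : DifferentiableAt ℝ f z) :
    fderiv ℝ (fun y => (f y : ℂ)) z v = (fderiv ℝ f z v : ℝ) := by
  rw [(hasFDerivAt_ofReal_comp h.hasFDerivAt).fderiv]; rfl

open FourierTransform in
theorem norm_fourier_heatK {τ : ℝ} (hτ : 0 < τ) (ξ : E3) :
    ‖𝓕 (fun z => (heatK τ z : ℂ)) ξ‖ = Real.exp (-(4 * Real.pi ^ 2 * ‖ξ‖ ^ 2) * τ) := by
  have hb : 0 < 1 / (4 * τ) := by positivity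
  have e : (fun z => (heatK τ z : ℂ)) = fun z => (((4 * Real.pi * τ) ^ (-(3:ℝ)/2) : ℝ) : ℂ) •
      Complex.exp (-((1 / (4 * τ) : ℝ) : ℂ) * ‖z‖ ^ 2) := by
    ext z
    unfold heatK
    push_cast
    rw [smul_eq_mul]
    congr 2
    ring
  have h1 := fourier_gaussian_innerProductSpace (V := E3) (b := ((1 / (4 * τ) : ℝ) : ℂ)) (by simpa using hb) ξ
  rw [e, Real.fourier_eq]
  simp_rw [smul_comm _ (((4 * Real.pi * τ) ^ (-(3:ℝ)/2) : ℝ) : ℂ)]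
  rw [integral_smul, ← Real.fourier_eq, h1, norm_smul, norm_mul, ← Complex.ofReal_div,
    Complex.norm_cpow_eq_rpow_re_of_pos (by positivity), Complex.norm_exp, ← mul_assoc]
  have h2 : ‖(((4 * Real.pi * τ) ^ (-(3:ℝ)/2) : ℝ) : ℂ)‖ * (Real.pi / (1 / (4 * τ))) ^
      (((Module.finrank ℝ E3 : ℕ) : ℂ) / 2).re = 1 := by
    rw [Complex.norm_real, Real.norm_of_nonneg (by positivity),
      show Module.finrank ℝ E3 = 3 from finrank_euclideanSpace_fin,
      show Real.pi / (1 / (4 * τ)) = 4 * Real.pi * τ by field_simp, ← Real.rpow_add (by positivity)]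
    have : (-(3:ℝ)/2) + (((3 : ℕ) : ℂ) / 2).re = 0 := by simp; norm_num
    rw [this, Real.rpow_zero]
  rw [h2, one_mul]
  congr 1
  have : (-(Real.pi:ℂ) ^ 2 * ‖ξ‖ ^ 2 / ((1 / (4 * τ) : ℝ) : ℂ)) =
    ((-(4 * Real.pi ^ 2 * ‖ξ‖ ^ 2) * τ : ℝ) : ℂ) := by push_cast; field_simp
  rw [this, Complex.ofReal_re]

open FourierTransform in
theorem norm_fourier_ddK_le (i j : Fin 3) {τ : ℝ} (hτ : 0 < τ) (ξ : E3) :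
    ‖𝓕 (fun z => (ddK i j τ z : ℂ)) ξ‖
      ≤ (4 * Real.pi ^ 2 * ‖ξ‖ ^ 2) * Real.exp (-(4 * Real.pi ^ 2 * ‖ξ‖ ^ 2) * τ) := by
  have d0 : ∀ z, DifferentiableAt ℝ (heatK τ) z := fun z => (hasFDerivAt_heatK τ z).differentiableAt
  have d1 : ∀ l z, DifferentiableAt ℝ (dK l τ) z := fun l z => (hasFDerivAt_dK l τ z).differentiableAt
  have e0 : ∀ l, (fun z => fderiv ℝ (fun y => (heatK τ y : ℂ)) z (EuclideanSpace.single l 1))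
      = fun z => (dK l τ z : ℂ) := fun l => by
    ext z; rw [fderiv_ofReal_comp (d0 z), fderiv_heatK_single]
  have e1 : ∀ l, (fun z => fderiv ℝ (fun y => (dK j τ y : ℂ)) z (EuclideanSpace.single l 1))
      = fun z => (ddK l j τ z : ℂ) := fun l => by
    ext z; rw [fderiv_ofReal_comp (d1 j z), fderiv_dK_single]
  have i0 : Integrable fun z => (heatK τ z : ℂ) := (integrable_heatK hτ).ofReal
  have i1 : Integrable fun z => (dK j τ z : ℂ) := (integrable_dK j hτ).ofReal
  have f0 := fourier_pderiv i0
    (fun z => (hasFDerivAt_ofReal_comp (d0 z).hasFDerivAt).differentiableAt)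
    (fun l => by rw [e0]; exact (integrable_dK l hτ).ofReal) j ξ
  have f1 := fourier_pderiv i1
    (fun z => (hasFDerivAt_ofReal_comp (d1 j z).hasFDerivAt).differentiableAt)
    (fun l => by rw [e1]; exact (integrable_ddK l j hτ).ofReal) i ξ
  rw [e0] at f0
  rw [e1] at f1
  rw [f1, f0, norm_mul, norm_mul _ (𝓕 (fun z => (heatK τ z : ℂ)) ξ), norm_fourier_heatK hτ]
  have hn : ∀ l : Fin 3, ‖(2 * Real.pi * Complex.I * ξ l : ℂ)‖ ≤ 2 * Real.pi * ‖ξ‖ := fun l => by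
    simp [abs_of_pos Real.pi_pos]
    exact mul_le_mul_of_nonneg_left (abs_apply_le ξ l) (by positivity)
  rw [← mul_assoc]
  refine mul_le_mul_of_nonneg_right ?_ (Real.exp_pos _).le
  calc _ ≤ _ := mul_le_mul (hn i) (hn j) (norm_nonneg _) (by positivity)
    _ = _ := by ring

/-- The character `x ↦ exp(-2πi⟨x, ξ⟩)`. -/
def expChar (ξ x : E3) : ℂ := (Real.fourierChar (-inner ℝ x ξ) : ℂ)

theorem measurable_expChar : Measurable fun q : E3 × E3 => expChar q.1 q.2 := by
  unfold expChar
  have h : Continuous fun t : ℝ => (Real.fourierChar t : ℂ) :=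
    continuous_subtype_val.comp Real.continuous_fourierChar
  exact (h.comp (by fun_prop)).measurable

theorem norm_expChar (ξ x : E3) : ‖expChar ξ x‖ = 1 := Circle.norm_coe _

theorem expChar_add (ξ x y : E3) : expChar ξ (x + y) = expChar ξ x * expChar ξ y := by
  unfold expChar
  rw [inner_add_left, neg_add, AddChar.map_add_eq_mul, Circle.coe_mul]

open FourierTransform in
theorem fourier_eq_expChar (f : E3 → ℂ) (ξ : E3) : 𝓕 f ξ = ∫ x, expChar ξ x * f x := by
  rw [Real.fourier_eq]; rfl

theorem memLp_two_of_bounded {φ : E3 → ℂ} (h : Integrable φ) {M : ℝ} (hM : ∀ x, ‖φ x‖ ≤ M) :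
    MemLp φ 2 := by
  rw [memLp_two_iff_integrable_sq_norm h.1]
  simp_rw [pow_two]
  exact h.norm.bdd_mul (c := M) h.1.norm (ae_of_all _ fun x => by simpa using hM x)

attribute [irreducible] expChar

theorem Measurable.expChar {α : Type*} [MeasurableSpace α] {f g : α → E3} (hf : Measurable f)
    (hg : Measurable g) : Measurable fun a => expChar (f a) (g a) :=
  measurable_expChar.comp (hf.prodMk hg)

/-- The partial Fourier transform in space. -/
def fourierX (f : ℝ × E3 → ℝ) (t : ℝ) (ξ : E3) : ℂ := ∫ x, expChar ξ x * (f (t, x) : ℂ)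

theorem measurable_fourierX {f : ℝ × E3 → ℝ} (hf : Measurable f) :
    Measurable fun q : ℝ × E3 => fourierX f q.1 q.2 := by
  refine (StronglyMeasurable.integral_prod_right'
    (f := fun a : (ℝ × E3) × E3 => expChar a.1.2 a.2 * (f (a.1.1, a.2) : ℂ)) ?_).measurable
  apply Measurable.stronglyMeasurable
  have h1 : Measurable fun a : (ℝ × E3) × E3 => expChar a.1.2 a.2 :=
    Measurable.expChar (by fun_prop) (by fun_prop)
  exact h1.mul (by fun_prop)

theorem lintegral_fourierX_sq {f : ℝ × E3 → ℝ} {t : ℝ} (h1 : Integrable fun x => f (t, x)) {M : ℝ}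
    (hM : ∀ x, |f (t, x)| ≤ M) : ∫⁻ ξ, ‖fourierX f t ξ‖ₑ ^ 2 = ∫⁻ x, ‖f (t, x)‖ₑ ^ 2 := by
  have i1 : Integrable fun x => (f (t, x) : ℂ) := h1.ofReal
  have := lintegral_fourier_sq i1 (memLp_two_of_bounded i1 (M := M) fun x => by simpa using hM x)
  simp_rw [fourier_eq_expChar] at this
  have e : ∀ r : ℝ, ‖(r : ℂ)‖ₑ = ‖r‖ₑ := fun r => by
    rw [← ofReal_norm, ← ofReal_norm, Complex.norm_real]
  simp_rw [e] at this
  exact this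

section

variable {k g : ℝ × E3 → ℝ} {S : ℝ≥0∞}

theorem lintegral_slice_mul_le (hk : Measurable k) (hg : Measurable g)
    (hS : ∀ τ, ∫⁻ z, ‖k (τ, z)‖ₑ ≤ S) (t : ℝ) :
    ∫⁻ q : ℝ × E3, ∫⁻ x : E3, ‖k ((t, x) - q) * g q‖ₑ ≤ S * ∫⁻ q, ‖g q‖ₑ := by
  rw [← lintegral_const_mul _ (by fun_prop)]
  refine lintegral_mono fun q => ?_
  simp_rw [enorm_mul]
  rw [lintegral_mul_const _ (by fun_prop)]
  refine mul_le_mul_left (le_trans (le_of_eq ?_) (hS (t - q.1))) _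
  exact lintegral_sub_right_eq_self (fun z => ‖k (t - q.1, z)‖ₑ) q.2

theorem integrable_slice_mul (hk : Measurable k) (hg : Measurable g) (hgi : Integrable g)
    (hSt : S ≠ ⊤) (hS : ∀ τ, ∫⁻ z, ‖k (τ, z)‖ₑ ≤ S) (t : ℝ) :
    Integrable (fun a : (ℝ × E3) × E3 => k ((t, a.2) - a.1) * g a.1) := by
  have hm : Measurable (fun a : (ℝ × E3) × E3 => k ((t, a.2) - a.1) * g a.1) := by fun_prop
  refine ⟨hm.aestronglyMeasurable, ?_⟩
  rw [HasFiniteIntegral, Measure.volume_eq_prod, lintegral_prod _ (by fun_prop)]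
  refine (lintegral_slice_mul_le hk hg hS t).trans_lt ?_
  exact ENNReal.mul_lt_top hSt.lt_top hgi.2

theorem integrable_cv_slice (hk : Measurable k) (hg : Measurable g) (hgi : Integrable g)
    (hSt : S ≠ ⊤) (hS : ∀ τ, ∫⁻ z, ‖k (τ, z)‖ₑ ≤ S) (t : ℝ) :
    Integrable fun x => cv k g (t, x) := by
  have := integrable_slice_mul hk hg hgi hSt hS t
  rw [Measure.volume_eq_prod] at this
  exact this.integral_prod_right

theorem fourierX_cv (hk : Measurable k) (hg : Measurable g) (hgi : Integrable g)
    (hSt : S ≠ ⊤) (hS : ∀ τ, ∫⁻ z, ‖k (τ, z)‖ₑ ≤ S) (t : ℝ) (ξ : E3) :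
    fourierX (cv k g) t ξ = ∫ s, fourierX k (t - s) ξ * fourierX g s ξ := by
  have hi : Integrable (fun a : (ℝ × E3) × E3 => ((k ((t, a.2) - a.1) * g a.1 : ℝ) : ℂ)) :=
    (integrable_slice_mul hk hg hgi hSt hS t).ofReal
  have he : Measurable fun a : (ℝ × E3) × E3 => expChar ξ a.2 :=
    Measurable.expChar measurable_const measurable_snd
  have hi2 : Integrable (fun a : (ℝ × E3) × E3 =>
      expChar ξ a.2 * ((k ((t, a.2) - a.1) * g a.1 : ℝ) : ℂ)) :=
    hi.bdd_mul (c := 1) he.aestronglyMeasurable (ae_of_all _ fun a => (norm_expChar _ _).le)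
  rw [Measure.volume_eq_prod] at hi2
  have hin : ∀ q : ℝ × E3, ∫ x, expChar ξ x * ((k ((t, x) - q) * g q : ℝ) : ℂ)
      = fourierX k (t - q.1) ξ * (expChar ξ q.2 * (g q : ℂ)) := by
    intro q
    unfold fourierX
    rw [← integral_mul_const, ← integral_add_right_eq_self _ q.2]
    refine integral_congr_ae (ae_of_all _ fun x => ?_)
    have : ((t, x + q.2) - q : ℝ × E3) = (t - q.1, x) := by ext <;> simp
    simp only [expChar_add, this]
    push_cast; ring
  have h1 : fourierX (cv k g) t ξ
      = ∫ q : ℝ × E3, ∫ x, expChar ξ x * ((k ((t, x) - q) * g q : ℝ) : ℂ) := by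
    rw [integral_integral_swap hi2]
    unfold fourierX cv
    refine integral_congr_ae (ae_of_all _ fun x => ?_)
    simp only
    rw [integral_const_mul, integral_complex_ofReal]
  rw [h1]
  have hi3 := hi2.integral_prod_left
  simp_rw [hin] at hi3 ⊢
  rw [Measure.volume_eq_prod] at hi3 ⊢
  rw [integral_prod _ hi3]
  refine integral_congr_ae (ae_of_all _ fun s => ?_)
  simp only
  rw [integral_const_mul]
  rfl

theorem lintegral_cv_sq_le (hk : Measurable k) {B : ℝ} (hB : ∀ q, |k q| ≤ B)
    (hSt : S ≠ ⊤) (hS : ∀ τ, ∫⁻ z, ‖k (τ, z)‖ₑ ≤ S) {m : E3 → ℝ → ℝ≥0∞}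
    (hm : ∀ ξ, Measurable (m ξ)) (hkm : ∀ τ ξ, ‖fourierX k τ ξ‖ₑ ≤ m ξ τ)
    (hm1 : ∀ ξ, ∫⁻ τ, m ξ τ ≤ 1)
    (hg : Measurable g) (hgi : Integrable g) (hgb : ∃ M, ∀ q, |g q| ≤ M) :
    ∫⁻ q, ‖cv k g q‖ₑ ^ 2 ≤ ∫⁻ q, ‖g q‖ₑ ^ 2 := by
  obtain ⟨M, hM⟩ := hgb
  have hcm := measurable_cv hk hg
  have hFm := measurable_fourierX hcm
  have hGm := measurable_fourierX hg
  have hcb : ∀ q, |cv k g q| ≤ B * ∫ r, |g r| := by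
    intro q
    rw [← integral_const_mul, ← Real.norm_eq_abs]
    refine norm_integral_le_of_norm_le (hgi.norm.const_mul B) (ae_of_all _ fun r => ?_)
    rw [norm_mul]
    exact mul_le_mul_of_nonneg_right (hB _) (norm_nonneg _)
  have hyoung : ∀ ξ, ∫⁻ t, ‖fourierX (cv k g) t ξ‖ₑ ^ 2 ≤ ∫⁻ s, ‖fourierX g s ξ‖ₑ ^ 2 := by
    intro ξ
    have hG1 : Measurable fun s => ‖fourierX g s ξ‖ₑ :=
      (hGm.comp (by fun_prop : Measurable fun s : ℝ => (s, ξ))).enorm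
    have y := lintegral_conv_rpow_le (μ := (volume : Measure ℝ)) (p := 2) (by norm_num) (hm ξ) hG1
    simp only [ENNReal.rpow_two] at y
    calc _ ≤ ∫⁻ t, (∫⁻ r, m ξ r * ‖fourierX g (t - r) ξ‖ₑ) ^ 2 := by
          refine lintegral_mono fun t => pow_le_pow_left' ?_ 2
          rw [fourierX_cv hk hg hgi hSt hS]
          refine (enorm_integral_le_lintegral_enorm _).trans ?_
          rw [← lintegral_sub_left_eq_self _ t]
          refine lintegral_mono fun s => ?_
          rw [enorm_mul, sub_sub_cancel]
          exact mul_le_mul_left (hkm s ξ) _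
      _ ≤ _ := y
      _ ≤ 1 ^ 2 * ∫⁻ s, ‖fourierX g s ξ‖ₑ ^ 2 := mul_le_mul_left (pow_le_pow_left' (hm1 ξ) 2) _
      _ = _ := by rw [one_pow, one_mul]
  have hgs : ∀ᵐ s : ℝ, Integrable fun y => g (s, y) := by
    rw [Measure.volume_eq_prod] at hgi
    exact hgi.prod_right_ae
  calc ∫⁻ q, ‖cv k g q‖ₑ ^ 2 = ∫⁻ t : ℝ, ∫⁻ x : E3, ‖cv k g (t, x)‖ₑ ^ 2 := by
        rw [Measure.volume_eq_prod]; exact lintegral_prod _ (by fun_prop)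
    _ = ∫⁻ t : ℝ, ∫⁻ ξ : E3, ‖fourierX (cv k g) t ξ‖ₑ ^ 2 := by
        refine lintegral_congr fun t => ?_
        rw [lintegral_fourierX_sq (integrable_cv_slice hk hg hgi hSt hS t) fun x => hcb _]
    _ = ∫⁻ ξ : E3, ∫⁻ t : ℝ, ‖fourierX (cv k g) t ξ‖ₑ ^ 2 := by
        refine lintegral_lintegral_swap ?_
        exact (hFm.enorm.pow_const 2).aemeasurable
    _ ≤ ∫⁻ ξ : E3, ∫⁻ s : ℝ, ‖fourierX g s ξ‖ₑ ^ 2 := lintegral_mono hyoung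
    _ = ∫⁻ s : ℝ, ∫⁻ ξ : E3, ‖fourierX g s ξ‖ₑ ^ 2 := by
        refine (lintegral_lintegral_swap ?_).symm
        exact (hGm.enorm.pow_const 2).aemeasurable
    _ = ∫⁻ s : ℝ, ∫⁻ y : E3, ‖g (s, y)‖ₑ ^ 2 := by
        refine lintegral_congr_ae ?_
        filter_upwards [hgs] with s hs
        rw [lintegral_fourierX_sq hs fun x => hM _]
    _ = _ := by
        rw [Measure.volume_eq_prod]; exact (lintegral_prod _ (hg.enorm.pow_const 2).aemeasurable).symm

end

theorem IsCZKernel.neg {k : ℝ × E3 → ℝ} {A : ℝ≥0∞} (hk : IsCZKernel k A) :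
    IsCZKernel (fun q => k (-q)) A where
  measurable := hk.measurable.comp measurable_neg
  bounded := by obtain ⟨B, hB⟩ := hk.bounded; exact ⟨B, fun q => hB _⟩
  l2 := by
    intro g hg hgi ⟨M, hM⟩
    have h := hk.l2 (fun q => g (-q)) (hg.comp measurable_neg) hgi.comp_neg ⟨M, fun q => hM _⟩
    have e : ∀ q, cv k (fun r => g (-r)) (-q) = cv (fun q => k (-q)) g q := by
      intro q
      unfold cv
      rw [← integral_neg_eq_self]
      refine integral_congr_ae (ae_of_all _ fun r => ?_)
      simp only [neg_neg]
      congr 2; abel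
    rw [← lintegral_neg_eq_self, ← lintegral_neg_eq_self (fun q => ‖g (-q)‖ₑ ^ 2)] at h
    simpa only [e, neg_neg] using h
  hormander := by
    intro r hr y hy1 hy2
    have h := hk.hormander r hr (-y) (by simpa using hy1) (by simpa using hy2)
    have hb := (measurableSet_box r).compl
    rw [← lintegral_indicator hb] at h ⊢
    rw [← lintegral_neg_eq_self] at h
    refine (lintegral_congr fun x => ?_).trans_le h
    have hbox : -x ∈ (box r)ᶜ ↔ x ∈ (box r)ᶜ := by simp [box]
    by_cases hx : x ∈ (box r)ᶜ
    · rw [indicator_of_mem hx, indicator_of_mem (hbox.2 hx)]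
      congr 3; abel
    · rw [indicator_of_notMem hx, indicator_of_notMem (fun h => hx (hbox.1 h))]

theorem abs_ddKTrunc_le (i j : Fin 3) {ε N : ℝ} (hε : 0 < ε) (q : ℝ × E3) :
    |ddKTrunc i j ε N q| ≤ 2 / ε * ε ^ (-(3:ℝ)/2) := by
  unfold ddKTrunc
  split_ifs with h
  · have h0 : 0 < q.1 := hε.trans h.1
    refine (abs_ddK_le i j h0 q.2).trans ?_
    have h1 : gauss q.1 q.2 ≤ ε ^ (-(3:ℝ)/2) := by
      unfold gauss
      calc _ ≤ q.1 ^ (-(3:ℝ)/2) * 1 := by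
            refine mul_le_mul_of_nonneg_left (Real.exp_le_one_iff.2 ?_) (by positivity)
            rw [neg_div]
            exact neg_nonpos.2 (by positivity)
        _ ≤ _ := by
            rw [mul_one]
            exact Real.rpow_le_rpow_of_nonpos hε h.1.le (by norm_num)
    refine mul_le_mul ?_ h1 (gauss_nonneg h0 _) (by positivity)
    exact div_le_div_of_nonneg_left (by norm_num) hε h.1.le
  · simp; positivity

/-- The `L¹` norm in space of the Gaussian majorant. -/
def gaussMass : ℝ≥0∞ := ENNReal.ofReal ((20 * Real.pi) ^ ((3:ℝ)/2))

theorem lintegral_ddKTrunc_slice_le (i j : Fin 3) {ε N : ℝ} (hε : 0 < ε) (τ : ℝ) :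
    ∫⁻ z, ‖ddKTrunc i j ε N (τ, z)‖ₑ
      ≤ (Ioo ε N).indicator (fun _ => ENNReal.ofReal (2 / ε) * gaussMass) τ := by
  by_cases h : ε < τ ∧ τ < N
  · rw [indicator_of_mem (show τ ∈ Ioo ε N from h)]
    have h0 : 0 < τ := hε.trans h.1
    have hm : Measurable fun z : E3 => gaussE (τ, z) := measurable_gaussE.comp (by fun_prop)
    calc _ ≤ ∫⁻ z : E3, ENNReal.ofReal (2 / ε) * gaussE (τ, z) := by
          refine lintegral_mono fun z => ?_
          rw [ddKTrunc, if_pos h]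
          refine enorm_le_ofReal_mul_gaussE h0 (by positivity) ((abs_ddK_le i j h0 z).trans ?_)
          refine mul_le_mul_of_nonneg_right ?_ (gauss_nonneg h0 z)
          exact div_le_div_of_nonneg_left (by norm_num) hε h.1.le
      _ ≤ _ := by
          rw [lintegral_const_mul _ hm]
          exact mul_le_mul_right (lintegral_gaussE_le τ) _
  · simp [ddKTrunc, h]

theorem integrable_ddKTrunc (i j : Fin 3) {ε N : ℝ} (hε : 0 < ε) : Integrable (ddKTrunc i j ε N) := by
  refine ⟨(measurable_ddKTrunc i j ε N).aestronglyMeasurable, ?_⟩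
  rw [HasFiniteIntegral, Measure.volume_eq_prod,
    lintegral_prod _ (measurable_ddKTrunc i j ε N).enorm.aemeasurable]
  refine (lintegral_mono (lintegral_ddKTrunc_slice_le i j hε)).trans_lt ?_
  rw [lintegral_indicator_const measurableSet_Ioo, Real.volume_Ioo, gaussMass]
  finiteness

/-- Fourier multiplier majorant. -/
def fourierMajorant (ξ : E3) (τ : ℝ) : ℝ≥0∞ :=
  (Ioi 0).indicator (fun τ => ENNReal.ofReal ((4 * Real.pi ^ 2 * ‖ξ‖ ^ 2) *
    Real.exp (-(4 * Real.pi ^ 2 * ‖ξ‖ ^ 2) * τ))) τ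

theorem lintegral_fourierMajorant_le (ξ : E3) : ∫⁻ τ, fourierMajorant ξ τ ≤ 1 := by
  unfold fourierMajorant
  rw [lintegral_indicator measurableSet_Ioi]
  set c := 4 * Real.pi ^ 2 * ‖ξ‖ ^ 2 with hc
  have hc0 : 0 ≤ c := by positivity
  rcases hc0.eq_or_lt with h | h
  · simp [← h]
  rw [← ofReal_integral_eq_lintegral_ofReal, integral_const_mul, integral_exp_mul_Ioi (by linarith)]
  · rw [← ENNReal.ofReal_one]
    refine ENNReal.ofReal_le_ofReal (le_of_eq ?_)
    simp; field_simp
  · exact (integrableOn_exp_mul_Ioi (by linarith) 0).const_mul c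
  · exact ae_of_all _ fun τ => by positivity

theorem enorm_fourierX_ddKTrunc_le (i j : Fin 3) {ε N : ℝ} (hε : 0 < ε) (τ : ℝ) (ξ : E3) :
    ‖fourierX (ddKTrunc i j ε N) τ ξ‖ₑ ≤ fourierMajorant ξ τ := by
  by_cases h : ε < τ ∧ τ < N
  · have h0 : 0 < τ := hε.trans h.1
    unfold fourierMajorant
    rw [indicator_of_mem (show τ ∈ Ioi 0 from h0)]
    have := norm_fourier_ddK_le i j h0 ξ
    rw [fourier_eq_expChar] at this
    rw [← ofReal_norm]
    refine ENNReal.ofReal_le_ofReal (le_trans (le_of_eq ?_) this)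
    simp [fourierX, ddKTrunc, h]
  · simp [fourierX, ddKTrunc, h]

theorem isCZKernel_ddKTrunc (i j : Fin 3) {ε N : ℝ} (hε : 0 < ε) :
    IsCZKernel (ddKTrunc i j ε N) (1 + hormConst) where
  measurable := measurable_ddKTrunc i j ε N
  bounded := ⟨_, abs_ddKTrunc_le i j hε⟩
  l2 := by
    intro g hg hgi hgb
    have hS : ∀ τ, ∫⁻ z, ‖ddKTrunc i j ε N (τ, z)‖ₑ ≤ ENNReal.ofReal (2 / ε) * gaussMass := fun τ =>
      (lintegral_ddKTrunc_slice_le i j hε τ).trans (indicator_le_self' (fun _ _ => zero_le) τ)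
    have hm : ∀ ξ, Measurable (fourierMajorant ξ) := fun ξ => by
      unfold fourierMajorant
      exact Measurable.indicator (by fun_prop) measurableSet_Ioi
    refine (lintegral_cv_sq_le (measurable_ddKTrunc i j ε N) (abs_ddKTrunc_le i j hε)
      (by unfold gaussMass; finiteness) hS hm (enorm_fourierX_ddKTrunc_le i j hε)
      lintegral_fourierMajorant_le hg hgi hgb).trans ?_
    exact le_mul_of_one_le_left' le_self_add
  hormander := fun r hr y hy1 hy2 => (hormander_ddKTrunc i j hε hr y hy1 hy2).trans le_add_self

/-- Uniform `L^p` bounds for convolution with the truncated second derivatives of the heat kernel. -/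
theorem exists_ddKTrunc_bound {p : ℝ} (hp : 1 < p) : ∃ C : ℝ≥0∞, C ≠ ⊤ ∧
    ∀ (i j : Fin 3) (ε N : ℝ), 0 < ε → ∀ f : ℝ × E3 → ℝ, Continuous f → HasCompactSupport f →
      ∫⁻ q, ‖cv (ddKTrunc i j ε N) f q‖ₑ ^ p ≤ C * ∫⁻ q, ‖f q‖ₑ ^ p := by
  obtain ⟨C, hC, h⟩ := exists_czKernel_bound hp (A := 1 + hormConst) (by unfold hormConst; finiteness)
  exact ⟨C, hC, fun i j ε N hε f hf hfc => h _ (isCZKernel_ddKTrunc i j hε)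
    (isCZKernel_ddKTrunc i j hε).neg (integrable_ddKTrunc i j hε) f hf hfc⟩

theorem eLpNorm_ofReal_rpow {α : Type*} [MeasurableSpace α] {μ : Measure α} {p : ℝ} (hp : 1 < p)
    (f : α → ℝ) : eLpNorm f (ENNReal.ofReal p) μ ^ p = ∫⁻ a, ‖f a‖ₑ ^ p ∂μ := by
  have h0 : 0 < p := by linarith
  rw [eLpNorm_eq_lintegral_rpow_enorm_toReal (by simpa using h0) ENNReal.ofReal_ne_top,
    ENNReal.toReal_ofReal h0.le, ← ENNReal.rpow_mul, one_div, inv_mul_cancel₀ h0.ne',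
    ENNReal.rpow_one]

section
variable {p : ℝ} {k F : ℝ × E3 → ℝ}

theorem lintegral_enorm_cv_rpow_le (hp : 1 < p) (hk : Measurable k) (hF : Measurable F) :
    ∫⁻ q, (∫⁻ r, ‖k (q - r) * F r‖ₑ) ^ p ≤ (∫⁻ r, ‖k r‖ₑ) ^ p * ∫⁻ r, ‖F r‖ₑ ^ p := by
  refine le_of_eq_of_le ?_ (lintegral_conv_rpow_le hp hk.enorm hF.enorm)
  refine lintegral_congr fun q => ?_
  rw [← lintegral_sub_left_eq_self _ q]
  simp only [sub_sub_cancel, enorm_mul]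

theorem eLpNorm_cv_le (hp : 1 < p) (hk : Measurable k) (hF : Measurable F) :
    eLpNorm (cv k F) (ENNReal.ofReal p) volume
      ≤ (∫⁻ r, ‖k r‖ₑ) * eLpNorm F (ENNReal.ofReal p) volume := by
  have h0 : 0 < p := by linarith
  rw [← ENNReal.rpow_le_rpow_iff h0, ENNReal.mul_rpow_of_nonneg _ _ h0.le, eLpNorm_ofReal_rpow hp,
    eLpNorm_ofReal_rpow hp]
  refine le_trans (lintegral_mono fun q => ?_) (lintegral_enorm_cv_rpow_le hp hk hF)
  exact ENNReal.rpow_le_rpow (enorm_integral_le_lintegral_enorm _) h0.le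

theorem memLp_cv (hp : 1 < p) (hk : Measurable k) (hki : Integrable k) (hF : Measurable F)
    (hFp : MemLp F (ENNReal.ofReal p)) : MemLp (cv k F) (ENNReal.ofReal p) :=
  ⟨(measurable_cv hk hF).aestronglyMeasurable,
    (eLpNorm_cv_le hp hk hF).trans_lt (ENNReal.mul_lt_top hki.2 hFp.2)⟩

theorem ae_integrable_mul (hp : 1 < p) (hk : Measurable k) (hki : Integrable k) (hF : Measurable F)
    (hFp : MemLp F (ENNReal.ofReal p)) : ∀ᵐ q, Integrable fun r => k (q - r) * F r := by
  have h0 : 0 < p := by linarith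
  have hm : Measurable fun a : (ℝ × E3) × (ℝ × E3) => ‖k (a.1 - a.2) * F a.2‖ₑ := by fun_prop
  have h := lintegral_enorm_cv_rpow_le hp hk hF
  have hlt : ∫⁻ q, (∫⁻ r, ‖k (q - r) * F r‖ₑ) ^ p ≠ ⊤ := by
    refine (h.trans_lt (ENNReal.mul_lt_top (ENNReal.rpow_lt_top_of_nonneg h0.le hki.2.ne) ?_)).ne
    rw [← eLpNorm_ofReal_rpow hp]
    exact ENNReal.rpow_lt_top_of_nonneg h0.le hFp.2.ne
  filter_upwards [ae_lt_top (hm.lintegral_prod_right.pow_const p) hlt] with q hq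
  refine ⟨Measurable.aestronglyMeasurable (by fun_prop), ?_⟩
  exact (ENNReal.rpow_lt_top_iff_of_pos h0).1 hq

theorem cv_sub_ae (hp : 1 < p) {G : ℝ × E3 → ℝ} (hk : Measurable k) (hki : Integrable k)
    (hF : Measurable F) (hFp : MemLp F (ENNReal.ofReal p)) (hG : Measurable G)
    (hGp : MemLp G (ENNReal.ofReal p)) : cv k F - cv k G =ᵐ[volume] cv k (F - G) := by
  filter_upwards [ae_integrable_mul hp hk hki hF hFp, ae_integrable_mul hp hk hki hG hGp] with q h1 h2
  simp only [cv, Pi.sub_apply]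
  rw [← integral_sub h1 h2]
  congr 1; ext r; ring

end

/-- The derivative of a function on space-time in the spatial direction `j`. -/
def dx (j : Fin 3) (h : ℝ × E3 → ℝ) (q : ℝ × E3) : ℝ := fderiv ℝ h q (0, EuclideanSpace.single j 1)

theorem continuous_dx {j : Fin 3} {h : ℝ × E3 → ℝ} (hh : ContDiff ℝ (⊤ : ℕ∞) h) :
    Continuous (dx j h) := (hh.continuous_fderiv (by simp)).clm_apply continuous_const

theorem hasCompactSupport_dx {j : Fin 3} {h : ℝ × E3 → ℝ} (hc : HasCompactSupport h) :
    HasCompactSupport (dx j h) := hc.fderiv_apply (𝕜 := ℝ) _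

theorem dx_slice {j : Fin 3} {h : ℝ × E3 → ℝ} (hh : ContDiff ℝ (⊤ : ℕ∞) h) (r : ℝ × E3) (t : ℝ)
    (x : E3) : fderiv ℝ (fun x : E3 => h ((t, x) - r)) x (EuclideanSpace.single j 1)
      = dx j h ((t, x) - r) := by
  have h1 : HasFDerivAt (fun x : E3 => ((t, x) - r : ℝ × E3)) (ContinuousLinearMap.inr ℝ ℝ E3) x :=
    (hasFDerivAt_prodMk_right t x).sub_const r
  have h2 := (hh.differentiable (by simp) ((t, x) - r)).hasFDerivAt
  have := (h2.comp x h1).fderiv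
  simp only [Function.comp_def] at this
  rw [this]
  rfl

theorem pd_continuous {φ : E3 → ℝ} (hφ : ContDiff ℝ (⊤ : ℕ∞) φ) (j : Fin 3) :
    Continuous (pd φ j) := (hφ.continuous_fderiv (by simp)).clm_apply continuous_const

theorem pd_hasCompactSupport {φ : E3 → ℝ} (hc : HasCompactSupport φ) (j : Fin 3) :
    HasCompactSupport (pd φ j) := hc.fderiv_apply (𝕜 := ℝ) _

theorem integrable_slice_test {k h : ℝ × E3 → ℝ} (hki : Integrable k) (hh : Continuous h)
    (hc : HasCompactSupport h) {ψ : E3 → ℝ} (hψ : Continuous ψ) (hψc : HasCompactSupport ψ) (t : ℝ) :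
    Integrable fun a : E3 × (ℝ × E3) => k a.2 * h ((t, a.1) - a.2) * ψ a.1 := by
  obtain ⟨M, hM⟩ := hc.exists_bound_of_continuous hh
  have i := (hψ.integrable_of_hasCompactSupport hψc (μ := volume)).mul_prod hki
  have := i.bdd_mul (f := fun a : E3 × (ℝ × E3) => h ((t, a.1) - a.2)) (c := M)
    (by fun_prop) (ae_of_all _ fun a => hM _)
  refine this.congr (ae_of_all _ fun a => ?_)
  simp only []; ring

theorem cv_comm (k h : ℝ × E3 → ℝ) (q : ℝ × E3) : cv k h q = ∫ r, k r * h (q - r) := by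
  unfold cv
  rw [← integral_sub_left_eq_self (fun r => k r * h (q - r)) volume q]
  simp only [sub_sub_cancel]

theorem integral_cv_slice_mul {k h : ℝ × E3 → ℝ} (hki : Integrable k) (hh : Continuous h)
    (hc : HasCompactSupport h) {ψ : E3 → ℝ} (hψ : Continuous ψ) (hψc : HasCompactSupport ψ) (t : ℝ) :
    ∫ x, cv k h (t, x) * ψ x = ∫ r, k r * ∫ x, h ((t, x) - r) * ψ x := by
  simp_rw [cv_comm, ← integral_mul_const, ← integral_const_mul]
  have := integrable_slice_test hki hh hc hψ hψc t
  rw [integral_integral_swap this]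
  simp_rw [mul_assoc]

theorem integrable_cv_slice_mul {k h : ℝ × E3 → ℝ} (hki : Integrable k) (hh : Continuous h)
    (hc : HasCompactSupport h) {ψ : E3 → ℝ} (hψ : Continuous ψ) (hψc : HasCompactSupport ψ) (t : ℝ) :
    Integrable fun x => cv k h (t, x) * ψ x := by
  simp_rw [cv_comm, ← integral_mul_const]
  have := integrable_slice_test hki hh hc hψ hψc t
  rw [Measure.volume_eq_prod] at this
  exact this.integral_prod_left

theorem integral_cv_slice_mul_pd {k h : ℝ × E3 → ℝ} (hki : Integrable k)
    (hh : ContDiff ℝ (⊤ : ℕ∞) h) (hc : HasCompactSupport h) {φ : E3 → ℝ}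
    (hφ : ContDiff ℝ (⊤ : ℕ∞) φ) (hφc : HasCompactSupport φ) (t : ℝ) (j : Fin 3) :
    ∫ x, cv k h (t, x) * pd φ j x = - ∫ x, cv k (dx j h) (t, x) * φ x := by
  rw [integral_cv_slice_mul hki hh.continuous hc (pd_continuous hφ j) (pd_hasCompactSupport hφc j),
    integral_cv_slice_mul hki (continuous_dx hh) (hasCompactSupport_dx hc) hφ.continuous hφc,
    ← integral_neg]
  congr 1; ext r
  rw [← mul_neg]
  congr 1
  have hs : ContDiff ℝ (⊤ : ℕ∞) fun x : E3 => h ((t, x) - r) := by fun_prop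
  have e : ∀ x, dx j h ((t, x) - r)
      = fderiv ℝ (fun x : E3 => h ((t, x) - r)) x (EuclideanSpace.single j 1) :=
    fun x => (dx_slice hh r t x).symm
  simp_rw [e]
  refine integral_mul_fderiv_eq_neg_fderiv_mul_of_integrable ?_ ?_ ?_
    (fun x _ => hs.differentiable (by simp) x) (fun x _ => hφ.differentiable (by simp) x)
  · simp_rw [← e]
    exact Continuous.integrable_of_hasCompactSupport
      (((continuous_dx hh).comp (by fun_prop)).mul hφ.continuous) hφc.mul_left
  · exact Continuous.integrable_of_hasCompactSupport
      (hs.continuous.mul (pd_continuous hφ j)) (pd_hasCompactSupport hφc j).mul_left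
  · exact Continuous.integrable_of_hasCompactSupport (hs.continuous.mul hφ.continuous) hφc.mul_left

theorem ae_tendsto_slice {p : ℝ} (hp : 1 < p) {D : ℕ → ℝ × E3 → ℝ} (hD : ∀ n, Measurable (D n))
    {c : ℝ≥0∞} (hc : c ≠ ⊤)
    (hB : ∀ n, eLpNorm (D n) (ENNReal.ofReal p) volume ≤ c * 2⁻¹ ^ n) :
    ∀ᵐ t, Filter.Tendsto (fun n => ∫⁻ x, ‖D n (t, x)‖ₑ ^ p) Filter.atTop (nhds 0) := by
  have h0 : 0 < p := by linarith
  have hm : ∀ n, Measurable fun t => ∫⁻ x, ‖D n (t, x)‖ₑ ^ p := fun n =>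
    ((hD n).enorm.pow_const p).lintegral_prod_right'
  have hfin : ∫⁻ t, ∑' n, ∫⁻ x, ‖D n (t, x)‖ₑ ^ p ≠ ⊤ := by
    rw [lintegral_tsum fun n => (hm n).aemeasurable]
    have : ∀ n, ∫⁻ t, ∫⁻ x, ‖D n (t, x)‖ₑ ^ p ≤ c ^ p * 2⁻¹ ^ n := fun n => by
      rw [← lintegral_prod (fun q => ‖D n q‖ₑ ^ p) ((hD n).enorm.pow_const p).aemeasurable,
        ← Measure.volume_eq_prod, ← eLpNorm_ofReal_rpow hp]
      refine (ENNReal.rpow_le_rpow (hB n) h0.le).trans ?_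
      rw [ENNReal.mul_rpow_of_nonneg _ _ h0.le]
      refine mul_le_mul_right (ENNReal.rpow_le_self_of_le_one ?_ hp.le) _
      exact pow_le_one₀ (by simp) (by simp)
    refine ((ENNReal.tsum_le_tsum this).trans_lt ?_).ne
    rw [ENNReal.tsum_mul_left, ENNReal.tsum_geometric]
    refine ENNReal.mul_lt_top (ENNReal.rpow_lt_top_of_nonneg h0.le hc) ?_
    simp
  filter_upwards [ae_lt_top (Measurable.tsum hm) hfin] with t ht
  exact ENNReal.tendsto_atTop_zero_of_tsum_ne_top ht.ne

theorem tendsto_integral_mul_test {p : ℝ} (hp : 1 < p) {f : ℕ → E3 → ℝ} {g ψ : E3 → ℝ}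
    (hf : ∀ n, Measurable (f n)) (hg : Measurable g) (hψ : Continuous ψ)
    (hψc : HasCompactSupport ψ) (hi : ∀ n, Integrable fun x => f n x * ψ x)
    (h : Filter.Tendsto (fun n => ∫⁻ x, ‖f n x - g x‖ₑ ^ p) Filter.atTop (nhds 0)) :
    Filter.Tendsto (fun n => ∫ x, f n x * ψ x) Filter.atTop (nhds (∫ x, g x * ψ x)) := by
  have hpq : p.HolderConjugate (p / (p - 1)) := Real.HolderConjugate.conjExponent hp
  set q := p / (p - 1)
  have h0 : 0 < p := by linarith
  refine tendsto_integral_of_L1 _ (hg.mul hψ.measurable).aestronglyMeasurable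
    (Filter.Eventually.of_forall hi) ?_
  have hψq : (∫⁻ x, ‖ψ x‖ₑ ^ q) ^ (1 / q) ≠ ⊤ := by
    refine ENNReal.rpow_ne_top_of_nonneg (by have := hpq.symm.pos; positivity) ?_
    rw [← eLpNorm_ofReal_rpow hpq.symm.lt]
    exact (ENNReal.rpow_lt_top_of_nonneg hpq.symm.pos.le
      (hψ.memLp_of_hasCompactSupport hψc).2.ne).ne
  have hb : ∀ n, ∫⁻ x, ‖f n x * ψ x - g x * ψ x‖ₑ
      ≤ (∫⁻ x, ‖f n x - g x‖ₑ ^ p) ^ (1 / p) * (∫⁻ x, ‖ψ x‖ₑ ^ q) ^ (1 / q) := fun n => by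
    have := ENNReal.lintegral_mul_le_Lp_mul_Lq volume hpq (f := fun x => ‖f n x - g x‖ₑ)
      (g := fun x => ‖ψ x‖ₑ) ((hf n).sub hg).enorm.aemeasurable hψ.measurable.enorm.aemeasurable
    simpa only [Pi.mul_apply, ← enorm_mul, sub_mul] using this
  refine tendsto_of_tendsto_of_tendsto_of_le_of_le tendsto_const_nhds ?_ (fun _ => zero_le) hb
  have h1 := h.ennrpow_const (1 / p)
  rw [ENNReal.zero_rpow_of_pos (by positivity)] at h1
  simpa using ENNReal.Tendsto.mul_const h1 (Or.inr hψq)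

/-- For almost every time, `W` is the weak derivative of `U` in the spatial direction `j`. -/
def HasWeakPd (j : Fin 3) (U W : ℝ × E3 → ℝ) : Prop :=
  ∀ᵐ t : ℝ, ∀ φ : E3 → ℝ, ContDiff ℝ (⊤ : ℕ∞) φ → HasCompactSupport φ →
    ∫ x, U (t, x) * pd φ j x = - ∫ x, W (t, x) * φ x

theorem exists_smooth_approx {p : ℝ} (hp : 1 < p) {F : ℝ × E3 → ℝ}
    (hFp : MemLp F (ENNReal.ofReal p)) : ∃ h : ℕ → ℝ × E3 → ℝ, ∀ n, HasCompactSupport (h n) ∧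
      ContDiff ℝ (⊤ : ℕ∞) (h n) ∧ eLpNorm (F - h n) (ENNReal.ofReal p) volume ≤ 2⁻¹ ^ n := by
  have h := fun n : ℕ => hFp.exist_eLpNorm_sub_le ENNReal.ofReal_ne_top (by simpa using hp.le)
    (ε := 2⁻¹ ^ n) (by positivity)
  choose g h1 h2 h3 using h
  refine ⟨g, fun n => ⟨h1 n, h2 n, (h3 n).trans_eq ?_⟩⟩
  rw [ENNReal.ofReal_pow (by positivity), ENNReal.ofReal_inv_of_pos (by norm_num)]
  simp

/-- If `h ↦ k ⋆ ∂ⱼh` is bounded on `L^p` for test functions `h`, then `k ⋆ F` has a weak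
derivative in `L^p` for every `F ∈ L^p`. -/
theorem exists_weakPd {p : ℝ} (hp : 1 < p) {k : ℝ × E3 → ℝ} (hk : Measurable k)
    (hki : Integrable k) {j : Fin 3} {C : ℝ≥0∞} (hC : C ≠ ⊤)
    (hB : ∀ h : ℝ × E3 → ℝ, ContDiff ℝ (⊤ : ℕ∞) h → HasCompactSupport h →
      eLpNorm (cv k (dx j h)) (ENNReal.ofReal p) volume
        ≤ C * eLpNorm h (ENNReal.ofReal p) volume)
    {F : ℝ × E3 → ℝ} (hF : Measurable F) (hFp : MemLp F (ENNReal.ofReal p)) :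
    ∃ w : ℝ × E3 → ℝ, Measurable w ∧ eLpNorm w (ENNReal.ofReal p) volume
      ≤ C * eLpNorm F (ENNReal.ofReal p) volume ∧ HasWeakPd j (cv k F) w := by
  have h0 : 0 < p := by linarith
  have hP : 1 ≤ ENNReal.ofReal p := by simpa using hp.le
  set P := ENNReal.ofReal p with hPdef
  obtain ⟨h, hh⟩ := exists_smooth_approx hp hFp
  choose hc hs hd using hh
  have hmem : ∀ n, MemLp (h n) P := fun n => (hs n).continuous.memLp_of_hasCompactSupport (hc n)
  have hdm : ∀ n, Measurable (dx j (h n)) := fun n => (continuous_dx (hs n)).measurable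
  have hdmem : ∀ n, MemLp (dx j (h n)) P := fun n =>
    (continuous_dx (hs n)).memLp_of_hasCompactSupport (hasCompactSupport_dx (hc n))
  set v : ℕ → ℝ × E3 → ℝ := fun n => cv k (dx j (h n)) with hv
  have hvm : ∀ n, Measurable (v n) := fun n => measurable_cv hk (hdm n)
  have hvp : ∀ n, MemLp (v n) P := fun n => memLp_cv hp hk hki (hdm n) (hdmem n)
  have hpow0 : ∀ N : ℕ, (2⁻¹ : ℝ≥0∞) ^ N ≠ 0 := fun N => by simp
  have hpowt : ∀ N : ℕ, (2⁻¹ : ℝ≥0∞) ^ N ≠ ⊤ := fun N => by finiteness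
  have hpowle : ∀ {N n : ℕ}, N ≤ n → (2⁻¹ : ℝ≥0∞) ^ n ≤ 2⁻¹ ^ N := fun hN =>
    pow_le_pow_right_of_le_one' (by simp) hN
  have hpowlim : Filter.Tendsto (fun n : ℕ => (2⁻¹ : ℝ≥0∞) ^ n) Filter.atTop (nhds 0) :=
    ENNReal.tendsto_pow_atTop_nhds_zero_of_lt_one (by simp)
  set c : ℝ≥0∞ := C * 2 + 1 with hcdef
  have hct : c ≠ ⊤ := by finiteness
  have hcauchy : ∀ N n m : ℕ, N ≤ n → N ≤ m → eLpNorm (v n - v m) P volume < c * 2⁻¹ ^ N := by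
    intro N n m hn hm
    have e1 : v n - v m =ᵐ[volume] cv k (dx j (h n - h m)) := by
      refine (cv_sub_ae hp hk hki (hdm n) (hdmem n) (hdm m) (hdmem m)).trans (ae_of_all _ fun q => ?_)
      congr 1; ext q
      simp only [dx, Pi.sub_apply]
      rw [fderiv_sub ((hs n).differentiable (by simp) q) ((hs m).differentiable (by simp) q)]
      rfl
    rw [eLpNorm_congr_ae e1]
    have e2 : eLpNorm (h n - h m) P volume ≤ 2 * 2⁻¹ ^ N := by
      have : h n - h m = (F - h m) - (F - h n) := by abel
      rw [this, two_mul]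
      refine (eLpNorm_sub_le (hFp.1.sub (hmem m).1) (hFp.1.sub (hmem n).1) hP).trans ?_
      exact add_le_add ((hd m).trans (hpowle hm)) ((hd n).trans (hpowle hn))
    refine lt_of_le_of_lt ((hB _ ((hs n).sub (hs m)) ((hc n).sub (hc m))).trans
      (mul_le_mul_right e2 C)) ?_
    rw [hcdef, add_mul, one_mul, mul_assoc]
    exact ENNReal.lt_add_right (by finiteness) (hpow0 N)
  have hsum : ∑' i : ℕ, c * (2⁻¹ : ℝ≥0∞) ^ i ≠ ⊤ := by
    rw [ENNReal.tsum_mul_left, ENNReal.tsum_geometric]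
    exact ENNReal.mul_ne_top hct (by simp)
  obtain ⟨w0, hw0, hlim⟩ := Lp.cauchy_complete_eLpNorm hP hvp hsum hcauchy
  set w := hw0.1.mk w0 with hw
  have hwm : Measurable w := hw0.1.stronglyMeasurable_mk.measurable
  have hww : w0 =ᵐ[volume] w := hw0.1.ae_eq_mk
  have hwp : MemLp w P := hw0.ae_eq hww
  have hrate : ∀ n, eLpNorm (v n - w) P volume ≤ c * 2⁻¹ ^ n := by
    intro n
    have l1 : Filter.Tendsto (fun m => c * 2⁻¹ ^ n + eLpNorm (v m - w0) P volume) Filter.atTop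
        (nhds (c * 2⁻¹ ^ n + 0)) := tendsto_const_nhds.add hlim
    rw [add_zero] at l1
    refine ge_of_tendsto l1 ?_
    filter_upwards [Filter.eventually_ge_atTop n] with m hm
    have e : v n - w0 = (v n - v m) + (v m - w0) := by abel
    rw [← eLpNorm_congr_ae (hww.mono fun q hq => by simp [hq] : v n - w0 =ᵐ[volume] v n - w), e]
    refine (eLpNorm_add_le ((hvp n).1.sub (hvp m).1) ((hvp m).1.sub hw0.1) hP).trans ?_
    exact add_le_add_left (hcauchy n n m le_rfl hm).le _
  refine ⟨w, hwm, ?_, ?_⟩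
  · have l1 : Filter.Tendsto (fun n : ℕ => c * 2⁻¹ ^ n + C * (eLpNorm F P volume + 2⁻¹ ^ n))
        Filter.atTop (nhds (c * 0 + C * (eLpNorm F P volume + 0))) :=
      (ENNReal.Tendsto.const_mul hpowlim (Or.inr hct)).add
        (ENNReal.Tendsto.const_mul (tendsto_const_nhds.add hpowlim) (Or.inr hC))
    rw [mul_zero, zero_add, add_zero] at l1
    refine ge_of_tendsto' l1 fun n => ?_
    have e : w = v n - (v n - w) := by abel
    have e' : h n = F - (F - h n) := by abel
    have b1 : eLpNorm (h n) P volume ≤ eLpNorm F P volume + 2⁻¹ ^ n := by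
      rw [e']
      exact (eLpNorm_sub_le hFp.1 (hFp.1.sub (hmem n).1) hP).trans (add_le_add le_rfl (hd n))
    calc eLpNorm w P volume = eLpNorm (v n - (v n - w)) P volume := by rw [← e]
      _ ≤ eLpNorm (v n) P volume + eLpNorm (v n - w) P volume :=
          eLpNorm_sub_le (hvp n).1 ((hvp n).1.sub hwp.1) hP
      _ ≤ C * (eLpNorm F P volume + 2⁻¹ ^ n) + c * 2⁻¹ ^ n :=
          add_le_add ((hB _ (hs n) (hc n)).trans (mul_le_mul_right b1 C)) (hrate n)
      _ = _ := add_comm _ _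
  · have hUm : ∀ n, Measurable (cv k (h n)) := fun n => measurable_cv hk (hs n).continuous.measurable
    have hFm : Measurable (cv k F) := measurable_cv hk hF
    have t1 := ae_tendsto_slice hp (D := fun n => v n - w) (fun n => (hvm n).sub hwm) hct hrate
    have t2 := ae_tendsto_slice hp (D := fun n => cv k (h n) - cv k F) (fun n => (hUm n).sub hFm)
      hki.2.ne fun n => by
        have := cv_sub_ae hp hk hki (hs n).continuous.measurable (hmem n) hF hFp
        rw [eLpNorm_congr_ae this]
        refine (eLpNorm_cv_le hp hk ((hs n).continuous.measurable.sub hF)).trans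
          (mul_le_mul_right ?_ _)
        rw [eLpNorm_sub_comm]
        exact hd n
    filter_upwards [t1, t2] with t h1 h2 φ hφ hφc
    have s1 := tendsto_integral_mul_test hp (f := fun n x => v n (t, x)) (g := fun x => w (t, x))
      (fun n => (hvm n).comp measurable_prodMk_left) (hwm.comp measurable_prodMk_left) hφ.continuous hφc
      (fun n => integrable_cv_slice_mul hki (continuous_dx (hs n)) (hasCompactSupport_dx (hc n))
        hφ.continuous hφc t) h1
    have s2 := tendsto_integral_mul_test hp (f := fun n x => cv k (h n) (t, x))
      (g := fun x => cv k F (t, x))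
      (fun n => (hUm n).comp measurable_prodMk_left) (hFm.comp measurable_prodMk_left)
      (pd_continuous hφ j) (pd_hasCompactSupport hφc j)
      (fun n => integrable_cv_slice_mul hki (hs n).continuous (hc n)
        (pd_continuous hφ j) (pd_hasCompactSupport hφc j) t) h2
    refine tendsto_nhds_unique s2 ?_
    refine s1.neg.congr fun n => ?_
    exact (integral_cv_slice_mul_pd hki (hs n) (hc n) hφ hφc t j).symm

/-- Restriction of a kernel to the times `ε < τ < T`. -/
def trunc (κ : ℝ → E3 → ℝ) (ε T : ℝ) (q : ℝ × E3) : ℝ :=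
  if ε < q.1 ∧ q.1 < T then κ q.1 q.2 else 0

theorem measurable_trunc {κ : ℝ → E3 → ℝ} (hκ : Measurable fun q : ℝ × E3 => κ q.1 q.2) (ε T : ℝ) :
    Measurable (trunc κ ε T) := by
  refine Measurable.ite ?_ hκ measurable_const
  exact (measurableSet_lt measurable_const measurable_fst).inter
    (measurableSet_lt measurable_fst measurable_const)

theorem lintegral_trunc_le {κ : ℝ → E3 → ℝ} (hκ : Measurable fun q : ℝ × E3 => κ q.1 q.2)
    {c : ℝ → ℝ} (hc : ∀ τ, 0 < τ → 0 ≤ c τ) (h : ∀ τ z, 0 < τ → |κ τ z| ≤ c τ * gauss τ z)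
    {ε T : ℝ} (hε : 0 ≤ ε) :
    ∫⁻ q, ‖trunc κ ε T q‖ₑ ≤ (∫⁻ τ in Ioc 0 T, ENNReal.ofReal (c τ)) * gaussMass := by
  rw [Measure.volume_eq_prod, lintegral_prod _ (measurable_trunc hκ ε T).enorm.aemeasurable,
    ← lintegral_mul_const' _ _ (by unfold gaussMass; finiteness),
    ← lintegral_indicator measurableSet_Ioc]
  refine lintegral_mono fun τ => ?_
  by_cases hτ : ε < τ ∧ τ < T
  · have h0 : 0 < τ := hε.trans_lt hτ.1
    rw [indicator_of_mem (show τ ∈ Ioc 0 T from ⟨h0, hτ.2.le⟩)]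
    have hm : Measurable fun z : E3 => gaussE (τ, z) := measurable_gaussE.comp (by fun_prop)
    calc _ ≤ ∫⁻ z : E3, ENNReal.ofReal (c τ) * gaussE (τ, z) := by
          refine lintegral_mono fun z => ?_
          rw [trunc, if_pos hτ]
          exact enorm_le_ofReal_mul_gaussE h0 (hc τ h0) (h τ z h0)
      _ ≤ _ := by
          rw [lintegral_const_mul _ hm]
          exact mul_le_mul_right (lintegral_gaussE_le τ) _
  · simp [trunc, hτ]

theorem gaussMass_ne_top : gaussMass ≠ ⊤ := by unfold gaussMass; finiteness

theorem lintegral_trunc_heatK_le {ε T : ℝ} (hε : 0 ≤ ε) :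
    ∫⁻ q, ‖trunc heatK ε T q‖ₑ ≤ ENNReal.ofReal T * gaussMass := by
  refine (lintegral_trunc_le (c := fun _ => 1) measurable_heatK (by simp) (fun τ z h => ?_) hε).trans_eq ?_
  · rw [abs_of_nonneg (heatK_nonneg h z), one_mul]
    exact heatK_le_gauss h z
  · simp

theorem lintegral_trunc_dK_le (i : Fin 3) {ε T : ℝ} (hε : 0 ≤ ε) (hT : 0 ≤ T) :
    ∫⁻ q, ‖trunc (dK i) ε T q‖ₑ ≤ ENNReal.ofReal (2 * T ^ ((1:ℝ)/2)) * gaussMass := by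
  refine (lintegral_trunc_le (c := fun τ => τ ^ (-(1:ℝ)/2)) (measurable_dK i)
    (fun τ h => by positivity) (fun τ z h => abs_dK_le i h z) hε).trans_eq ?_
  rw [lintegral_Ioc_rpow hT (by norm_num)]
  congr 2
  norm_num
  ring

theorem integrable_trunc_heatK {ε T : ℝ} (hε : 0 ≤ ε) : Integrable (trunc heatK ε T) :=
  ⟨(measurable_trunc measurable_heatK ε T).aestronglyMeasurable,
    (lintegral_trunc_heatK_le hε).trans_lt (ENNReal.mul_lt_top (by simp) gaussMass_ne_top.lt_top)⟩

theorem integrable_trunc_dK (i : Fin 3) {ε T : ℝ} (hε : 0 ≤ ε) (hT : 0 ≤ T) :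
    Integrable (trunc (dK i) ε T) :=
  ⟨(measurable_trunc (measurable_dK i) ε T).aestronglyMeasurable,
    (lintegral_trunc_dK_le i hε hT).trans_lt (ENNReal.mul_lt_top ENNReal.ofReal_lt_top gaussMass_ne_top.lt_top)⟩

theorem dx_slice_sub {j : Fin 3} {h : ℝ × E3 → ℝ} (hh : ContDiff ℝ (⊤ : ℕ∞) h) (q : ℝ × E3) (s : ℝ)
    (z : E3) : fderiv ℝ (fun z : E3 => h (q - (s, z))) z (EuclideanSpace.single j 1)
      = - dx j h (q - (s, z)) := by
  have h1 : HasFDerivAt (fun z : E3 => (q - (s, z) : ℝ × E3)) (-ContinuousLinearMap.inr ℝ ℝ E3) z :=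
    (hasFDerivAt_prodMk_right s z).const_sub q
  have h2 := (hh.differentiable (by simp) (q - (s, z))).hasFDerivAt
  have := (h2.comp z h1).fderiv
  simp only [Function.comp_def] at this
  rw [this]
  simp [dx]

theorem integrable_kernel_mul_test {k h : ℝ × E3 → ℝ} (hki : Integrable k) (hh : Continuous h)
    (hc : HasCompactSupport h) (q : ℝ × E3) : Integrable fun r => k r * h (q - r) := by
  obtain ⟨M, hM⟩ := hc.exists_bound_of_continuous hh
  exact hki.mul_bdd (c := M) (by fun_prop) (ae_of_all _ fun a => hM _)

/-- A spatial derivative on the function can be moved to the kernel. -/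
theorem cv_dx {κ κ' : ℝ → E3 → ℝ} {j : Fin 3} {ε T : ℝ} (hk : Integrable (trunc κ ε T))
    (hk' : Integrable (trunc κ' ε T)) (hd : ∀ s, Differentiable ℝ (κ s))
    (hdd : ∀ s z, fderiv ℝ (κ s) z (EuclideanSpace.single j 1) = κ' s z) (hε : 0 ≤ ε)
    (hs : ∀ s, 0 < s → Integrable (κ s)) (hs' : ∀ s, 0 < s → Integrable (κ' s))
    {h : ℝ × E3 → ℝ} (hh : ContDiff ℝ (⊤ : ℕ∞) h) (hc : HasCompactSupport h) :
    cv (trunc κ ε T) (dx j h) = cv (trunc κ' ε T) h := by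
  ext q
  have i1 := integrable_kernel_mul_test hk (continuous_dx (j := j) hh) (hasCompactSupport_dx hc) q
  have i2 := integrable_kernel_mul_test hk' hh.continuous hc q
  rw [cv_comm, cv_comm, Measure.volume_eq_prod, integral_prod _ i1, integral_prod _ i2]
  congr 1; ext s
  by_cases hτ : ε < s ∧ s < T
  · have h0 : 0 < s := hε.trans_lt hτ.1
    simp only [trunc, hτ.1, hτ.2, and_self, if_true]
    obtain ⟨M, hM⟩ := hc.exists_bound_of_continuous hh.continuous
    obtain ⟨M', hM'⟩ := (hasCompactSupport_dx (j := j) hc).exists_bound_of_continuous (continuous_dx hh)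
    have hsm : ContDiff ℝ (⊤ : ℕ∞) fun z : E3 => h (q - (s, z)) := by fun_prop
    have hcd := continuous_dx (j := j) hh
    have := integral_mul_fderiv_eq_neg_fderiv_mul_of_integrable (μ := volume) (f := κ s)
      (g := fun z : E3 => h (q - (s, z))) (v := EuclideanSpace.single j 1) ?_ ?_ ?_
      (fun x _ => hd s x) (fun x _ => hsm.differentiable (by simp) x)
    · simp_rw [dx_slice_sub hh, hdd, mul_neg, integral_neg, neg_inj] at this
      exact this
    · simp_rw [hdd]
      exact (hs' s h0).mul_bdd (c := M) (by fun_prop) (ae_of_all _ fun a => hM _)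
    · simp_rw [dx_slice_sub hh]
      refine (hs s h0).mul_bdd (c := M') (by fun_prop) (ae_of_all _ fun a => ?_)
      rw [norm_neg]; exact hM' _
    · exact (hs s h0).mul_bdd (c := M) (by fun_prop) (ae_of_all _ fun a => hM _)
  · simp [trunc, hτ]

theorem eLpNorm_cv_heatK_dx_le {p : ℝ} (hp : 1 < p) {T : ℝ} (hT : 0 ≤ T) (j : Fin 3)
    {h : ℝ × E3 → ℝ} (hh : ContDiff ℝ (⊤ : ℕ∞) h) (hc : HasCompactSupport h) :
    eLpNorm (cv (trunc heatK 0 T) (dx j h)) (ENNReal.ofReal p) volume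
      ≤ ENNReal.ofReal (2 * T ^ ((1:ℝ)/2)) * gaussMass * eLpNorm h (ENNReal.ofReal p) volume := by
  rw [cv_dx (integrable_trunc_heatK le_rfl) (integrable_trunc_dK j le_rfl hT)
    (fun s z => (hasFDerivAt_heatK s z).differentiableAt) (fun s z => fderiv_heatK_single j s z) le_rfl
    (fun s => integrable_heatK) (fun s => integrable_dK j) hh hc]
  exact (eLpNorm_cv_le hp (measurable_trunc (measurable_dK j) _ _) hh.continuous.measurable).trans
    (mul_le_mul_left (lintegral_trunc_dK_le j le_rfl hT) _)

theorem tendsto_cv_trunc {κ : ℝ → E3 → ℝ} (hκ : Measurable fun q : ℝ × E3 => κ q.1 q.2) {T : ℝ}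
    (hk : Integrable (trunc κ 0 T)) {h : ℝ × E3 → ℝ} (hh : Continuous h) (hc : HasCompactSupport h)
    (q : ℝ × E3) : Filter.Tendsto (fun n : ℕ => cv (trunc κ (1 / ((n:ℝ) + 1)) T) h q) Filter.atTop
      (nhds (cv (trunc κ 0 T) h q)) := by
  simp_rw [cv_comm]
  have hm := fun ε => measurable_trunc hκ ε T
  refine tendsto_integral_of_dominated_convergence (fun r => ‖trunc κ 0 T r * h (q - r)‖)
    (fun n => ((hm _).mul (by fun_prop)).aestronglyMeasurable)
    (integrable_kernel_mul_test hk hh hc q).norm (fun n => ae_of_all _ fun r => ?_)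
    (ae_of_all _ fun r => ?_)
  · rw [norm_mul, norm_mul]
    refine mul_le_mul_of_nonneg_right ?_ (norm_nonneg _)
    unfold trunc
    by_cases h1 : 1 / ((n:ℝ) + 1) < r.1 ∧ r.1 < T
    · rw [if_pos h1, if_pos ⟨lt_trans (by positivity) h1.1, h1.2⟩]
    · rw [if_neg h1, norm_zero]; positivity
  · refine Filter.Tendsto.mul_const _ (tendsto_const_nhds.congr' ?_)
    unfold trunc
    rcases le_or_gt r.1 0 with h0 | h0
    · refine Filter.Eventually.of_forall fun n => ?_
      have : ¬ (1 / ((n:ℝ) + 1) < r.1) := not_lt.2 (h0.trans (by positivity))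
      rw [if_neg fun h => not_lt.2 h0 h.1]
      exact (if_neg fun h => this h.1).symm
    · filter_upwards [tendsto_one_div_add_atTop_nhds_zero_nat.eventually_lt_const h0] with n hn
      simp only [h0, hn, true_and]

theorem exists_eLpNorm_cv_dK_dx_le {p : ℝ} (hp : 1 < p) : ∃ C : ℝ≥0∞, C ≠ ⊤ ∧
    ∀ (i j : Fin 3) (T : ℝ), 0 ≤ T → ∀ h : ℝ × E3 → ℝ, ContDiff ℝ (⊤ : ℕ∞) h → HasCompactSupport h →
      eLpNorm (cv (trunc (dK i) 0 T) (dx j h)) (ENNReal.ofReal p) volume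
        ≤ C * eLpNorm h (ENNReal.ofReal p) volume := by
  obtain ⟨C, hC, hb⟩ := exists_ddKTrunc_bound hp
  have h0 : 0 < p := by linarith
  refine ⟨C ^ (1 / p), ENNReal.rpow_ne_top_of_nonneg (by positivity) hC, fun i j T hT h hh hc => ?_⟩
  have hlim := fun q => tendsto_cv_trunc (measurable_dK i) (integrable_trunc_dK i le_rfl hT)
    (continuous_dx (j := j) hh) (hasCompactSupport_dx hc) q
  refine (Lp.eLpNorm_lim_le_liminf_eLpNorm (fun n => (measurable_cv
    (measurable_trunc (measurable_dK i) _ T) (continuous_dx hh).measurable).aestronglyMeasurable) _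
    (ae_of_all _ hlim)).trans ?_
  refine (Filter.liminf_le_liminf (Filter.Eventually.of_forall fun n => ?_)).trans_eq
    (Filter.liminf_const (C ^ (1 / p) * eLpNorm h (ENNReal.ofReal p) volume))
  have hn : 0 < 1 / ((n:ℝ) + 1) := by positivity
  rw [cv_dx (integrable_trunc_dK i hn.le hT) (integrable_ddKTrunc j i hn)
    (fun s z => (hasFDerivAt_dK i s z).differentiableAt) (fun s z => fderiv_dK_single j i s z) hn.le
    (fun s => integrable_dK i) (fun s => integrable_ddK j i) hh hc,
    ← ENNReal.rpow_le_rpow_iff h0, ENNReal.mul_rpow_of_nonneg _ _ h0.le, eLpNorm_ofReal_rpow hp,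
    eLpNorm_ofReal_rpow hp, ← ENNReal.rpow_mul, one_div_mul_cancel h0.ne', ENNReal.rpow_one]
  exact hb j i _ T hn h hh.continuous hc

theorem ae_integrable_slice_test {p : ℝ} (hp : 1 < p) {V : ℝ × E3 → ℝ} (hV : Measurable V)
    (hVp : MemLp V (ENNReal.ofReal p)) : ∀ᵐ t : ℝ, ∀ ψ : E3 → ℝ, Continuous ψ → HasCompactSupport ψ →
      Integrable fun x => V (t, x) * ψ x := by
  have h0 : 0 < p := by linarith
  have hlt : ∫⁻ t, ∫⁻ x, ‖V (t, x)‖ₑ ^ p ≠ ⊤ := by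
    rw [← lintegral_prod (fun q => ‖V q‖ₑ ^ p) (hV.enorm.pow_const p).aemeasurable,
      ← Measure.volume_eq_prod, ← eLpNorm_ofReal_rpow hp]
    exact ENNReal.rpow_ne_top_of_nonneg h0.le hVp.2.ne
  filter_upwards [ae_lt_top (hV.enorm.pow_const p).lintegral_prod_right' hlt] with t ht ψ hψ hψc
  have hm : MemLp (fun x => V (t, x)) (ENNReal.ofReal p) := by
    refine ⟨(hV.comp measurable_prodMk_left).aestronglyMeasurable, ?_⟩
    rw [← ENNReal.rpow_lt_top_iff_of_pos h0, eLpNorm_ofReal_rpow hp]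
    exact ht
  have := (hm.locallyIntegrable (by simpa using hp.le)).integrable_smul_left_of_hasCompactSupport hψ hψc
  exact this.congr (ae_of_all _ fun x => mul_comm _ _)

theorem HasWeakPd.sub {p : ℝ} (hp : 1 < p) {j : Fin 3} {U V W Z : ℝ × E3 → ℝ}
    (h1 : HasWeakPd j U W) (h2 : HasWeakPd j V Z)
    (hU : Measurable U) (hUp : MemLp U (ENNReal.ofReal p))
    (hV : Measurable V) (hVp : MemLp V (ENNReal.ofReal p))
    (hW : Measurable W) (hWp : MemLp W (ENNReal.ofReal p))
    (hZ : Measurable Z) (hZp : MemLp Z (ENNReal.ofReal p)) : HasWeakPd j (U - V) (W - Z) := by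
  filter_upwards [h1, h2, ae_integrable_slice_test hp hU hUp, ae_integrable_slice_test hp hV hVp,
    ae_integrable_slice_test hp hW hWp, ae_integrable_slice_test hp hZ hZp]
    with t e1 e2 iU iV iW iZ φ hφ hc
  simp only [Pi.sub_apply, sub_mul]
  rw [integral_sub (iU _ (pd_continuous hφ j) (pd_hasCompactSupport hc j))
    (iV _ (pd_continuous hφ j) (pd_hasCompactSupport hc j)), integral_sub (iW _ hφ.continuous hc)
    (iZ _ hφ.continuous hc), e1 φ hφ hc, e2 φ hφ hc]
  ring

/-- Extension by zero outside the time interval `(-t₀, 0)`. -/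
def zeroExt (t₀ : ℝ) (g : ℝ → E3 → ℝ) (q : ℝ × E3) : ℝ := if q.1 ∈ Ioo (-t₀) 0 then g q.1 q.2 else 0

theorem measurable_zeroExt {t₀ : ℝ} {g : ℝ → E3 → ℝ} (hg : Measurable fun q : ℝ × E3 => g q.1 q.2) :
    Measurable (zeroExt t₀ g) :=
  Measurable.ite (measurable_fst measurableSet_Ioo) hg measurable_const

theorem eLpNorm_zeroExt_rpow {p t₀ : ℝ} (hp : 1 < p) {g : ℝ → E3 → ℝ}
    (hg : Measurable fun q : ℝ × E3 => g q.1 q.2) :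
    eLpNorm (zeroExt t₀ g) (ENNReal.ofReal p) volume ^ p
      = ∫⁻ t in Ioo (-t₀) 0, ∫⁻ x : E3, ENNReal.ofReal (|g t x| ^ p) := by
  have h0 : 0 < p := by linarith
  rw [eLpNorm_ofReal_rpow hp, Measure.volume_eq_prod,
    lintegral_prod _ ((measurable_zeroExt hg).enorm.pow_const p).aemeasurable,
    ← lintegral_indicator measurableSet_Ioo]
  refine lintegral_congr fun t => ?_
  by_cases ht : t ∈ Ioo (-t₀) 0
  · rw [indicator_of_mem ht]
    refine lintegral_congr fun x => ?_
    simp only [zeroExt, ht, if_true]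
    rw [Real.enorm_eq_ofReal_abs, ENNReal.ofReal_rpow_of_nonneg (abs_nonneg _) h0.le]
  · simp [zeroExt, ht, h0]

theorem integral_kernel_zeroExt {t₀ t : ℝ} {Φ : ℝ × E3 → ℝ} {ψ : ℝ → E3 → ℝ}
    (hΦ : Integrable Φ) (h : ∀ s y, s ∈ Ioo (-t₀) t → Φ (s, y) = ψ s y)
    (h' : ∀ s y, s ∉ Ioo (-t₀) t → Φ (s, y) = 0) :
    ∫ r, Φ r = ∫ s in Ioo (-t₀) t, ∫ y, ψ s y := by
  rw [Measure.volume_eq_prod, integral_prod _ hΦ, ← integral_indicator measurableSet_Ioo]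
  congr 1; ext s
  by_cases hs : s ∈ Ioo (-t₀) t
  · rw [indicator_of_mem hs]; simp_rw [h s _ hs]
  · rw [indicator_of_notMem hs]; simp_rw [h' s _ hs]; simp

theorem trunc_mul_zeroExt_of_mem {t₀ t s : ℝ} {κ : ℝ → E3 → ℝ} {g : ℝ → E3 → ℝ} (ht : t ∈ Ioo (-t₀) 0)
    (x y : E3) (hs : s ∈ Ioo (-t₀) t) :
    trunc κ 0 t₀ ((t, x) - (s, y)) * zeroExt t₀ g (s, y) = κ (t - s) (x - y) * g s y := by
  have h1 : 0 < t - s ∧ t - s < t₀ := ⟨by linarith [hs.2], by linarith [hs.1, ht.2]⟩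
  have h2 : s ∈ Ioo (-t₀) 0 := ⟨hs.1, hs.2.trans ht.2⟩
  simp only [trunc, zeroExt, Prod.mk_sub_mk, if_pos h1, if_pos h2]

theorem trunc_mul_zeroExt_of_notMem {t₀ t s : ℝ} {κ : ℝ → E3 → ℝ} {g : ℝ → E3 → ℝ}
    (x y : E3) (hs : s ∉ Ioo (-t₀) t) :
    trunc κ 0 t₀ ((t, x) - (s, y)) * zeroExt t₀ g (s, y) = 0 := by
  by_cases h1 : 0 < t - s
  · have h2 : s ∉ Ioo (-t₀) 0 := fun h => hs ⟨h.1, by linarith⟩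
    simp only [zeroExt, if_neg h2, mul_zero]
  · have h2 : ¬ (0 < t - s ∧ t - s < t₀) := fun h => h1 h.1
    simp only [trunc, Prod.mk_sub_mk, if_neg h2, zero_mul]

/-- The Duhamel integral as a difference of convolutions on space-time. -/
theorem ae_duhamel_eq {p : ℝ} (hp : 1 < p) {t₀ : ℝ} (ht₀ : 0 < t₀) {f : ℝ → E3 → E3} {g : ℝ → E3 → ℝ}
    (hf : Measurable fun q : ℝ × E3 => f q.1 q.2) (hg : Measurable fun q : ℝ × E3 => g q.1 q.2)
    (hfp : ∀ i, MemLp (zeroExt t₀ fun t x => f t x i) (ENNReal.ofReal p))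
    (hgp : MemLp (zeroExt t₀ g) (ENNReal.ofReal p)) {u : ℝ → E3 → ℝ}
    (hu : ∀ t x, u t x = (∫ s in Set.Ioo (-t₀) t, ∫ y : E3, heatK (t - s) (x - y) * g s y)
        - ∫ s in Set.Ioo (-t₀) t, ∫ y : E3, (fderiv ℝ (heatK (t - s)) (x - y)) (f s y)) :
    ∀ᵐ q : ℝ × E3, q.1 ∈ Ioo (-t₀) 0 → u q.1 q.2 = cv (trunc heatK 0 t₀) (zeroExt t₀ g) q
      - ∑ i, cv (trunc (dK i) 0 t₀) (zeroExt t₀ fun t x => f t x i) q := by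
  have hfi : ∀ i, Measurable fun q : ℝ × E3 => f q.1 q.2 i := fun i => by fun_prop
  have a1 := ae_integrable_mul hp (measurable_trunc measurable_heatK 0 t₀)
    (integrable_trunc_heatK le_rfl) (measurable_zeroExt (t₀ := t₀) hg) hgp
  have a2 := ae_all_iff.2 fun i : Fin 3 =>
    ae_integrable_mul hp (measurable_trunc (measurable_dK i) 0 t₀)
    (integrable_trunc_dK i le_rfl ht₀.le) (measurable_zeroExt (t₀ := t₀) (hfi i)) (hfp i)
  filter_upwards [a1, a2] with ⟨t, x⟩ h1 h2 ht
  rw [hu]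
  congr 1
  · unfold cv
    exact (integral_kernel_zeroExt h1 (fun s y hs => trunc_mul_zeroExt_of_mem ht x y hs)
      fun s y hs => trunc_mul_zeroExt_of_notMem x y hs).symm
  · unfold cv
    rw [← integral_finsetSum _ fun i _ => h2 i]
    refine (integral_kernel_zeroExt (integrable_finsetSum _ fun i _ => h2 i) (fun s y hs => ?_)
      fun s y hs => ?_).symm
    · rw [fderiv_heatK]
      exact Finset.sum_congr rfl fun i _ => trunc_mul_zeroExt_of_mem ht x y hs
    · exact Finset.sum_eq_zero fun i _ => trunc_mul_zeroExt_of_notMem x y hs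

theorem sum_sq_rpow_le {p : ℝ} (hp : 1 < p) (a : Fin 3 → ℝ) :
    ENNReal.ofReal ((∑ j, a j ^ 2) ^ (p / 2)) ≤ ‖|a 0| + |a 1| + |a 2|‖ₑ ^ p := by
  have h0 : 0 < p := by linarith
  rw [Real.enorm_eq_ofReal_abs, ENNReal.ofReal_rpow_of_nonneg (abs_nonneg _) h0.le]
  refine ENNReal.ofReal_le_ofReal ?_
  have e : |(|a 0| + |a 1| + |a 2|)| ^ p = ((|a 0| + |a 1| + |a 2|) ^ 2) ^ (p / 2) := by
    rw [abs_of_nonneg (by positivity), ← Real.rpow_natCast, ← Real.rpow_mul (by positivity)]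
    congr 1; push_cast; ring
  rw [e]
  refine Real.rpow_le_rpow (Finset.sum_nonneg fun j _ => sq_nonneg _) ?_ (by positivity)
  rw [Fin.sum_univ_three, ← sq_abs (a 0), ← sq_abs (a 1), ← sq_abs (a 2)]
  nlinarith [mul_nonneg (abs_nonneg (a 0)) (abs_nonneg (a 1)),
    mul_nonneg (abs_nonneg (a 0)) (abs_nonneg (a 2)), mul_nonneg (abs_nonneg (a 1)) (abs_nonneg (a 2))]

theorem eLpNorm_sub_sub_sub_le {p : ℝ} (hp : 1 < p) {a b c d : ℝ × E3 → ℝ} (ha : Measurable a)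
    (hb : Measurable b) (hc : Measurable c) (hd : Measurable d) {M : ℝ≥0∞}
    (ha' : eLpNorm a (ENNReal.ofReal p) volume ≤ M) (hb' : eLpNorm b (ENNReal.ofReal p) volume ≤ M)
    (hc' : eLpNorm c (ENNReal.ofReal p) volume ≤ M) (hd' : eLpNorm d (ENNReal.ofReal p) volume ≤ M) :
    eLpNorm (a - b - c - d) (ENNReal.ofReal p) volume ≤ 4 * M := by
  have hP : 1 ≤ ENNReal.ofReal p := by simpa using hp.le
  have e : (4:ℝ≥0∞) * M = M + M + M + M := by ring
  rw [e]
  refine (eLpNorm_sub_le ((ha.sub hb).sub hc).aestronglyMeasurable hd.aestronglyMeasurable hP).trans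
    (add_le_add ?_ hd')
  refine (eLpNorm_sub_le (ha.sub hb).aestronglyMeasurable hc.aestronglyMeasurable hP).trans
    (add_le_add ?_ hc')
  exact (eLpNorm_sub_le ha.aestronglyMeasurable hb.aestronglyMeasurable hP).trans (add_le_add ha' hb')

/-- The Duhamel solution on all of space-time: bounds in `L^p` for it and its weak gradient. -/
theorem exists_duhamel_weakPd {p : ℝ} (hp : 1 < p) {t₀ : ℝ} (ht₀ : 0 < t₀) : ∃ D : ℝ≥0∞, D ≠ ⊤ ∧
    ∀ (G : ℝ × E3 → ℝ) (F : Fin 3 → ℝ × E3 → ℝ) (ν : ℝ≥0∞), ν ≠ ⊤ → Measurable G →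
      (∀ i, Measurable (F i)) → eLpNorm G (ENNReal.ofReal p) volume ≤ ν →
      (∀ i, eLpNorm (F i) (ENNReal.ofReal p) volume ≤ ν) →
      ∃ (U : ℝ × E3 → ℝ) (W : Fin 3 → ℝ × E3 → ℝ), Measurable U ∧ (∀ j, Measurable (W j)) ∧
        (∀ q, U q = cv (trunc heatK 0 t₀) G q - ∑ i, cv (trunc (dK i) 0 t₀) (F i) q) ∧
        (∀ j, HasWeakPd j U (W j)) ∧ eLpNorm U (ENNReal.ofReal p) volume ≤ D * ν ∧
        ∀ j, eLpNorm (W j) (ENNReal.ofReal p) volume ≤ D * ν := by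
  obtain ⟨C, hC, hb⟩ := exists_eLpNorm_cv_dK_dx_le hp
  set C₁ := ENNReal.ofReal t₀ * gaussMass with hC₁
  set C₂ := ENNReal.ofReal (2 * t₀ ^ ((1:ℝ)/2)) * gaussMass with hC₂
  have hC₁t : C₁ ≠ ⊤ := ENNReal.mul_ne_top ENNReal.ofReal_ne_top gaussMass_ne_top
  have hC₂t : C₂ ≠ ⊤ := ENNReal.mul_ne_top ENNReal.ofReal_ne_top gaussMass_ne_top
  set M := C₁ + C₂ + C with hM
  have hM1 : C₁ ≤ M := le_self_add.trans le_self_add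
  have hM2 : C₂ ≤ M := le_add_self.trans le_self_add
  have hM3 : C ≤ M := le_add_self
  refine ⟨4 * M, by finiteness, fun G F ν hν hG hF hGν hFν => ?_⟩
  have hGp : MemLp G (ENNReal.ofReal p) := ⟨hG.aestronglyMeasurable, hGν.trans_lt hν.lt_top⟩
  have hFp : ∀ i, MemLp (F i) (ENNReal.ofReal p) := fun i =>
    ⟨(hF i).aestronglyMeasurable, (hFν i).trans_lt hν.lt_top⟩
  have hKm := measurable_trunc measurable_heatK 0 t₀
  have hKi := integrable_trunc_heatK (ε := 0) (T := t₀) le_rfl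
  have hDm := fun i => measurable_trunc (measurable_dK i) 0 t₀
  have hDi := fun i => integrable_trunc_dK i (ε := 0) le_rfl ht₀.le
  choose wg hwgm hwgb hwg using fun j => exists_weakPd hp hKm hKi hC₂t
    (fun h hh hc => eLpNorm_cv_heatK_dx_le hp ht₀.le j hh hc) hG hGp
  choose wf hwfm hwfb hwf using fun i j => exists_weakPd hp (hDm i) (hDi i) hC
    (fun h hh hc => hb i j t₀ ht₀.le h hh hc) (hF i) (hFp i)
  set u := cv (trunc heatK 0 t₀) G with hu
  set v := fun i => cv (trunc (dK i) 0 t₀) (F i) with hv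
  have hum : Measurable u := measurable_cv hKm hG
  have hvm : ∀ i, Measurable (v i) := fun i => measurable_cv (hDm i) (hF i)
  have hup : MemLp u (ENNReal.ofReal p) := memLp_cv hp hKm hKi hG hGp
  have hvp : ∀ i, MemLp (v i) (ENNReal.ofReal p) := fun i => memLp_cv hp (hDm i) (hDi i) (hF i) (hFp i)
  have hub : eLpNorm u (ENNReal.ofReal p) volume ≤ M * ν :=
    (eLpNorm_cv_le hp hKm hG).trans (mul_le_mul' ((lintegral_trunc_heatK_le le_rfl).trans hM1) hGν)
  have hvb : ∀ i, eLpNorm (v i) (ENNReal.ofReal p) volume ≤ M * ν := fun i =>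
    (eLpNorm_cv_le hp (hDm i) (hF i)).trans
      (mul_le_mul' ((lintegral_trunc_dK_le i le_rfl ht₀.le).trans hM2) (hFν i))
  have hgb : ∀ j, eLpNorm (wg j) (ENNReal.ofReal p) volume ≤ M * ν := fun j =>
    (hwgb j).trans (mul_le_mul' hM2 hGν)
  have hfb : ∀ i j, eLpNorm (wf i j) (ENNReal.ofReal p) volume ≤ M * ν := fun i j =>
    (hwfb i j).trans (mul_le_mul' hM3 (hFν i))
  have hMν : M * ν < ⊤ := ENNReal.mul_lt_top (by finiteness) hν.lt_top
  have hgp : ∀ j, MemLp (wg j) (ENNReal.ofReal p) := fun j =>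
    ⟨(hwgm j).aestronglyMeasurable, (hgb j).trans_lt hMν⟩
  have hfp : ∀ i j, MemLp (wf i j) (ENNReal.ofReal p) := fun i j =>
    ⟨(hwfm i j).aestronglyMeasurable, (hfb i j).trans_lt hMν⟩
  refine ⟨u - v 0 - v 1 - v 2, fun j => wg j - wf 0 j - wf 1 j - wf 2 j,
    ((hum.sub (hvm 0)).sub (hvm 1)).sub (hvm 2),
    fun j => (((hwgm j).sub (hwfm 0 j)).sub (hwfm 1 j)).sub (hwfm 2 j), fun q => ?_, fun j => ?_, ?_,
    fun j => ?_⟩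
  · rw [Fin.sum_univ_three]
    simp only [Pi.sub_apply, hv]
    ring
  · refine HasWeakPd.sub hp (HasWeakPd.sub hp (HasWeakPd.sub hp (hwg j) (hwf 0 j) hum hup (hvm 0) (hvp 0)
      (hwgm j) (hgp j) (hwfm 0 j) (hfp 0 j)) (hwf 1 j) (hum.sub (hvm 0)) (hup.sub (hvp 0)) (hvm 1) (hvp 1)
      ((hwgm j).sub (hwfm 0 j)) ((hgp j).sub (hfp 0 j)) (hwfm 1 j) (hfp 1 j)) (hwf 2 j)
      ((hum.sub (hvm 0)).sub (hvm 1)) ((hup.sub (hvp 0)).sub (hvp 1)) (hvm 2) (hvp 2)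
      (((hwgm j).sub (hwfm 0 j)).sub (hwfm 1 j)) (((hgp j).sub (hfp 0 j)).sub (hfp 1 j))
      (hwfm 2 j) (hfp 2 j)
  · rw [mul_assoc]
    exact eLpNorm_sub_sub_sub_le hp hum (hvm 0) (hvm 1) (hvm 2) hub (hvb 0) (hvb 1) (hvb 2)
  · rw [mul_assoc]
    exact eLpNorm_sub_sub_sub_le hp (hwgm j) (hwfm 0 j) (hwfm 1 j) (hwfm 2 j) (hgb j) (hfb 0 j)
      (hfb 1 j) (hfb 2 j)

theorem lintegral_rpow_add_le {p : ℝ} (hp : 1 < p) {U : ℝ × E3 → ℝ} {W : Fin 3 → ℝ × E3 → ℝ}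
    (hU : Measurable U) (hW : ∀ j, Measurable (W j)) {M : ℝ≥0∞}
    (hU' : eLpNorm U (ENNReal.ofReal p) volume ≤ M)
    (hW' : ∀ j, eLpNorm (W j) (ENNReal.ofReal p) volume ≤ M) :
    ∫⁻ t, ∫⁻ x, (‖U (t, x)‖ₑ ^ p + ENNReal.ofReal ((∑ j, W j (t, x) ^ 2) ^ (p / 2)))
      ≤ (4 * M) ^ p := by
  have hP : 1 ≤ ENNReal.ofReal p := by simpa using hp.le
  have hm : Measurable fun q => |W 0 q| + |W 1 q| + |W 2 q| := by fun_prop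
  have hn : ∀ j, eLpNorm (fun q => |W j q|) (ENNReal.ofReal p) volume ≤ M := fun j =>
    (eLpNorm_norm (W j)).trans_le (hW' j)
  have hS : eLpNorm (fun q => |W 0 q| + |W 1 q| + |W 2 q|) (ENNReal.ofReal p) volume ≤ M + M + M := by
    refine (eLpNorm_add_le (f := fun q => |W 0 q| + |W 1 q|) (g := fun q => |W 2 q|)
      (Measurable.aestronglyMeasurable (by fun_prop)) (Measurable.aestronglyMeasurable (by fun_prop))
      hP).trans (add_le_add ?_ (hn 2))
    exact (eLpNorm_add_le (f := fun q => |W 0 q|) (g := fun q => |W 1 q|)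
      (Measurable.aestronglyMeasurable (by fun_prop)) (Measurable.aestronglyMeasurable (by fun_prop))
      hP).trans (add_le_add (hn 0) (hn 1))
  calc _ ≤ ∫⁻ t, ∫⁻ x, (‖U (t, x)‖ₑ ^ p
        + ‖|W 0 (t, x)| + |W 1 (t, x)| + |W 2 (t, x)|‖ₑ ^ p) :=
        lintegral_mono fun t => lintegral_mono fun x =>
          add_le_add le_rfl (sum_sq_rpow_le hp fun j => W j (t, x))
    _ = ∫⁻ q : ℝ × E3, (‖U q‖ₑ ^ p + ‖|W 0 q| + |W 1 q| + |W 2 q|‖ₑ ^ p) := by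
        rw [Measure.volume_eq_prod, lintegral_prod _ (by fun_prop)]
    _ = eLpNorm U (ENNReal.ofReal p) volume ^ p
        + eLpNorm (fun q => |W 0 q| + |W 1 q| + |W 2 q|) (ENNReal.ofReal p) volume ^ p := by
        rw [lintegral_add_left (by fun_prop), eLpNorm_ofReal_rpow hp, eLpNorm_ofReal_rpow hp]
    _ ≤ (eLpNorm U (ENNReal.ofReal p) volume
        + eLpNorm (fun q => |W 0 q| + |W 1 q| + |W 2 q|) (ENNReal.ofReal p) volume) ^ p :=
        ENNReal.add_rpow_le_rpow_add _ _ hp.le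
    _ ≤ (M + (M + M + M)) ^ p := ENNReal.rpow_le_rpow (add_le_add hU' hS) (by linarith)
    _ = (4 * M) ^ p := by congr 1; ring

/-- Parabolic `L^p` regularity (Lemma 2.3, first part): the Duhamel solution of
`∂ₜu − Δu = g + div f`, `u(−t₀) = 0`, with data supported in `B₁`, has a weak spatial
gradient `w` and satisfies `‖u‖_{L^p(W^{1,p}(B₁))}^p ≤ C^p (‖f‖_p^p + ‖g‖_p^p)`. -/
theorem parabolic_Lp_regularity (p : ℝ) (hp : 1 < p) (t₀ : ℝ) (ht₀ : 0 < t₀) :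
    ∃ C > (0:ℝ), ∀ (f : ℝ → E3 → E3) (g : ℝ → E3 → ℝ),
      Measurable (fun q : ℝ × E3 => f q.1 q.2) →
      Measurable (fun q : ℝ × E3 => g q.1 q.2) →
      (∀ t x, x ∉ ball (0:E3) 1 → f t x = 0) →
      (∀ t x, x ∉ ball (0:E3) 1 → g t x = 0) →
      (∫⁻ t in Set.Ioo (-t₀) 0, ∫⁻ x : E3, ENNReal.ofReal (‖f t x‖ ^ p)) < ⊤ →
      (∫⁻ t in Set.Ioo (-t₀) 0, ∫⁻ x : E3, ENNReal.ofReal (|g t x| ^ p)) < ⊤ →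
      ∀ u : ℝ → E3 → ℝ,
      (∀ t x, u t x = (∫ s in Set.Ioo (-t₀) t, ∫ y : E3, heatK (t - s) (x - y) * g s y)
        - ∫ s in Set.Ioo (-t₀) t, ∫ y : E3, (fderiv ℝ (heatK (t - s)) (x - y)) (f s y)) →
      ∃ w : ℝ → E3 → Fin 3 → ℝ,
        (∀ᵐ t ∂(volume.restrict (Set.Ioo (-t₀) 0)),
          ∀ j : Fin 3, ∀ φ : E3 → ℝ, ContDiff ℝ (⊤ : ℕ∞) φ → HasCompactSupport φ →
            ∫ x, u t x * pd φ j x = - ∫ x, w t x j * φ x) ∧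
        (∫⁻ t in Set.Ioo (-t₀) 0, ∫⁻ x in ball (0:E3) 1,
            (ENNReal.ofReal (|u t x| ^ p)
              + ENNReal.ofReal ((∑ j, (w t x j) ^ 2) ^ (p/2))))
          ≤ ENNReal.ofReal (C ^ p) *
              ((∫⁻ t in Set.Ioo (-t₀) 0, ∫⁻ x : E3, ENNReal.ofReal (‖f t x‖ ^ p))
                + ∫⁻ t in Set.Ioo (-t₀) 0, ∫⁻ x : E3, ENNReal.ofReal (|g t x| ^ p)) := by
  have h0 : 0 < p := by linarith
  obtain ⟨D, hD, hmain⟩ := exists_duhamel_weakPd hp ht₀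
  have hDt : 4 * D ≠ ⊤ := by finiteness
  refine ⟨(4 * D).toReal + 1, by positivity, fun f g hf hg _ _ hfN hgN u hu => ?_⟩
  set Nf := ∫⁻ t in Set.Ioo (-t₀) 0, ∫⁻ x : E3, ENNReal.ofReal (‖f t x‖ ^ p)
  set Ng := ∫⁻ t in Set.Ioo (-t₀) 0, ∫⁻ x : E3, ENNReal.ofReal (|g t x| ^ p)
  have hNt : Nf + Ng ≠ ⊤ := by finiteness
  have hfi : ∀ i, Measurable fun q : ℝ × E3 => f q.1 q.2 i := fun i => by fun_prop
  set ν := (Nf + Ng) ^ (1 / p) with hν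
  have hνt : ν ≠ ⊤ := ENNReal.rpow_ne_top_of_nonneg (by positivity) hNt
  have hνp : ν ^ p = Nf + Ng := by
    rw [hν, ← ENNReal.rpow_mul, one_div_mul_cancel h0.ne', ENNReal.rpow_one]
  have hGν : eLpNorm (zeroExt t₀ g) (ENNReal.ofReal p) volume ≤ ν := by
    rw [← ENNReal.rpow_le_rpow_iff h0, hνp, eLpNorm_zeroExt_rpow hp hg]
    exact le_add_self
  have hFν : ∀ i, eLpNorm (zeroExt t₀ fun t x => f t x i) (ENNReal.ofReal p) volume ≤ ν := fun i => by
    rw [← ENNReal.rpow_le_rpow_iff h0, hνp, eLpNorm_zeroExt_rpow hp (hfi i)]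
    refine le_trans (lintegral_mono fun t => lintegral_mono fun x => ?_) le_self_add
    exact ENNReal.ofReal_le_ofReal
      (Real.rpow_le_rpow (abs_nonneg _) (abs_apply_le (f t x) i) h0.le)
  obtain ⟨U, W, hUm, hWm, hUeq, hUW, hUb, hWb⟩ := hmain _ _ ν hνt (measurable_zeroExt hg)
    (fun i => measurable_zeroExt (hfi i)) hGν hFν
  have hae := ae_duhamel_eq hp ht₀ hf hg
    (fun i => ⟨(measurable_zeroExt (hfi i)).aestronglyMeasurable, (hFν i).trans_lt hνt.lt_top⟩)
    ⟨(measurable_zeroExt hg).aestronglyMeasurable, hGν.trans_lt hνt.lt_top⟩ hu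
  simp_rw [← hUeq] at hae
  rw [Measure.volume_eq_prod] at hae
  have hslice : ∀ᵐ t ∂(volume.restrict (Set.Ioo (-t₀) 0)), ∀ᵐ x : E3, u t x = U (t, x) := by
    rw [ae_restrict_iff' measurableSet_Ioo]
    filter_upwards [Measure.ae_ae_of_ae_prod hae] with t ht hmem
    filter_upwards [ht] with x hx using hx hmem
  refine ⟨fun t x j => W j (t, x), ?_, ?_⟩
  · filter_upwards [hslice, ae_restrict_of_ae (ae_all_iff.2 hUW)] with t h1 h2 j φ hφ hc
    rw [← h2 j φ hφ hc]
    refine integral_congr_ae ?_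
    filter_upwards [h1] with x hx
    rw [hx]
  · calc _ ≤ ∫⁻ t in Set.Ioo (-t₀) 0, ∫⁻ x,
          (‖U (t, x)‖ₑ ^ p + ENNReal.ofReal ((∑ j, W j (t, x) ^ 2) ^ (p / 2))) := by
          refine lintegral_mono_ae ?_
          filter_upwards [hslice] with t ht
          refine (setLIntegral_le_lintegral _ _).trans (lintegral_mono_ae ?_)
          filter_upwards [ht] with x hx
          rw [hx, Real.enorm_eq_ofReal_abs, ENNReal.ofReal_rpow_of_nonneg (abs_nonneg _) h0.le]
      _ ≤ ∫⁻ t, ∫⁻ x,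
          (‖U (t, x)‖ₑ ^ p + ENNReal.ofReal ((∑ j, W j (t, x) ^ 2) ^ (p / 2))) :=
          setLIntegral_le_lintegral _ _
      _ ≤ (4 * (D * ν)) ^ p := lintegral_rpow_add_le hp hUm hWm hUb hWb
      _ = (4 * D) ^ p * (Nf + Ng) := by
          rw [← mul_assoc, ENNReal.mul_rpow_of_nonneg _ _ h0.le, hνp]
      _ ≤ _ := by
          refine mul_le_mul_left ?_ _
          rw [← ENNReal.ofReal_rpow_of_nonneg (by positivity) h0.le]
          refine ENNReal.rpow_le_rpow ?_ h0.le
          rw [ENNReal.le_ofReal_iff_toReal_le hDt (by positivity)]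
          linarith
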